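/- Let 0 ≤ Ω < Ω* and 0 < a < a*. Then there exists a constant M > 0 with V(x) − (Ω²/4)|x|² > −M on ℝ², and for every u ∈ S_a one has the coercivity estimate E_a(u) ≥ ((a*−a)/(2a*)) ∫_{ℝ²} |∇|u||² dx − C a³ a*/(a*−a) − aM, where C > 0 is a universal constant; in particular E_a is bounded from below on S_a, so e(a) > −∞. -/

import Mathlib

open MeasureTheory Filter Topology Set Metric

noncomputable section

/-- The plane `ℝ²` with the Euclidean norm. -/
abbrev Plane : Type := EuclideanSpace ℝ (Fin 2)

def e0 : Plane := EuclideanSpace.single (0 : Fin 2) (1 : ℝ)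
def e1 : Plane := EuclideanSpace.single (1 : Fin 2) (1 : ℝ)

/-- Partial derivatives of a complex-valued function. -/
def d0 (u : Plane → ℂ) (x : Plane) : ℂ := fderiv ℝ u x e0
def d1 (u : Plane → ℂ) (x : Plane) : ℂ := fderiv ℝ u x e1

/-- `|∇u|²` for complex-valued `u`. -/
def gradSq (u : Plane → ℂ) (x : Plane) : ℝ := ‖d0 u x‖ ^ 2 + ‖d1 u x‖ ^ 2

/-- `|∇|u||²`. -/
def gradAbsSq (u : Plane → ℂ) (x : Plane) : ℝ := ‖fderiv ℝ (fun y => ‖u y‖) x‖ ^ 2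

/-- Membership in `H¹(ℝ², ℂ)` (smooth-representative formulation). -/
def InH1 (u : Plane → ℂ) : Prop :=
  Differentiable ℝ u ∧ Integrable (fun x => ‖u x‖ ^ 2) ∧ Integrable (gradSq u)

/-- Membership in the space `𝓗 = {u ∈ H¹ : ∫ V |u|² < ∞}`. -/
def InH (V : Plane → ℝ) (u : Plane → ℂ) : Prop :=
  InH1 u ∧ Integrable (fun x => V x * ‖u x‖ ^ 2)

/-- The constraint set `S_a`. -/
def Sset (V : Plane → ℝ) (a : ℝ) : Set (Plane → ℂ) :=
  {u | InH V u ∧ (∫ x : Plane, ‖u x‖ ^ 2) = a}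

/-- The momentum density `x^⊥ · (iu, ∇u)`, with `x^⊥ = (-x₂, x₁)` and
`(iu,∇u)_j = Im(ū ∂_j u)`. -/
def momentum (u : Plane → ℂ) (x : Plane) : ℝ :=
  (-(x 1)) * ((starRingEnd ℂ) (u x) * d0 u x).im + (x 0) * ((starRingEnd ℂ) (u x) * d1 u x).im

/-- The logarithmic convolution term `∫∫ ln|x-y| |u(x)|²|u(y)|²`. -/
def logConv (u : Plane → ℂ) : ℝ :=
  ∫ x : Plane, ∫ y : Plane, Real.log ‖x - y‖ * ‖u x‖ ^ 2 * ‖u y‖ ^ 2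

/-- The energy functional `E_a`. -/
def Ea (V : Plane → ℝ) (Ω : ℝ) (u : Plane → ℂ) : ℝ :=
  (∫ x : Plane, (gradSq u x + V x * ‖u x‖ ^ 2)) + (1 / 2) * logConv u
    - (1 / 2) * (∫ x : Plane, ‖u x‖ ^ 4) - Ω * (∫ x : Plane, momentum u x)

/-- `u` is a minimizer of `e(a) = inf_{S_a} E_a`. -/
def IsMinimizer (V : Plane → ℝ) (Ω a : ℝ) (u : Plane → ℂ) : Prop :=
  u ∈ Sset V a ∧ ∀ v ∈ Sset V a, Ea V Ω u ≤ Ea V Ω v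

/-- `e(a) = inf_{u ∈ S_a} E_a(u)`. -/
def eInf (V : Plane → ℝ) (Ω a : ℝ) : ℝ := sInf (Ea V Ω '' Sset V a)

/-- `f(x) → ∞` as `|x| → ∞`. -/
def TendsInfty (f : Plane → ℝ) : Prop := ∀ M : ℝ, ∃ R : ℝ, ∀ x : Plane, R ≤ ‖x‖ → M ≤ f x

/-- Hypotheses (1.10): `0 ≤ V ∈ L^∞_loc` and `liminf_{|x|→∞} V(x)/|x|² > 0`. -/
def V110 (V : Plane → ℝ) : Prop :=
  Measurable V ∧ (∀ x, 0 ≤ V x) ∧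
  (∀ R : ℝ, ∃ C : ℝ, ∀ x : Plane, ‖x‖ ≤ R → V x ≤ C) ∧
  (∃ c : ℝ, 0 < c ∧ ∃ R : ℝ, ∀ x : Plane, R ≤ ‖x‖ → c * ‖x‖ ^ 2 ≤ V x)

/-- The set of rotational velocities `W > 0` with `V(x) - (W²/4)|x|² → ∞`;
`Ω* = sup RotSet V`. -/
def RotSet (V : Plane → ℝ) : Set ℝ :=
  {W : ℝ | 0 < W ∧ TendsInfty (fun x => V x - W ^ 2 / 4 * ‖x‖ ^ 2)}

/-- `Ω < Ω*` where `Ω* = sup RotSet V` (possibly `+∞`). -/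
def SubCritical (V : Plane → ℝ) (Ω : ℝ) : Prop := ∃ W ∈ RotSet V, Ω < W

def d0R (q : Plane → ℝ) (x : Plane) : ℝ := fderiv ℝ q x e0
def d1R (q : Plane → ℝ) (x : Plane) : ℝ := fderiv ℝ q x e1

/-- `|∇q|²` for real-valued `q`. -/
def gradSqR (q : Plane → ℝ) (x : Plane) : ℝ := (d0R q x) ^ 2 + (d1R q x) ^ 2

/-- The Laplacian of a real-valued function. -/
def lapR (q : Plane → ℝ) (x : Plane) : ℝ := fderiv ℝ (d0R q) x e0 + fderiv ℝ (d1R q) x e1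

/-- `Q` is the positive radially symmetric `H¹` solution of `-ΔQ + Q - Q³ = 0` on `ℝ²`. -/
def IsGroundState (Q : Plane → ℝ) : Prop :=
  ContDiff ℝ 2 Q ∧ (∀ x, 0 < Q x) ∧ (∀ x y : Plane, ‖x‖ = ‖y‖ → Q x = Q y) ∧
  Integrable (fun x => (Q x) ^ 2) ∧ Integrable (fun x => ‖fderiv ℝ Q x‖ ^ 2) ∧
  (∀ x, - lapR Q x + Q x - (Q x) ^ 3 = 0)

/-- The Laplacian of a complex-valued function. -/
def lapC (u : Plane → ℂ) (x : Plane) : ℂ := fderiv ℝ (d0 u) x e0 + fderiv ℝ (d1 u) x e1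

/-- The Euler–Lagrange equation (1.18):
`-Δu + V u + (∫ ln|x-y||u(y)|² dy) u + iΩ (x^⊥·∇u) = μ u + |u|² u`. -/
def EulerLagrange (V : Plane → ℝ) (Ω : ℝ) (u : Plane → ℂ) (μ : ℝ) : Prop :=
  ∀ x : Plane,
    - lapC u x + (V x : ℂ) * u x
      + (((∫ y : Plane, Real.log ‖x - y‖ * ‖u y‖ ^ 2) : ℝ) : ℂ) * u x
      + Complex.I * (Ω : ℂ) * (((-(x 1) : ℝ) : ℂ) * d0 u x + ((x 0 : ℝ) : ℂ) * d1 u x)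
    = (μ : ℂ) * u x + ((‖u x‖ ^ 2 : ℝ) : ℂ) * u x

/-- Condition (V): `0 ≤ V_Ω ∈ C^α_loc`, `V_Ω` vanishes only at the origin, and `V` has at
most exponential growth. Here `V_Ω(x) = V(x) - (Ω²/4)|x|²`. -/
def CondV (V : Plane → ℝ) (Ω α : ℝ) : Prop :=
  α ∈ Ioo (0 : ℝ) 1 ∧
  (∀ x : Plane, 0 ≤ V x - Ω ^ 2 / 4 * ‖x‖ ^ 2) ∧
  (∀ x : Plane, V x - Ω ^ 2 / 4 * ‖x‖ ^ 2 = 0 ↔ x = 0) ∧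
  (∀ R : ℝ, 0 < R → ∃ C : ℝ, ∀ x ∈ closedBall (0 : Plane) R, ∀ y ∈ closedBall (0 : Plane) R,
    |(V x - Ω ^ 2 / 4 * ‖x‖ ^ 2) - (V y - Ω ^ 2 / 4 * ‖y‖ ^ 2)| ≤ C * ‖x - y‖ ^ α) ∧
  (∃ C γ : ℝ, 0 < γ ∧ ∀ x : Plane, V x ≤ C * Real.exp (γ * ‖x‖))

/-- `ε_a = (∫ |∇|u_a||²)^{-1/2}` for a family of minimizers. -/
def epsOf (u : ℝ → Plane → ℂ) (a : ℝ) : ℝ :=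
  (∫ x : Plane, gradAbsSq (u a) x) ^ (-(1 : ℝ) / 2)

/-- The rescaled family
`w_a(y) = ε_a u_a(ε_a y + x_a) e^{-i((ε_a Ω/2) y·x_a^⊥ - θ)}`. -/
def wfam (Ω : ℝ) (u : ℝ → Plane → ℂ) (xa : ℝ → Plane) (a θv : ℝ) (y : Plane) : ℂ :=
  ((epsOf u a : ℝ) : ℂ) * u a ((epsOf u a) • y + xa a) *
    Complex.exp (-Complex.I *
      ((((epsOf u a * Ω / 2) * (-(y 0) * (xa a 1) + (y 1) * (xa a 0)) - θv) : ℝ) : ℂ))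

/-- The limit profile `(1/√a*) Q(x/√a*)` where `a* = ‖Q‖₂²`. -/
def Qstar (Q : Plane → ℝ) (x : Plane) : ℝ :=
  (Real.sqrt (∫ y : Plane, (Q y) ^ 2))⁻¹ * Q ((Real.sqrt (∫ y : Plane, (Q y) ^ 2))⁻¹ • x)

/-! ### The planar Brunn–Minkowski inequality -/

theorem volume_add_le_of_isCompact {K L Z : Set ℝ} (hK : IsCompact K) (hL : IsCompact L)
    (hK0 : K.Nonempty) (hL0 : L.Nonempty) (h : ∀ x ∈ K, ∀ y ∈ L, x + y ∈ Z) :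
    volume K + volume L ≤ volume Z := by
  obtain ⟨k, hk, hkm⟩ := hK.exists_isGreatest hK0
  obtain ⟨l, hl, hlm⟩ := hL.exists_isLeast hL0
  have hKm : MeasurableSet ((fun x => -l + x) ⁻¹' K) :=
    hK.measurableSet.preimage (measurable_const_add _)
  have hLm : MeasurableSet ((fun x => -k + x) ⁻¹' L) :=
    hL.measurableSet.preimage (measurable_const_add _)
  have hinter : volume (((fun x => -l + x) ⁻¹' K) ∩ ((fun x => -k + x) ⁻¹' L)) = 0 := by
    refine measure_mono_null (t := {k + l}) ?_ (by simp)
    rintro z ⟨hz1, hz2⟩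
    have h1 : -l + z ≤ k := hkm hz1
    have h2 : l ≤ -k + z := hlm hz2
    simp only [mem_singleton_iff]
    linarith
  calc volume K + volume L
      = volume ((fun x => -l + x) ⁻¹' K) + volume ((fun x => -k + x) ⁻¹' L) := by
        rw [measure_preimage_add, measure_preimage_add]
    _ = volume (((fun x => -l + x) ⁻¹' K) ∪ ((fun x => -k + x) ⁻¹' L)) := by
        rw [← measure_union_add_inter _ hLm, hinter, add_zero]
    _ ≤ volume Z := by
        refine measure_mono ?_
        rintro z (hz | hz)
        · have := h _ hz _ hl
          simpa using this
        · have := h _ hk _ hz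
          simpa using this

theorem volume_add_le {X Y Z : Set ℝ} (hX : MeasurableSet X) (hY : MeasurableSet Y)
    (hX0 : X.Nonempty) (hY0 : Y.Nonempty) (h : ∀ x ∈ X, ∀ y ∈ Y, x + y ∈ Z) :
    volume X + volume Y ≤ volume Z := by
  obtain ⟨x₀, hx₀⟩ := hX0
  obtain ⟨y₀, hy₀⟩ := hY0
  have key : ∀ K : Set ℝ, K ⊆ X → IsCompact K → ∀ L : Set ℝ, L ⊆ Y → IsCompact L →
      volume K + volume L ≤ volume Z := by
    intro K hKX hK L hLY hL
    calc volume K + volume L ≤ volume (insert x₀ K) + volume (insert y₀ L) := by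
          gcongr <;> exact subset_insert _ _
      _ ≤ volume Z := by
          refine volume_add_le_of_isCompact (hK.insert _) (hL.insert _) (insert_nonempty _ _)
            (insert_nonempty _ _) ?_
          intro x hx y hy
          exact h _ (insert_subset hx₀ hKX hx) _ (insert_subset hy₀ hLY hy)
  rw [hX.measure_eq_iSup_isCompact, hY.measure_eq_iSup_isCompact]
  simp only [iSup_and']
  refine ENNReal.biSup_add_biSup_le' ⟨∅, by simp⟩ ⟨∅, by simp⟩ ?_
  rintro K ⟨hKX, hK⟩ L ⟨hLY, hL⟩
  exact key K hKX hK L hLY hL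

theorem lintegral_ofReal_eq_lintegral_Ioo {X : Type*} [MeasurableSpace X] (μ : Measure X)
    {f : X → ℝ} (hf : Measurable f) (h0 : ∀ x, 0 ≤ f x) (h1 : ∀ x, f x ≤ 1) :
    ∫⁻ x, ENNReal.ofReal (f x) ∂μ = ∫⁻ t in Ioo (0 : ℝ) 1, μ {x | t < f x} := by
  rw [lintegral_eq_lintegral_meas_lt μ (Eventually.of_forall h0) hf.aemeasurable,
    ← Ioo_union_Ici_eq_Ioi (zero_lt_one (α := ℝ)),
    lintegral_union measurableSet_Ici (by
      rw [Set.disjoint_left]; intro t ht ht'; exact absurd ht.2 (not_lt.mpr ht'))]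
  have : ∫⁻ t in Ici (1 : ℝ), μ {x | t < f x} = 0 := by
    rw [setLIntegral_congr_fun (g := fun _ => 0) measurableSet_Ici]
    · simp
    · intro t ht
      have : {x | t < f x} = ∅ := by
        ext x
        simp only [mem_ofPred_eq, mem_empty_iff_false, iff_false, not_lt]
        exact (h1 x).trans ht
      simp [this]
  rw [this, add_zero]

/-- A non-optimised form of the planar Brunn–Minkowski inequality obtained by slicing. -/
theorem slice_brunn_minkowski {A B C : Set (ℝ × ℝ)} (hA : MeasurableSet A) (hB : MeasurableSet B)
    (hC : MeasurableSet C) (h : ∀ x ∈ A, ∀ y ∈ B, x + y ∈ C)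
    {α β : ℝ} (hα : 0 < α) (hβ : 0 < β)
    (hAα : ∀ x, volume (Prod.mk x ⁻¹' A) ≤ ENNReal.ofReal α)
    (hBβ : ∀ x, volume (Prod.mk x ⁻¹' B) ≤ ENNReal.ofReal β)
    (hAα' : ∀ t < α, ∃ x, t < (volume (Prod.mk x ⁻¹' A)).toReal)
    (hBβ' : ∀ t < β, ∃ x, t < (volume (Prod.mk x ⁻¹' B)).toReal) :
    ENNReal.ofReal (α + β) * (volume A / ENNReal.ofReal α + volume B / ENNReal.ofReal β)
      ≤ volume C := by
  have slice : ∀ {S : Set (ℝ × ℝ)}, MeasurableSet S → ∀ {γ : ℝ}, 0 < γ →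
      (∀ x, volume (Prod.mk x ⁻¹' S) ≤ ENNReal.ofReal γ) →
      Measurable (fun x => (volume (Prod.mk x ⁻¹' S)).toReal / γ) ∧
      volume S / ENNReal.ofReal γ =
        ∫⁻ t in Ioo (0 : ℝ) 1, volume {x | t < (volume (Prod.mk x ⁻¹' S)).toReal / γ} := by
    intro S hS γ hγ hb
    have hm : Measurable (fun x => (volume (Prod.mk x ⁻¹' S)).toReal / γ) :=
      (measurable_measure_prodMk_left hS).ennreal_toReal.div_const _
    refine ⟨hm, ?_⟩
    rw [← lintegral_ofReal_eq_lintegral_Ioo volume hm (fun x => by positivity)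
      (fun x => by
        rw [div_le_one hγ]
        exact ENNReal.toReal_le_of_le_ofReal hγ.le (hb x)), Measure.volume_eq_prod,
      Measure.prod_apply hS, div_eq_mul_inv,
      ← lintegral_mul_const _ (measurable_measure_prodMk_left hS)]
    refine lintegral_congr fun x => ?_
    rw [ENNReal.ofReal_div_of_pos hγ, ENNReal.ofReal_toReal ((hb x).trans_lt (by simp)).ne,
      div_eq_mul_inv]
  obtain ⟨hAm, hAe⟩ := slice hA hα hAα
  obtain ⟨hBm, hBe⟩ := slice hB hβ hBβ
  have hαβ : 0 < α + β := by linarith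
  set c : ℝ → ℝ := fun z => (min (volume (Prod.mk z ⁻¹' C)) (ENNReal.ofReal (α + β))).toReal
    / (α + β) with hc
  have hcm : Measurable c :=
    (((measurable_measure_prodMk_left hC).min measurable_const).ennreal_toReal).div_const _
  have hcfin : ∀ z, min (volume (Prod.mk z ⁻¹' C)) (ENNReal.ofReal (α + β)) ≠ ⊤ := fun z =>
    ((min_le_right _ _).trans_lt ENNReal.ofReal_lt_top).ne
  have hce : ENNReal.ofReal (α + β) * ∫⁻ t in Ioo (0 : ℝ) 1, volume {x | t < c x} ≤ volume C := by
    rw [← lintegral_ofReal_eq_lintegral_Ioo volume hcm (fun x => by positivity)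
      (fun x => by
        rw [hc, div_le_one hαβ]
        exact ENNReal.toReal_le_of_le_ofReal hαβ.le (min_le_right _ _)), Measure.volume_eq_prod,
      Measure.prod_apply hC, ← lintegral_const_mul _ (by fun_prop)]
    refine lintegral_mono fun x => ?_
    rw [← ENNReal.ofReal_mul hαβ.le, hc]
    simp only
    rw [mul_div_cancel₀ _ hαβ.ne', ENNReal.ofReal_toReal (hcfin x)]
    exact min_le_left _ _
  refine le_trans ?_ hce
  gcongr
  rw [hAe, hBe, ← lintegral_add_left']
  · refine setLIntegral_mono' measurableSet_Ioo fun t ht => ?_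
    obtain ⟨x₁, hx₁⟩ := hAα' (t * α) (by nlinarith [ht.2])
    obtain ⟨y₁, hy₁⟩ := hBβ' (t * β) (by nlinarith [ht.2])
    refine volume_add_le (measurableSet_lt measurable_const hAm)
      (measurableSet_lt measurable_const hBm) ⟨x₁, by simpa [lt_div_iff₀ hα] using hx₁⟩
      ⟨y₁, by simpa [lt_div_iff₀ hβ] using hy₁⟩ ?_
    intro x hx y hy
    simp only [mem_ofPred_eq, lt_div_iff₀ hα, lt_div_iff₀ hβ] at hx hy
    have hxpos : 0 < volume (Prod.mk x ⁻¹' A) := by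
      rw [pos_iff_ne_zero]; intro h0; rw [h0] at hx
      simp at hx; nlinarith [ht.1]
    have hypos : 0 < volume (Prod.mk y ⁻¹' B) := by
      rw [pos_iff_ne_zero]; intro h0; rw [h0] at hy
      simp at hy; nlinarith [ht.1]
    have hsum := volume_add_le (measurable_prodMk_left hA) (measurable_prodMk_left hB)
      (nonempty_of_measure_ne_zero hxpos.ne') (nonempty_of_measure_ne_zero hypos.ne')
      (Z := Prod.mk (x + y) ⁻¹' C) (fun a ha b hb => h _ ha _ hb)
    simp only [mem_ofPred_eq, hc, lt_div_iff₀ hαβ]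
    rw [← ENNReal.ofReal_lt_iff_lt_toReal (by nlinarith [ht.1]) (hcfin _), lt_min_iff]
    constructor
    · refine lt_of_lt_of_le ?_ hsum
      rw [mul_add, ENNReal.ofReal_add (by nlinarith [ht.1]) (by nlinarith [ht.1])]
      exact ENNReal.add_lt_add
        ((ENNReal.ofReal_lt_iff_lt_toReal (by nlinarith [ht.1])
          ((hAα x).trans_lt ENNReal.ofReal_lt_top).ne).mpr hx)
        ((ENNReal.ofReal_lt_iff_lt_toReal (by nlinarith [ht.1])
          ((hBβ y).trans_lt ENNReal.ofReal_lt_top).ne).mpr hy)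
    · exact (ENNReal.ofReal_lt_ofReal_iff hαβ).mpr (by nlinarith [ht.2])
  · refine Measurable.aemeasurable ?_
    exact Antitone.measurable fun s t hst =>
      measure_mono fun x (hx : t < _) => lt_of_le_of_lt hst hx

/-- Cartesian coordinates on the plane. -/
def planeCoords : Plane ≃ᵐ ℝ × ℝ :=
  (MeasurableEquiv.toLp 2 (Fin 2 → ℝ)).symm.trans (MeasurableEquiv.finTwoArrow (α := ℝ))

theorem planeCoords_apply (x : Plane) : planeCoords x = (x 0, x 1) := rfl

theorem planeCoords_symm_add (x y : ℝ × ℝ) :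
    planeCoords.symm (x + y) = planeCoords.symm x + planeCoords.symm y := by
  apply planeCoords.injective
  rw [planeCoords.apply_symm_apply]
  have h1 := planeCoords.apply_symm_apply x
  have h2 := planeCoords.apply_symm_apply y
  rw [planeCoords_apply] at h1 h2 ⊢
  ext
  · have a := congrArg Prod.fst h1
    have b := congrArg Prod.fst h2
    simp only at a b
    simp [a, b]
  · have a := congrArg Prod.snd h1
    have b := congrArg Prod.snd h2
    simp only at a b
    simp [a, b]

theorem measurePreserving_planeCoords : MeasurePreserving planeCoords :=
  (volume_preserving_finTwoArrow ℝ).comp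
    (EuclideanSpace.volume_preserving_symm_measurableEquiv_toLp (Fin 2))

theorem volume_preimage_planeCoords_symm (A : Set Plane) :
    volume (planeCoords.symm ⁻¹' A) = volume A :=
  measurePreserving_planeCoords.symm.measure_preimage_equiv A

theorem norm_sq_planeCoords_symm (p : ℝ × ℝ) : ‖planeCoords.symm p‖ ^ 2 = p.1 ^ 2 + p.2 ^ 2 := by
  have h1 := planeCoords.apply_symm_apply p
  rw [planeCoords_apply] at h1
  rw [EuclideanSpace.norm_sq_eq, Fin.sum_univ_two]
  have a := congrArg Prod.fst h1
  have b := congrArg Prod.snd h1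
  simp only at a b
  simp [a, b]

theorem volume_plane_ball {r : ℝ} (hr : 0 ≤ r) (x : Plane) :
    volume (ball x r) = ENNReal.ofReal (Real.pi * r ^ 2) := by
  rw [EuclideanSpace.volume_ball]
  simp only [Fintype.card_fin, Nat.cast_ofNat, div_self (two_ne_zero (α := ℝ)), one_add_one_eq_two,
    Real.Gamma_two, div_one]
  rw [← ENNReal.ofReal_pow hr, ← ENNReal.ofReal_mul (by positivity), mul_comm,
    Real.sq_sqrt Real.pi_pos.le]

/-- The planar Brunn–Minkowski inequality for the `ε`-neighbourhood of a set. -/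
theorem plane_brunn_minkowski {A Z : Set Plane} (hA : MeasurableSet A)
    (hAb : Bornology.IsBounded A) (hA0 : A.Nonempty) (hZ : MeasurableSet Z) {ε ρ : ℝ} (hε : 0 < ε)
    (hρ : 0 ≤ ρ) (hAρ : ENNReal.ofReal (Real.pi * ρ ^ 2) ≤ volume A)
    (h : ∀ x ∈ A, ∀ z, dist x z < ε → z ∈ Z) :
    ENNReal.ofReal (Real.pi * (ρ + ε) ^ 2) ≤ volume Z := by
  rcases hρ.eq_or_lt with rfl | hρ
  · obtain ⟨x, hx⟩ := hA0
    rw [zero_add, ← volume_plane_ball hε.le x]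
    exact measure_mono fun z hz => h x hx z (by rwa [dist_comm])
  set A' : Set (ℝ × ℝ) := planeCoords.symm ⁻¹' A with hA'
  set B' : Set (ℝ × ℝ) := planeCoords.symm ⁻¹' ball 0 ε with hB'
  set Z' : Set (ℝ × ℝ) := planeCoords.symm ⁻¹' Z with hZ'
  have hA'm : MeasurableSet A' := planeCoords.symm.measurable hA
  have hB'm : MeasurableSet B' := planeCoords.symm.measurable measurableSet_ball
  have hZ'm : MeasurableSet Z' := planeCoords.symm.measurable hZ
  have hsub : ∀ x ∈ A', ∀ y ∈ B', x + y ∈ Z' := by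
    intro x hx y hy
    refine h _ hx _ ?_
    rw [planeCoords_symm_add, dist_self_add_right]
    simpa [hB'] using hy
  obtain ⟨R, hR⟩ := hAb.exists_norm_le
  have hslice : ∀ x, volume (Prod.mk x ⁻¹' A') ≤ ENNReal.ofReal (2 * R) := by
    intro x
    calc volume (Prod.mk x ⁻¹' A') ≤ volume (Icc (-R) R) := by
          refine measure_mono fun y hy => ?_
          have h1 := hR _ hy
          have h2 := norm_sq_planeCoords_symm (x, y)
          simp only at h2
          have h3 : y ^ 2 ≤ R ^ 2 := by
            nlinarith [norm_nonneg (planeCoords.symm (x, y)), sq_nonneg x]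
          exact abs_le.mp (abs_le_of_sq_le_sq h3 ((norm_nonneg _).trans h1))
      _ = ENNReal.ofReal (2 * R) := by rw [Real.volume_Icc]; congr 1; ring
  set a : ℝ → ℝ := fun x => (volume (Prod.mk x ⁻¹' A')).toReal with ha
  have hbdd : BddAbove (range a) := by
    refine ⟨(ENNReal.ofReal (2 * R)).toReal, ?_⟩
    rintro _ ⟨x, rfl⟩
    exact ENNReal.toReal_mono ENNReal.ofReal_ne_top (hslice x)
  have hfin : ∀ x, volume (Prod.mk x ⁻¹' A') ≠ ⊤ := fun x =>
    ((hslice x).trans_lt ENNReal.ofReal_lt_top).ne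
  set α := sSup (range a) with hαdef
  have hle : ∀ x, a x ≤ α := fun x => le_csSup hbdd ⟨x, rfl⟩
  have hVA : 0 < volume A := lt_of_lt_of_le (ENNReal.ofReal_pos.mpr (by positivity)) hAρ
  have hα : 0 < α := by
    by_contra hcon
    refine hVA.ne' ?_
    rw [← volume_preimage_planeCoords_symm, Measure.volume_eq_prod, Measure.measure_prod_null hA'm]
    refine Eventually.of_forall fun x => ?_
    have h0 : a x = 0 := le_antisymm ((hle x).trans (not_lt.mp hcon)) ENNReal.toReal_nonneg
    exact ((ENNReal.toReal_eq_zero_iff _).mp h0).resolve_right (hfin x)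
  have hB0 : Prod.mk (0 : ℝ) ⁻¹' B' = Ioo (-ε) ε := by
    ext y
    have h2 := norm_sq_planeCoords_symm (0, y)
    simp only [hB', mem_preimage, mem_ball, dist_zero_right, mem_Ioo]
    rw [← abs_lt, ← pow_lt_pow_iff_left₀ (norm_nonneg _) hε.le two_ne_zero, h2,
      ← pow_lt_pow_iff_left₀ (abs_nonneg y) hε.le two_ne_zero, sq_abs]
    simp
  have key := slice_brunn_minkowski hA'm hB'm hZ'm hsub hα (β := 2 * ε) (by linarith)
    (fun x => by
      rw [← ENNReal.ofReal_toReal (hfin x)]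
      exact ENNReal.ofReal_le_ofReal (hle x))
    (fun x => by
      calc volume (Prod.mk x ⁻¹' B') ≤ volume (Ioo (-ε) ε) := by
            rw [← hB0]
            refine measure_mono fun y hy => ?_
            simp only [hB', mem_preimage, mem_ball, dist_zero_right] at hy ⊢
            refine lt_of_le_of_lt ?_ hy
            refine abs_le_of_sq_le_sq' ?_ (norm_nonneg _) |>.2
            rw [norm_sq_planeCoords_symm, norm_sq_planeCoords_symm]
            simp only
            nlinarith [sq_nonneg x]
        _ = ENNReal.ofReal (2 * ε) := by rw [Real.volume_Ioo]; congr 1; ring)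
    (fun t ht => by
      obtain ⟨_, ⟨x, rfl⟩, hx⟩ := exists_lt_of_lt_csSup (range_nonempty a) ht
      exact ⟨x, hx⟩)
    (fun t ht => ⟨0, by
      rw [hB0, Real.volume_Ioo, ENNReal.toReal_ofReal (by linarith)]; linarith⟩)
  rw [volume_preimage_planeCoords_symm, volume_preimage_planeCoords_symm,
    volume_preimage_planeCoords_symm, volume_plane_ball hε.le] at key
  refine le_trans ?_ key
  calc ENNReal.ofReal (Real.pi * (ρ + ε) ^ 2)
      ≤ ENNReal.ofReal ((α + 2 * ε) * (Real.pi * ρ ^ 2 / α + Real.pi * ε ^ 2 / (2 * ε))) := by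
        refine ENNReal.ofReal_le_ofReal ?_
        have : (α + 2 * ε) * (Real.pi * ρ ^ 2 / α + Real.pi * ε ^ 2 / (2 * ε))
            - Real.pi * (ρ + ε) ^ 2 = Real.pi * (2 * ε) / α * (ρ - α / 2) ^ 2 := by
          field_simp
          ring
        have h2 : 0 ≤ Real.pi * (2 * ε) / α * (ρ - α / 2) ^ 2 := by positivity
        linarith
    _ = ENNReal.ofReal (α + 2 * ε) * (ENNReal.ofReal (Real.pi * ρ ^ 2) / ENNReal.ofReal α
          + ENNReal.ofReal (Real.pi * ε ^ 2) / ENNReal.ofReal (2 * ε)) := by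
        rw [ENNReal.ofReal_mul (by positivity), ENNReal.ofReal_add (p := Real.pi * ρ ^ 2 / α)
          (by positivity) (by positivity), ENNReal.ofReal_div_of_pos hα,
          ENNReal.ofReal_div_of_pos (by positivity)]
    _ ≤ _ := by gcongr

/-- Integration of a radial function in polar coordinates. -/
theorem lintegral_fun_norm_plane {f : ℝ → ENNReal} (hf : Measurable f) :
    ∫⁻ x : Plane, f ‖x‖ = ENNReal.ofReal (2 * Real.pi) *
      ∫⁻ r in Ioi (0 : ℝ), ENNReal.ofReal r * f r := by
  calc ∫⁻ x : Plane, f ‖x‖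
      = ∫⁻ x : ({(0)}ᶜ : Set Plane), f (‖x.1‖) ∂((volume : Measure Plane).comap (↑)) := by
        rw [lintegral_subtype_comap (measurableSet_singleton _).compl fun x ↦ f (‖x‖),
          restrict_compl_singleton]
    _ = ∫⁻ x, f x.2 ∂(volume : Measure Plane).toSphere.prod
          (.volumeIoiPow (Module.finrank ℝ Plane - 1)) := by
        rw [← (volume : Measure Plane).measurePreserving_homeomorphUnitSphereProd.lintegral_comp
          (f := fun p => f p.2) (hf.comp (measurable_subtype_coe.comp measurable_snd))]
        simp
    _ = (volume : Measure Plane).toSphere univ *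
          ∫⁻ x : Ioi (0 : ℝ), f x ∂.volumeIoiPow (Module.finrank ℝ Plane - 1) := by
        have hm : Measurable fun p : sphere (0 : Plane) 1 × Ioi (0 : ℝ) => f p.2 :=
          hf.comp (measurable_subtype_coe.comp measurable_snd)
        rw [lintegral_prod _ hm.aemeasurable]
        simp [mul_comm]
    _ = _ := by
        have hm : Measurable fun p : Ioi (0 : ℝ) => f p := hf.comp measurable_subtype_coe
        rw [Measure.volumeIoiPow, lintegral_withDensity_eq_lintegral_mul _ (by fun_prop) hm,
          Measure.toSphere_apply_univ,
          volume_plane_ball zero_le_one]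
        congr 1
        · simp [ENNReal.ofReal_mul]
        · rw [← lintegral_subtype_comap measurableSet_Ioi]
          simp

/-- The decreasing rearrangement of `f`, as a function of the radius. -/
def radialRearrangement (f : Plane → ℝ) (r : ℝ) : ℝ :=
  sInf {t | 0 ≤ t ∧ volume {x | t < f x} ≤ ENNReal.ofReal (Real.pi * r ^ 2)}

section Rearrangement

variable {f : Plane → ℝ}

theorem exists_forall_le_of_hasCompactSupport (hf : Continuous f) (hs : HasCompactSupport f) :
    ∃ M, 0 ≤ M ∧ ∀ x, f x ≤ M := by
  obtain ⟨M, hM⟩ := hs.exists_bound_of_continuous hf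
  exact ⟨M, (norm_nonneg _).trans (hM 0), fun x => (le_abs_self _).trans (hM x)⟩

theorem radialRearrangement_set_nonempty (hf : Continuous f) (hs : HasCompactSupport f) (r : ℝ) :
    {t | 0 ≤ t ∧ volume {x | t < f x} ≤ ENNReal.ofReal (Real.pi * r ^ 2)}.Nonempty := by
  obtain ⟨M, hM, hfM⟩ := exists_forall_le_of_hasCompactSupport hf hs
  refine ⟨M, hM, ?_⟩
  have : {x | M < f x} = ∅ := by
    ext x
    simpa using hfM x
  simp [this]

theorem radialRearrangement_nonneg (r : ℝ) : 0 ≤ radialRearrangement f r :=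
  Real.sInf_nonneg fun _ ht => ht.1

theorem lt_radialRearrangement_iff (hf : Continuous f) (hs : HasCompactSupport f) {t : ℝ}
    (ht : 0 ≤ t) (r : ℝ) :
    t < radialRearrangement f r ↔
      ENNReal.ofReal (Real.pi * r ^ 2) < volume {x | t < f x} := by
  constructor
  · intro h
    by_contra! hc
    have hb : BddBelow {t | 0 ≤ t ∧ volume {x | t < f x} ≤ ENNReal.ofReal (Real.pi * r ^ 2)} :=
      ⟨0, fun _ hs => hs.1⟩
    exact absurd (csInf_le hb ⟨ht, hc⟩) (not_le.mpr h)
  · intro h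
    have hU : {x | t < f x} = ⋃ n : ℕ, {x | t + 1 / ((n : ℝ) + 1) < f x} := by
      ext x
      simp only [mem_ofPred_eq, mem_iUnion]
      constructor
      · intro hx
        obtain ⟨n, hn⟩ := exists_nat_one_div_lt (sub_pos.mpr hx)
        exact ⟨n, by linarith⟩
      · rintro ⟨n, hn⟩
        have : 0 < 1 / ((n : ℝ) + 1) := by positivity
        linarith
    have hmono : Monotone fun n : ℕ => {x | t + 1 / ((n : ℝ) + 1) < f x} := by
      intro m n hmn x hx
      simp only [mem_ofPred_eq] at hx ⊢
      have : 1 / ((n : ℝ) + 1) ≤ 1 / ((m : ℝ) + 1) := by gcongr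
      linarith
    rw [hU, hmono.measure_iUnion, lt_iSup_iff] at h
    obtain ⟨n, hn⟩ := h
    refine lt_of_lt_of_le (b := t + 1 / ((n : ℝ) + 1)) ?_ ?_
    · have : 0 < 1 / ((n : ℝ) + 1) := by positivity
      linarith
    · refine le_csInf (radialRearrangement_set_nonempty hf hs r) fun s hs' => ?_
      by_contra! hc
      refine absurd (hn.trans_le ((measure_mono fun x hx => ?_).trans hs'.2)) (lt_irrefl _)
      exact hc.trans hx

theorem radialRearrangement_anti (hf : Continuous f) (hs : HasCompactSupport f) {r s : ℝ}
    (hr : 0 ≤ r) (hrs : r ≤ s) : radialRearrangement f s ≤ radialRearrangement f r := by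
  refine csInf_le_csInf ⟨0, fun _ hs => hs.1⟩ (radialRearrangement_set_nonempty hf hs r) ?_
  intro t ht
  refine ⟨ht.1, ht.2.trans (ENNReal.ofReal_le_ofReal ?_)⟩
  have := Real.pi_pos
  gcongr

theorem volume_superlevel_ne_top (hs : HasCompactSupport f) {t : ℝ} (ht : 0 ≤ t) :
    volume {x | t < f x} ≠ ⊤ := by
  refine ((measure_mono ?_).trans_lt hs.isCompact.measure_lt_top).ne
  intro x hx
  refine subset_tsupport _ ?_
  simp only [mem_ofPred_eq] at hx
  simp only [Function.mem_support]
  linarith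

/-- The radius of the disc whose area is that of the superlevel set. -/
theorem exists_radius_superlevel (hs : HasCompactSupport f) {t : ℝ} (ht : 0 ≤ t) :
    ∃ ρ, 0 ≤ ρ ∧ volume {x | t < f x} = ENNReal.ofReal (Real.pi * ρ ^ 2) := by
  refine ⟨√((volume {x | t < f x}).toReal / Real.pi), Real.sqrt_nonneg _, ?_⟩
  have := Real.pi_pos
  rw [Real.sq_sqrt (by positivity), mul_div_cancel₀ _ this.ne',
    ENNReal.ofReal_toReal (volume_superlevel_ne_top hs ht)]

theorem lt_radialRearrangement_iff_lt_radius (hf : Continuous f) (hs : HasCompactSupport f)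
    {t ρ : ℝ} (ht : 0 ≤ t) (hρ : 0 ≤ ρ)
    (h : volume {x | t < f x} = ENNReal.ofReal (Real.pi * ρ ^ 2)) {r : ℝ} (hr : 0 ≤ r) :
    t < radialRearrangement f r ↔ r < ρ := by
  have := Real.pi_pos
  rw [lt_radialRearrangement_iff hf hs ht, h,
    ENNReal.ofReal_lt_ofReal_iff_of_nonneg (by positivity),
    mul_lt_mul_iff_right₀ this, pow_lt_pow_iff_left₀ hr hρ two_ne_zero]

theorem radialRearrangement_eq_zero (hf : Continuous f) (hs : HasCompactSupport f) :
    ∃ R, 0 < R ∧ ∀ r, R ≤ r → radialRearrangement f r = 0 := by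
  obtain ⟨ρ, hρ, h⟩ := exists_radius_superlevel hs le_rfl
  refine ⟨ρ + 1, by linarith, fun r hr => ?_⟩
  refine le_antisymm ?_ (radialRearrangement_nonneg r)
  by_contra! hc
  rw [lt_radialRearrangement_iff_lt_radius hf hs le_rfl hρ h (by linarith)] at hc
  linarith

theorem measurable_radialRearrangement (hf : Continuous f) (hs : HasCompactSupport f) :
    Measurable (radialRearrangement f) := by
  refine measurable_of_Ioi fun t => ?_
  rcases lt_or_ge t 0 with ht | ht
  · convert MeasurableSet.univ
    ext r
    simpa using ht.trans_le (radialRearrangement_nonneg r)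
  · have : radialRearrangement f ⁻¹' Ioi t =
        {r | ENNReal.ofReal (Real.pi * r ^ 2) < volume {x | t < f x}} := by
      ext r
      exact lt_radialRearrangement_iff hf hs ht r
    rw [this]
    exact measurableSet_lt (by fun_prop) measurable_const

theorem volume_superlevel_radialRearrangement (hf : Continuous f) (hs : HasCompactSupport f)
    {t : ℝ} (ht : 0 ≤ t) :
    volume {x : Plane | t < radialRearrangement f ‖x‖} = volume {x | t < f x} := by
  obtain ⟨ρ, hρ, h⟩ := exists_radius_superlevel hs ht
  have : {x : Plane | t < radialRearrangement f ‖x‖} = ball 0 ρ := by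
    ext x
    rw [mem_ball, dist_zero_right]
    exact lt_radialRearrangement_iff_lt_radius hf hs ht hρ h (norm_nonneg x)
  rw [this, h, volume_plane_ball hρ]

theorem lintegral_radialRearrangement_pow (hf : Continuous f) (hs : HasCompactSupport f)
    (h0 : ∀ x, 0 ≤ f x) {n : ℕ} (hn : n ≠ 0) :
    ∫⁻ x : Plane, ENNReal.ofReal (radialRearrangement f ‖x‖ ^ n) =
      ∫⁻ x, ENNReal.ofReal (f x ^ n) := by
  have h1 := lintegral_rpow_eq_lintegral_meas_lt_mul (p := n) volume
    (Eventually.of_forall h0) hf.measurable.aemeasurable (by positivity)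
  have h2 := lintegral_rpow_eq_lintegral_meas_lt_mul (p := n) (volume : Measure Plane)
    (f := fun x => radialRearrangement f ‖x‖)
    (Eventually.of_forall fun x => radialRearrangement_nonneg _)
    ((measurable_radialRearrangement hf hs).comp measurable_norm).aemeasurable (by positivity)
  simp only [Real.rpow_natCast] at h1 h2
  rw [h1, h2]
  congr 1
  refine setLIntegral_congr_fun measurableSet_Ioi fun t ht => ?_
  rw [volume_superlevel_radialRearrangement hf hs (le_of_lt ht)]

theorem radialRearrangement_le_add (hf : Continuous f) (hs : HasCompactSupport f) {L : ℝ}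
    (hL : ∀ x y, |f x - f y| ≤ L * dist x y) {r ε : ℝ} (hr : 0 ≤ r) (hε : 0 < ε) :
    radialRearrangement f r ≤ radialRearrangement f (r + ε) + L * ε := by
  by_contra! hc
  have hL0 : 0 ≤ L := by
    have := hL e0 0
    have h1 : dist e0 (0 : Plane) = 1 := by simp [e0]
    rw [h1, mul_one] at this
    exact (abs_nonneg _).trans this
  set t := radialRearrangement f (r + ε) with ht
  have ht0 : 0 ≤ t := radialRearrangement_nonneg _
  have hs0 : 0 ≤ t + L * ε := by positivity
  obtain ⟨ρ, hρ, h⟩ := exists_radius_superlevel hs hs0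
  obtain ⟨σ, hσ, h'⟩ := exists_radius_superlevel hs ht0
  rw [lt_radialRearrangement_iff_lt_radius hf hs hs0 hρ h hr] at hc
  have h2 : ¬ (r + ε < σ) := by
    rw [← lt_radialRearrangement_iff_lt_radius hf hs ht0 hσ h' (by linarith)]
    exact lt_irrefl _
  have hne : {x | t + L * ε < f x}.Nonempty := by
    refine nonempty_of_measure_ne_zero (μ := volume) ?_
    rw [h]
    have := Real.pi_pos
    have : 0 < ρ := hr.trans_lt hc
    exact (ENNReal.ofReal_pos.mpr (by positivity)).ne'
  have h3 := plane_brunn_minkowski (A := {x | t + L * ε < f x}) (Z := {x | t < f x})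
    (hf.measurable measurableSet_Ioi) (hs.isCompact.isBounded.subset ?_) hne
    (hf.measurable measurableSet_Ioi) hε hρ h.ge ?_
  · rw [h', ENNReal.ofReal_le_ofReal_iff (by positivity), mul_le_mul_iff_right₀ Real.pi_pos,
      pow_le_pow_iff_left₀ (by positivity) hσ two_ne_zero] at h3
    linarith
  · intro x hx
    refine subset_tsupport _ ?_
    simp only [mem_ofPred_eq] at hx
    simp only [Function.mem_support]
    linarith
  · intro x hx z hz
    simp only [mem_ofPred_eq] at hx ⊢
    have h4 := (abs_le.mp (hL x z)).2
    have : L * dist x z ≤ L * ε := by gcongr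
    linarith

end Rearrangement

theorem lintegral_ofReal_sub_sq {X : Type*} [MeasurableSpace X] (μ : Measure X) [SFinite μ]
    {F G : X → ℝ} (hF : Measurable F) (hG : Measurable G) :
    ∫⁻ x, ENNReal.ofReal (G x - F x) ^ 2 ∂μ =
      ∫⁻ p : ℝ × ℝ, μ {x | F x ≤ min p.1 p.2 ∧ max p.1 p.2 < G x} := by
  set S : Set (X × (ℝ × ℝ)) := {q | F q.1 ≤ min q.2.1 q.2.2 ∧ max q.2.1 q.2.2 < G q.1} with hS
  have hSm : MeasurableSet S := by
    refine MeasurableSet.inter (s₁ := {q : X × (ℝ × ℝ) | F q.1 ≤ min q.2.1 q.2.2})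
      (s₂ := {q : X × (ℝ × ℝ) | max q.2.1 q.2.2 < G q.1})
      (measurableSet_le ?_ ?_) (measurableSet_lt ?_ ?_) <;>
      fun_prop
  have h1 := Measure.prod_apply (μ := μ) (ν := (volume : Measure (ℝ × ℝ))) hSm
  rw [Measure.prod_apply_symm hSm] at h1
  refine Eq.trans ?_ h1.symm
  refine lintegral_congr fun x => ?_
  have : Prod.mk x ⁻¹' S = Ico (F x) (G x) ×ˢ Ico (F x) (G x) := by
    ext p
    simp only [hS, mem_preimage, mem_ofPred_eq, mem_prod, mem_Ico, le_min_iff, max_lt_iff]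
    tauto
  rw [this, Measure.volume_eq_prod, Measure.prod_prod, Real.volume_Ico, sq]

section Energy

variable {f : Plane → ℝ}

theorem lintegral_radialRearrangement_shift_le (hf : Continuous f) (hs : HasCompactSupport f)
    {G : Plane → ℝ} (hG : Measurable G) {ε : ℝ} (hε : 0 < ε)
    (hfG : ∀ x y, dist x y < ε → f y ≤ G x) :
    ∫⁻ x : Plane, ENNReal.ofReal
        (radialRearrangement f (max (‖x‖ - ε) 0) - radialRearrangement f ‖x‖) ^ 2
      ≤ ∫⁻ x, ENNReal.ofReal (G x - f x) ^ 2 := by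
  have hm := measurable_radialRearrangement hf hs
  rw [lintegral_ofReal_sub_sq _ hf.measurable hG, lintegral_ofReal_sub_sq volume
    (F := fun x : Plane => radialRearrangement f ‖x‖)
    (G := fun x : Plane => radialRearrangement f (max (‖x‖ - ε) 0)) (by fun_prop) (by fun_prop)]
  refine lintegral_mono fun p => ?_
  set σ := min p.1 p.2
  set τ := max p.1 p.2
  have hστ : σ ≤ τ := min_le_max
  rcases lt_or_ge σ 0 with hσ | hσ
  · have : {x : Plane | radialRearrangement f ‖x‖ ≤ σ ∧
        τ < radialRearrangement f (max (‖x‖ - ε) 0)} = ∅ := by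
      ext x
      simp only [mem_ofPred_eq, mem_empty_iff_false, iff_false, not_and]
      intro h
      exact absurd (h.trans_lt hσ) (not_lt.mpr (radialRearrangement_nonneg _))
    simp [this]
  have hτ : 0 ≤ τ := hσ.trans hστ
  obtain ⟨a, ha, hσa⟩ := exists_radius_superlevel hs hσ
  obtain ⟨b, hb, hτb⟩ := exists_radius_superlevel hs hτ
  rcases hb.eq_or_lt with rfl | hb'
  · have : {x : Plane | radialRearrangement f ‖x‖ ≤ σ ∧
        τ < radialRearrangement f (max (‖x‖ - ε) 0)} = ∅ := by
      ext x
      simp only [mem_ofPred_eq, mem_empty_iff_false, iff_false, not_and]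
      intro _
      rw [lt_radialRearrangement_iff_lt_radius hf hs hτ hb hτb (le_max_right _ _)]
      exact not_lt.mpr (le_max_right _ _)
    simp [this]
  have hset : {x : Plane | radialRearrangement f ‖x‖ ≤ σ ∧
      τ < radialRearrangement f (max (‖x‖ - ε) 0)} = ball 0 (b + ε) \ ball 0 a := by
    ext x
    rw [Set.mem_sdiff, mem_ball, mem_ball, dist_zero_right, mem_ofPred_eq, ← not_lt (a := σ),
      lt_radialRearrangement_iff_lt_radius hf hs hτ hb hτb (le_max_right _ _),
      lt_radialRearrangement_iff_lt_radius hf hs hσ ha hσa (norm_nonneg _), max_lt_iff,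
      and_comm, sub_lt_iff_lt_add]
    simp [hb']
  rw [hset]
  rcases le_or_gt (b + ε) a with hab | hab
  · rw [sdiff_eq_empty.mpr (ball_subset_ball hab)]
    simp
  have hπ := Real.pi_pos
  have hne : {x | τ < f x}.Nonempty := by
    refine nonempty_of_measure_ne_zero (μ := volume) ?_
    rw [hτb]
    exact (ENNReal.ofReal_pos.mpr (by positivity)).ne'
  have hBM := plane_brunn_minkowski (A := {x | τ < f x}) (Z := {x | τ < G x})
    (hf.measurable measurableSet_Ioi) (hs.isCompact.isBounded.subset (by
      intro x hx
      refine subset_tsupport _ ?_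
      simp only [mem_ofPred_eq] at hx
      simp only [Function.mem_support]
      linarith)) hne
    (hG measurableSet_Ioi) hε hb hτb.ge (by
      intro x hx z hz
      exact lt_of_lt_of_le hx (hfG z x (by rwa [dist_comm])))
  rw [measure_sdiff (ball_subset_ball hab.le) measurableSet_ball.nullMeasurableSet
    measure_ball_lt_top.ne, volume_plane_ball (by positivity), volume_plane_ball ha, ← hσa]
  refine (tsub_le_tsub_right hBM _).trans ?_
  rw [tsub_le_iff_right, add_comm]
  refine (measure_mono ?_).trans (measure_union_le _ _)
  intro x hx
  rcases lt_or_ge σ (f x) with h | h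
  · exact Or.inl h
  · exact Or.inr ⟨h, hx⟩

theorem lipschitzWith_radialRearrangement (hf : Continuous f) (hs : HasCompactSupport f)
    {L : NNReal} (hL : LipschitzWith L f) : LipschitzWith L (radialRearrangement f) := by
  have heven : ∀ r, radialRearrangement f |r| = radialRearrangement f r := by
    intro r
    simp [radialRearrangement]
  have h1 : ∀ r s : ℝ, 0 ≤ r → r ≤ s →
      |radialRearrangement f r - radialRearrangement f s| ≤ L * (s - r) := by
    intro r s hr hrs
    rcases hrs.eq_or_lt with rfl | hrs'
    · simp
    have h2 := radialRearrangement_le_add hf hs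
      (fun x y => by simpa [Real.dist_eq] using hL.dist_le_mul x y) hr (sub_pos.mpr hrs')
    rw [add_sub_cancel] at h2
    have h3 := radialRearrangement_anti hf hs hr hrs
    rw [abs_of_nonneg (by linarith)]
    linarith
  refine LipschitzWith.of_dist_le_mul fun r s => ?_
  rw [Real.dist_eq, Real.dist_eq, ← heven r, ← heven s]
  refine le_trans ?_ (mul_le_mul_of_nonneg_left (abs_abs_sub_abs_le r s) L.2)
  rcases le_total |r| |s| with h | h
  · rw [abs_sub_comm |r| |s|, abs_of_nonneg (sub_nonneg.mpr h)]
    exact h1 _ _ (abs_nonneg _) h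
  · rw [abs_of_nonneg (sub_nonneg.mpr h), abs_sub_comm]
    exact h1 _ _ (abs_nonneg _) h

/-- The Pólya–Szegő inequality in the plane. -/
theorem lintegral_deriv_radialRearrangement_sq_le (hf : ContDiff ℝ 1 f)
    (hs : HasCompactSupport f) (h0 : ∀ x, 0 ≤ f x) :
    ENNReal.ofReal (2 * Real.pi) *
        ∫⁻ r in Ioi (0 : ℝ), ENNReal.ofReal r *
          ENNReal.ofReal (-deriv (radialRearrangement f) r) ^ 2
      ≤ ∫⁻ x, ENNReal.ofReal ‖fderiv ℝ f x‖ ^ 2 := by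
  have hc := hf.continuous
  have hd : Differentiable ℝ f := hf.differentiable one_ne_zero
  have hcd : Continuous (fderiv ℝ f) := hf.continuous_fderiv one_ne_zero
  obtain ⟨L, hL⟩ := hf.lipschitzWith_of_hasCompactSupport hs one_ne_zero
  obtain ⟨R, hR⟩ := hs.isCompact.isBounded.subset_ball (0 : Plane)
  set h := radialRearrangement f with hh
  have hhm : Measurable h := measurable_radialRearrangement hc hs
  have huc : UniformContinuous (fderiv ℝ f) :=
    (hs.fderiv (𝕜 := ℝ)).uniformContinuous_of_continuous hcd
  have hfL : ∀ x, ‖fderiv ℝ f x‖ ≤ L := fun x => norm_fderiv_le_of_lipschitz ℝ hL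
  set B : Set Plane := ball 0 (R + 1) with hB
  have step : ∀ ω : ℝ, 0 < ω → ENNReal.ofReal (2 * Real.pi) *
        ∫⁻ r in Ioi (0 : ℝ), ENNReal.ofReal r * ENNReal.ofReal (-deriv h r) ^ 2
      ≤ ∫⁻ x in B, ENNReal.ofReal (‖fderiv ℝ f x‖ + ω) ^ 2 := by
    intro ω hω
    obtain ⟨δ, hδ, hδω⟩ := Metric.uniformContinuous_iff.mp huc ω hω
    have hε : ∀ ε, 0 < ε → ε ≤ min δ 1 → ENNReal.ofReal (2 * Real.pi) *
        ∫⁻ r in Ioi (0 : ℝ), ENNReal.ofReal r * ENNReal.ofReal (ε⁻¹ * (h (max (r - ε) 0) - h r)) ^ 2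
      ≤ ∫⁻ x in B, ENNReal.ofReal (‖fderiv ℝ f x‖ + ω) ^ 2 := by
      intro ε hε hε1
      set G : Plane → ℝ := fun x => f x + B.indicator (fun x => ε * (‖fderiv ℝ f x‖ + ω)) x with hG
      have hGm : Measurable G := by
        refine hc.measurable.add (Measurable.indicator ?_ measurableSet_ball)
        exact (continuous_const.mul (hcd.norm.add continuous_const)).measurable
      have hfG : ∀ x y, dist x y < ε → f y ≤ G x := by
        intro x y hxy
        by_cases hx : x ∈ B
        · have hmv := (convex_ball x ε).norm_image_sub_le_of_norm_fderiv_le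
            (f := f) (C := ‖fderiv ℝ f x‖ + ω) (𝕜 := ℝ) (x := x) (y := y)
            (fun z _ => hd z) (fun z hz => by
              have h1 := hδω (a := z) (b := x) (lt_of_lt_of_le hz (hε1.trans (min_le_left _ _)))
              rw [dist_eq_norm] at h1
              have h2 := norm_le_norm_add_norm_sub (fderiv ℝ f x) (fderiv ℝ f z)
              rw [norm_sub_rev] at h2
              linarith) (mem_ball_self hε) (by rwa [mem_ball, dist_comm])
          rw [← dist_eq_norm y x, dist_comm, Real.norm_eq_abs] at hmv
          have h3 : (‖fderiv ℝ f x‖ + ω) * dist x y ≤ (‖fderiv ℝ f x‖ + ω) * ε := by gcongr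
          simp only [hG, indicator_of_mem hx]
          have := le_abs_self (f y - f x)
          linarith
        · have hy : f y = 0 := by
            by_contra hne
            refine hx ?_
            have h1 := hR (subset_tsupport _ (Function.mem_support.mpr hne))
            rw [mem_ball] at h1 ⊢
            have := dist_triangle x y 0
            have := min_le_right δ 1
            linarith
          simp only [hG, indicator_of_notMem hx, hy, add_zero]
          exact h0 x
      have h1 := lintegral_radialRearrangement_shift_le hc hs hGm hε hfG
      rw [← hh, lintegral_fun_norm_plane
        (f := fun r => ENNReal.ofReal (h (max (r - ε) 0) - h r) ^ 2) (by fun_prop)] at h1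
      have hint : ∫⁻ r in Ioi (0 : ℝ), ENNReal.ofReal r *
          ENNReal.ofReal (ε⁻¹ * (h (max (r - ε) 0) - h r)) ^ 2 =
          ENNReal.ofReal (ε⁻¹) ^ 2 * ∫⁻ r in Ioi (0 : ℝ), ENNReal.ofReal r *
          ENNReal.ofReal (h (max (r - ε) 0) - h r) ^ 2 := by
        rw [← lintegral_const_mul _ (by fun_prop)]
        refine lintegral_congr fun r => ?_
        rw [ENNReal.ofReal_mul (by positivity)]
        ring
      rw [hint, mul_left_comm]
      refine (mul_le_mul_right h1 _).trans ?_
      rw [← lintegral_const_mul _ (by fun_prop), ← lintegral_indicator measurableSet_ball]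
      refine lintegral_mono fun x => ?_
      simp only [hG, add_sub_cancel_left, indicator]
      split_ifs
      · rw [← mul_pow, ← ENNReal.ofReal_mul (by positivity), inv_mul_cancel_left₀ hε.ne']
      · simp
    have hae : ∀ᵐ r ∂(volume.restrict (Ioi (0 : ℝ))), Tendsto (fun n : ℕ =>
        ENNReal.ofReal r * ENNReal.ofReal ((1 / ((n : ℝ) + 1))⁻¹ *
          (h (max (r - 1 / ((n : ℝ) + 1)) 0) - h r)) ^ 2) atTop
        (𝓝 (ENNReal.ofReal r * ENNReal.ofReal (-deriv h r) ^ 2)) := by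
      filter_upwards [ae_restrict_mem measurableSet_Ioi, ae_restrict_of_ae
        (lipschitzWith_radialRearrangement hc hs hL).ae_differentiableAt_real] with r hr hdr
      have h1 : HasDerivAt (fun s => h (r - s)) (-deriv h r) 0 := by
        have h5 : HasDerivAt h (deriv h r) (r - 0) := by
          rw [sub_zero]
          exact hdr.hasDerivAt
        have := HasDerivAt.comp (h₂ := h) (h := fun s => r - s) (0 : ℝ) h5
          ((hasDerivAt_id (0 : ℝ)).const_sub r)
        simpa [Function.comp_def] using this
      rw [hasDerivAt_iff_tendsto_slope_zero] at h1
      have h2 : Tendsto (fun n : ℕ => 1 / ((n : ℝ) + 1)) atTop (𝓝[≠] 0) := by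
        refine tendsto_nhdsWithin_iff.mpr ⟨tendsto_one_div_add_atTop_nhds_zero_nat, ?_⟩
        filter_upwards with n
        have : (0 : ℝ) < 1 / ((n : ℝ) + 1) := by positivity
        exact this.ne'
      have h3 := h1.comp h2
      refine ENNReal.Tendsto.const_mul ?_ (Or.inr ENNReal.ofReal_ne_top)
      refine ENNReal.Tendsto.pow (ENNReal.tendsto_ofReal (h3.congr' ?_))
      have h4 := tendsto_one_div_add_atTop_nhds_zero_nat (𝕜 := ℝ)
      filter_upwards [h4.eventually (gt_mem_nhds hr)] with n hn
      simp only [Function.comp_apply, zero_add, sub_zero, smul_eq_mul]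
      rw [max_eq_left (by linarith)]
    have hfatou : ∫⁻ r in Ioi (0 : ℝ), ENNReal.ofReal r * ENNReal.ofReal (-deriv h r) ^ 2 ≤
        liminf (fun n : ℕ => ∫⁻ r in Ioi (0 : ℝ), ENNReal.ofReal r *
          ENNReal.ofReal ((1 / ((n : ℝ) + 1))⁻¹ *
          (h (max (r - 1 / ((n : ℝ) + 1)) 0) - h r)) ^ 2) atTop := by
      refine le_trans (le_of_eq ?_) (lintegral_liminf_le fun n => by fun_prop)
      refine lintegral_congr_ae ?_
      filter_upwards [hae] with r hr
      exact hr.liminf_eq.symm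
    have hπ : ENNReal.ofReal (2 * Real.pi) ≠ 0 := by
      have := Real.pi_pos
      exact (ENNReal.ofReal_pos.mpr (by positivity)).ne'
    rw [mul_comm, ← ENNReal.le_div_iff_mul_le (Or.inl hπ) (Or.inl ENNReal.ofReal_ne_top)]
    refine hfatou.trans (liminf_le_of_frequently_le' (Eventually.frequently ?_))
    have h4 := tendsto_one_div_add_atTop_nhds_zero_nat (𝕜 := ℝ)
    filter_upwards [h4.eventually (ge_mem_nhds (lt_min hδ one_pos))] with n hn
    rw [ENNReal.le_div_iff_mul_le (Or.inl hπ) (Or.inl ENNReal.ofReal_ne_top), mul_comm]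
    exact hε _ (by positivity) hn
  have hlim : Tendsto (fun n : ℕ => ∫⁻ x in B,
      ENNReal.ofReal (‖fderiv ℝ f x‖ + 1 / ((n : ℝ) + 1)) ^ 2) atTop
      (𝓝 (∫⁻ x in B, ENNReal.ofReal ‖fderiv ℝ f x‖ ^ 2)) := by
    refine tendsto_lintegral_of_dominated_convergence (fun _ => ENNReal.ofReal (L + 1) ^ 2)
      (fun n => ?_) (fun n => ?_) ?_ ?_
    · have : Continuous fun x => ‖fderiv ℝ f x‖ + 1 / ((n : ℝ) + 1) := by fun_prop
      exact (this.measurable.ennreal_ofReal).pow_const 2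
    · refine Eventually.of_forall fun x => ?_
      have h1 : 1 / ((n : ℝ) + 1) ≤ 1 := by
        rw [div_le_one (by positivity)]
        linarith [Nat.cast_nonneg (α := ℝ) n]
      exact pow_le_pow_left' (ENNReal.ofReal_le_ofReal (add_le_add (hfL x) h1)) 2
    · rw [lintegral_const]
      refine ENNReal.mul_ne_top (by finiteness) ?_
      rw [Measure.restrict_apply_univ]
      exact measure_ball_lt_top.ne
    · refine Eventually.of_forall fun x => ENNReal.Tendsto.pow (ENNReal.tendsto_ofReal ?_)
      simpa using (tendsto_one_div_add_atTop_nhds_zero_nat (𝕜 := ℝ)).const_add ‖fderiv ℝ f x‖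
  exact (ge_of_tendsto' hlim fun n => step _ (by positivity)).trans (setLIntegral_le_lintegral _ _)

end Energy

theorem integrableOn_Ioi_of_bounded {g : ℝ → ℝ} (hg : Measurable g) {R K : ℝ}
    (hK : ∀ r, 0 < r → r ≤ R → |g r| ≤ K) (hR : ∀ r, R < r → g r = 0) :
    IntegrableOn g (Ioi 0) := by
  have h1 : IntegrableOn g (Ioc 0 R) := by
    refine Measure.integrableOn_of_bounded (M := K) (by simp) hg.aestronglyMeasurable ?_
    filter_upwards [ae_restrict_mem measurableSet_Ioc] with r hr
    exact hK r hr.1 hr.2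
  have h2 : IntegrableOn g (Ioi R) := by
    have h3 : IntegrableOn (fun _ : ℝ => (0 : ℝ)) (Ioi R) := integrableOn_zero
    exact h3.congr_fun (fun r hr => (hR r hr).symm) measurableSet_Ioi
  refine (h1.union h2).mono_set fun r hr => ?_
  rcases le_or_gt r R with h | h
  · exact Or.inl ⟨hr, h⟩
  · exact Or.inr h

/-- Lipschitz radial profiles with bounded support. -/
def IsProfile (h : ℝ → ℝ) : Prop :=
  (∃ K, LipschitzWith K h) ∧ ∃ R, 0 < R ∧ ∀ r, R ≤ r → h r = 0

/-- The radial Dirichlet energy. -/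
def radialDirichlet (h : ℝ → ℝ) : ℝ := ∫ r in Ioi (0 : ℝ), r * deriv h r ^ 2

/-- The radial moment of order `n`. -/
def radialMoment (n : ℕ) (h : ℝ → ℝ) : ℝ := ∫ r in Ioi (0 : ℝ), r * h r ^ n

/-- The sum of the radial Dirichlet energy and the radial mass. -/
def radialEnergy (h : ℝ → ℝ) : ℝ := radialDirichlet h + radialMoment 2 h

namespace IsProfile

variable {h g : ℝ → ℝ}

theorem exists_bounds (hh : IsProfile h) : ∃ K R, 0 ≤ K ∧ 0 < R ∧ (∀ r, |deriv h r| ≤ K) ∧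
    (∀ r, 0 < r → |h r| ≤ K) ∧ (∀ r, R ≤ r → h r = 0) ∧ (∀ r, R < r → deriv h r = 0) := by
  obtain ⟨⟨K, hK⟩, R, hR, h0⟩ := hh
  refine ⟨K * (R + 1), R, by positivity, hR, fun r => ?_, fun r hr => ?_, h0, fun r hr => ?_⟩
  · have h1 := norm_deriv_le_of_lipschitz hK (x₀ := r)
    rw [Real.norm_eq_abs] at h1
    nlinarith [K.2]
  · rcases le_or_gt R r with h1 | h1
    · rw [h0 r h1, abs_zero]
      positivity
    · have h2 := hK.dist_le_mul r R
      rw [h0 R le_rfl, Real.dist_eq, Real.dist_eq, sub_zero, abs_sub_comm,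
        abs_of_pos (sub_pos.mpr h1)] at h2
      refine h2.trans ?_
      gcongr
      linarith
  · have h1 : h =ᶠ[𝓝 r] fun _ => 0 := by
      filter_upwards [lt_mem_nhds hr] with s hs
      exact h0 s hs.le
    rw [h1.deriv_eq, deriv_const]

theorem continuous (hh : IsProfile h) : Continuous h := by
  obtain ⟨⟨K, hK⟩, -⟩ := hh
  exact hK.continuous

theorem ae_differentiableAt (hh : IsProfile h) : ∀ᵐ r, DifferentiableAt ℝ h r := by
  obtain ⟨⟨K, hK⟩, -⟩ := hh
  exact hK.ae_differentiableAt_real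

theorem integrableOn_dirichlet (hh : IsProfile h) (hg : IsProfile g) :
    IntegrableOn (fun r => r * (deriv h r * deriv g r)) (Ioi 0) := by
  obtain ⟨K, R, hK, hR, h1, -, -, h2⟩ := hh.exists_bounds
  obtain ⟨K', -, hK', -, h1', -, -, -⟩ := hg.exists_bounds
  refine integrableOn_Ioi_of_bounded (R := R) (K := R * (K * K')) ?_ (fun r hr hrR => ?_)
    fun r hr => by simp [h2 r hr]
  · exact measurable_id.mul ((measurable_deriv h).mul (measurable_deriv g))
  · rw [abs_mul, abs_mul, abs_of_pos hr]
    have := h1 r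
    have := h1' r
    gcongr

theorem integrableOn_dirichlet_sq (hh : IsProfile h) :
    IntegrableOn (fun r => r * deriv h r ^ 2) (Ioi 0) := by
  simpa only [sq] using hh.integrableOn_dirichlet hh

theorem integrableOn_mul_pow (hh : IsProfile h) (hg : Continuous g) {n : ℕ} (hn : n ≠ 0) :
    IntegrableOn (fun r => r * (h r ^ n * g r)) (Ioi 0) := by
  obtain ⟨K, R, hK, hR, -, h1, h2, -⟩ := hh.exists_bounds
  obtain ⟨K', hK'⟩ := (isCompact_Icc (a := (0 : ℝ)) (b := R)).exists_bound_of_continuousOn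
    hg.continuousOn
  refine integrableOn_Ioi_of_bounded (R := R) (K := R * (K ^ n * K')) ?_ (fun r hr hrR => ?_)
    fun r hr => by simp [h2 r hr.le, hn]
  · have := hh.continuous
    fun_prop
  · rw [abs_mul, abs_mul, abs_of_pos hr, abs_pow]
    have h3 := h1 r hr
    have h4 := hK' r ⟨hr.le, hrR⟩
    rw [Real.norm_eq_abs] at h4
    gcongr

theorem integrableOn_moment (hh : IsProfile h) {n : ℕ} (hn : n ≠ 0) :
    IntegrableOn (fun r => r * h r ^ n) (Ioi 0) := by
  simpa using hh.integrableOn_mul_pow (g := fun _ => 1) continuous_const hn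

theorem absolutelyContinuousOnInterval (hh : IsProfile h) (s t : ℝ) :
    AbsolutelyContinuousOnInterval h s t := by
  obtain ⟨⟨K, hK⟩, -⟩ := hh
  exact hK.lipschitzOnWith.absolutelyContinuousOnInterval

theorem radialDirichlet_nonneg (h : ℝ → ℝ) : 0 ≤ radialDirichlet h :=
  setIntegral_nonneg measurableSet_Ioi fun _ hr => mul_nonneg (le_of_lt hr) (sq_nonneg _)

theorem radialMoment_nonneg {n : ℕ} (hn : Even n) (h : ℝ → ℝ) : 0 ≤ radialMoment n h :=
  setIntegral_nonneg measurableSet_Ioi fun _ hr => mul_nonneg (le_of_lt hr) (hn.pow_nonneg _)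

theorem radialEnergy_nonneg (h : ℝ → ℝ) : 0 ≤ radialEnergy h :=
  add_nonneg (radialDirichlet_nonneg h) (radialMoment_nonneg even_two h)

/-- Logarithmic modulus of continuity. -/
theorem sq_sub_le (hh : IsProfile h) {s t : ℝ} (hs : 0 < s) (hst : s ≤ t) :
    (h t - h s) ^ 2 ≤ radialDirichlet h * Real.log (t / s) := by
  have hne : ∀ r ∈ uIcc s t, r ≠ 0 := fun r hr => by
    rw [uIcc_of_le hst] at hr
    exact (hs.trans_le hr.1).ne'
  have hi := (hh.absolutelyContinuousOnInterval s t).intervalIntegrable_deriv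
  have hi2 : IntervalIntegrable (fun r => r * deriv h r ^ 2) volume s t := by
    rw [intervalIntegrable_iff_integrableOn_Ioc_of_le hst]
    exact hh.integrableOn_dirichlet_sq.mono_set fun r hr => hs.trans hr.1
  have hi3 : IntervalIntegrable (fun r : ℝ => r⁻¹) volume s t :=
    intervalIntegral.intervalIntegrable_inv (fun r hr => hne r hr) continuousOn_id
  have key : ∀ c : ℝ, 0 ≤ Real.log (t / s) * (c * c) + (-2 * (h t - h s)) * c
      + radialDirichlet h := by
    intro c
    have h1 : ∫ r in s..t, (r * deriv h r ^ 2 - 2 * c * deriv h r + c ^ 2 * r⁻¹) =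
        (∫ r in s..t, r * deriv h r ^ 2) - 2 * c * (h t - h s) + c ^ 2 * Real.log (t / s) := by
      rw [intervalIntegral.integral_add (hi2.sub (hi.const_mul _)) (hi3.const_mul _),
        intervalIntegral.integral_sub hi2 (hi.const_mul _), intervalIntegral.integral_const_mul,
        intervalIntegral.integral_const_mul,
        (hh.absolutelyContinuousOnInterval s t).integral_deriv_eq_sub,
        integral_inv_of_pos hs (hs.trans_le hst)]
    have h2 : 0 ≤ ∫ r in s..t, (r * deriv h r ^ 2 - 2 * c * deriv h r + c ^ 2 * r⁻¹) := by
      refine intervalIntegral.integral_nonneg hst fun r hr => ?_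
      have hr0 : 0 < r := hs.trans_le hr.1
      have : r * deriv h r ^ 2 - 2 * c * deriv h r + c ^ 2 * r⁻¹ =
          r⁻¹ * (r * deriv h r - c) ^ 2 := by
        field_simp
        ring
      rw [this]
      positivity
    have h3 : (∫ r in s..t, r * deriv h r ^ 2) ≤ radialDirichlet h := by
      rw [intervalIntegral.integral_of_le hst]
      refine setIntegral_mono_set hh.integrableOn_dirichlet_sq ?_ ?_
      · filter_upwards [ae_restrict_mem measurableSet_Ioi] with r hr
        exact mul_nonneg (le_of_lt hr) (sq_nonneg _)
      · exact (show Ioc s t ⊆ Ioi 0 from fun r hr => hs.trans hr.1).eventuallyLE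
    linarith
  have := discrim_le_zero key
  rw [discrim] at this
  linarith

/-- Radial decay. -/
theorem sq_le_div (hh : IsProfile h) {r : ℝ} (hr : 0 < r) : h r ^ 2 ≤ radialEnergy h / r := by
  obtain ⟨-, R, -, hR, -, -, h2, -⟩ := hh.exists_bounds
  set T := max R r
  have hrT : r ≤ T := le_max_right _ _
  have hac := hh.absolutelyContinuousOnInterval r T
  have h1 := hac.integral_deriv_mul_eq_sub hac
  rw [h2 T (le_max_left _ _)] at h1
  have hint : IntegrableOn (fun s => s * deriv h s ^ 2 + s * h s ^ 2) (Ioi 0) :=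
    hh.integrableOn_dirichlet_sq.add (hh.integrableOn_moment two_ne_zero)
  have hsub : Ioc r T ⊆ Ioi 0 := fun s hs => hr.trans hs.1
  have h3 : ∫ s in r..T, -(deriv h s * h s + h s * deriv h s) ≤
      ∫ s in r..T, r⁻¹ * (s * deriv h s ^ 2 + s * h s ^ 2) := by
    have hd := hac.intervalIntegrable_deriv
    have hc : ContinuousOn h (uIcc r T) := hh.continuous.continuousOn
    refine intervalIntegral.integral_mono_on hrT
      ((hd.mul_continuousOn hc).add (hd.continuousOn_mul hc)).neg ?_ fun s hs => ?_
    · rw [intervalIntegrable_iff_integrableOn_Ioc_of_le hrT]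
      exact (hint.mono_set hsub).const_mul _
    · have h4 : 1 ≤ r⁻¹ * s := by
        rw [← div_eq_inv_mul, le_div_iff₀ hr]
        linarith [hs.1]
      nlinarith [sq_nonneg (deriv h s + h s), mul_nonneg (sub_nonneg.mpr h4)
        (add_nonneg (sq_nonneg (deriv h s)) (sq_nonneg (h s)))]
  rw [intervalIntegral.integral_neg, h1, intervalIntegral.integral_const_mul] at h3
  have h5 : ∫ s in r..T, (s * deriv h s ^ 2 + s * h s ^ 2) ≤ radialEnergy h := by
    rw [intervalIntegral.integral_of_le hrT, radialEnergy, radialDirichlet, radialMoment,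
      ← integral_add hh.integrableOn_dirichlet_sq (hh.integrableOn_moment two_ne_zero)]
    refine setIntegral_mono_set hint ?_ hsub.eventuallyLE
    filter_upwards [ae_restrict_mem measurableSet_Ioi] with s hs
    have : 0 < s := hs
    positivity
  rw [div_eq_inv_mul]
  have := mul_le_mul_of_nonneg_left h5 (inv_nonneg.mpr hr.le)
  nlinarith

/-- Uniform bound for the quartic density near the origin. -/
theorem mul_pow_four_le (hh : IsProfile h) {r : ℝ} (hr : 0 < r) (hr1 : r ≤ 1) :
    r * h r ^ 4 ≤ 16 * radialEnergy h ^ 2 := by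
  have hE := radialEnergy_nonneg h
  have hA : radialDirichlet h ≤ radialEnergy h := by
    have := radialMoment_nonneg even_two h
    rw [radialEnergy]
    linarith
  have h1 := hh.sq_sub_le hr hr1
  have h2 := hh.sq_le_div one_pos
  rw [div_one] at h2
  set x := (√r)⁻¹ with hx
  have hsr : 0 < √r := Real.sqrt_pos.mpr hr
  have hxpos : 0 < x := by positivity
  have hxr : x ^ 2 * r = 1 := by
    rw [hx, inv_pow, Real.sq_sqrt hr.le, inv_mul_cancel₀ hr.ne']
  have hlog : Real.log (1 / r) ≤ 2 * (x - 1) := by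
    have h3 : 1 / r = x ^ 2 := by
      field_simp
      linarith
    rw [h3, Real.log_pow]
    push_cast
    have := Real.log_le_sub_one_of_pos hxpos
    linarith
  have hx1 : 1 ≤ x := by
    by_contra! hc
    nlinarith
  have h4 : radialDirichlet h * Real.log (1 / r) ≤ radialEnergy h * (2 * (x - 1)) := by
    have h5 : 0 ≤ Real.log (1 / r) := Real.log_nonneg (by rw [le_div_iff₀ hr]; linarith)
    gcongr
  have h6 : h r ^ 2 ≤ 4 * radialEnergy h * x := by
    nlinarith [sq_nonneg (2 * h 1 - h r)]
  calc r * h r ^ 4 = r * (h r ^ 2) ^ 2 := by ring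
    _ ≤ r * (4 * radialEnergy h * x) ^ 2 := by gcongr
    _ = 16 * radialEnergy h ^ 2 * (x ^ 2 * r) := by ring
    _ = _ := by rw [hxr, mul_one]

/-- Decay of the quartic density at infinity. -/
theorem mul_pow_four_le_tail (hh : IsProfile h) {R r : ℝ} (hR : 0 < R) (hr : R ≤ r) :
    r * h r ^ 4 ≤ radialEnergy h / R * (r * h r ^ 2) := by
  have h1 := hh.sq_le_div (hR.trans_le hr)
  have hE := radialEnergy_nonneg h
  have h2 : radialEnergy h / r ≤ radialEnergy h / R := by gcongr
  have h3 : 0 ≤ r * h r ^ 2 := by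
    have := hR.le.trans hr
    positivity
  nlinarith

theorem setIntegral_tail_le (hh : IsProfile h) {R : ℝ} (hR : 0 < R) :
    ∫ r in Ioi R, r * h r ^ 4 ≤ radialEnergy h ^ 2 / R := by
  have hsub : Ioi R ⊆ Ioi 0 := Ioi_subset_Ioi hR.le
  have hE := radialEnergy_nonneg h
  have hB : radialMoment 2 h ≤ radialEnergy h := by
    have := radialDirichlet_nonneg h
    rw [radialEnergy]
    linarith
  calc ∫ r in Ioi R, r * h r ^ 4 ≤ ∫ r in Ioi R, radialEnergy h / R * (r * h r ^ 2) := by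
        refine setIntegral_mono_on ((hh.integrableOn_moment four_ne_zero).mono_set hsub)
          (((hh.integrableOn_moment two_ne_zero).mono_set hsub).const_mul _) measurableSet_Ioi
          fun r hr => hh.mul_pow_four_le_tail hR (le_of_lt hr)
    _ = radialEnergy h / R * ∫ r in Ioi R, r * h r ^ 2 := integral_const_mul _ _
    _ ≤ radialEnergy h / R * radialEnergy h := by
        refine mul_le_mul_of_nonneg_left (le_trans ?_ hB) (by positivity)
        refine setIntegral_mono_set (hh.integrableOn_moment two_ne_zero) ?_ hsub.eventuallyLE
        filter_upwards [ae_restrict_mem measurableSet_Ioi] with r hr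
        have : 0 < r := hr
        positivity
    _ = _ := by ring

theorem radialMoment_four_le (hh : IsProfile h) : radialMoment 4 h ≤ 17 * radialEnergy h ^ 2 := by
  have h4 := hh.integrableOn_moment four_ne_zero
  have h1 : ∫ r in Ioc (0 : ℝ) 1, r * h r ^ 4 ≤ 16 * radialEnergy h ^ 2 := by
    calc ∫ r in Ioc (0 : ℝ) 1, r * h r ^ 4 ≤ ∫ r in Ioc (0 : ℝ) 1, 16 * radialEnergy h ^ 2 := by
          refine setIntegral_mono_on (h4.mono_set Ioc_subset_Ioi_self)
            (integrableOn_const (by simp)) measurableSet_Ioc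
            fun r hr => hh.mul_pow_four_le hr.1 hr.2
      _ = _ := by simp
  have h2 := hh.setIntegral_tail_le one_pos
  have h3 : radialMoment 4 h = (∫ r in Ioc (0 : ℝ) 1, r * h r ^ 4) + ∫ r in Ioi 1, r * h r ^ 4 := by
    rw [radialMoment, ← Ioc_union_Ioi_eq_Ioi (zero_le_one (α := ℝ))]
    exact setIntegral_union (Ioc_disjoint_Ioi le_rfl) measurableSet_Ioi
      (h4.mono_set Ioc_subset_Ioi_self) (h4.mono_set (Ioi_subset_Ioi zero_le_one))
  rw [h3]
  linarith

end IsProfile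

namespace IsProfile

variable {h g : ℝ → ℝ}

theorem add_const_mul (hh : IsProfile h) (hg : IsProfile g) (c : ℝ) :
    IsProfile fun r => h r + c * g r := by
  obtain ⟨⟨K, hK⟩, R, hR, h0⟩ := hh
  obtain ⟨⟨L, hL⟩, S, hS, g0⟩ := hg
  refine ⟨⟨K + ‖c‖₊ * L, hK.add ?_⟩, max R S, lt_max_of_lt_left hR, fun r hr => ?_⟩
  · exact (lipschitzWith_smul c).comp hL
  · dsimp only
    rw [h0 r ((le_max_left _ _).trans hr), g0 r ((le_max_right _ _).trans hr), mul_zero, add_zero]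

theorem const_mul (hh : IsProfile h) (c : ℝ) : IsProfile fun r => c * h r := by
  obtain ⟨⟨K, hK⟩, R, hR, h0⟩ := hh
  refine ⟨⟨‖c‖₊ * K, (lipschitzWith_smul c).comp hK⟩, R, hR, fun r hr => ?_⟩
  simp only [h0 r hr, mul_zero]

theorem abs (hh : IsProfile h) : IsProfile fun r => |h r| := by
  obtain ⟨⟨K, hK⟩, R, hR, h0⟩ := hh
  refine ⟨⟨K, ?_⟩, R, hR, fun r hr => by simp only [h0 r hr, abs_zero]⟩
  refine LipschitzWith.of_dist_le_mul fun x y => ?_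
  refine le_trans ?_ (hK.dist_le_mul x y)
  rw [Real.dist_eq, Real.dist_eq]
  exact abs_abs_sub_abs_le_abs_sub _ _

theorem radialDirichlet_abs_le (hh : IsProfile h) :
    radialDirichlet (fun r => |h r|) ≤ radialDirichlet h := by
  refine setIntegral_mono_on_ae hh.abs.integrableOn_dirichlet_sq hh.integrableOn_dirichlet_sq
    measurableSet_Ioi ?_
  filter_upwards [hh.ae_differentiableAt, hh.abs.ae_differentiableAt] with r h1 h2 hr
  refine mul_le_mul_of_nonneg_left ?_ (le_of_lt hr)
  rw [← sq_abs, ← sq_abs (deriv h r)]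
  have h3 := (hasDerivAt_iff_tendsto_slope.mp h1.hasDerivAt).abs
  have h4 := (hasDerivAt_iff_tendsto_slope.mp h2.hasDerivAt).abs
  refine pow_le_pow_left₀ (abs_nonneg _) (le_of_tendsto_of_tendsto' h4 h3 fun s => ?_) 2
  rw [slope_def_field, slope_def_field, abs_div, abs_div]
  exact div_le_div_of_nonneg_right (abs_abs_sub_abs_le_abs_sub _ _) (abs_nonneg _)

theorem radialMoment_const_mul (h : ℝ → ℝ) (n : ℕ) (c : ℝ) :
    radialMoment n (fun r => c * h r) = c ^ n * radialMoment n h := by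
  rw [radialMoment, radialMoment, ← integral_const_mul]
  congr 1
  ext r
  ring

theorem radialDirichlet_const_mul (h : ℝ → ℝ) (c : ℝ) :
    radialDirichlet (fun r => c * h r) = c ^ 2 * radialDirichlet h := by
  rw [radialDirichlet, radialDirichlet, ← integral_const_mul]
  congr 1
  ext r
  rw [deriv_const_mul_field]
  ring

theorem radialEnergy_const_mul (h : ℝ → ℝ) (c : ℝ) :
    radialEnergy (fun r => c * h r) = c ^ 2 * radialEnergy h := by
  rw [radialEnergy, radialEnergy, radialDirichlet_const_mul, radialMoment_const_mul]
  ring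

/-- Expansion of the energy along a line. -/
theorem radialEnergy_add (hh : IsProfile h) (hg : IsProfile g) (c : ℝ) :
    radialEnergy (fun r => h r + c * g r) = radialEnergy h +
      2 * c * ((∫ r in Ioi 0, r * (deriv h r * deriv g r)) + ∫ r in Ioi 0, r * (h r * g r)) +
      c ^ 2 * radialEnergy g := by
  have i1 := hh.integrableOn_dirichlet_sq
  have i2 := hg.integrableOn_dirichlet_sq
  have i3 := hh.integrableOn_dirichlet hg
  have i4 := hh.integrableOn_moment two_ne_zero
  have i5 := hg.integrableOn_moment two_ne_zero
  have i6 : IntegrableOn (fun r => r * (h r * g r)) (Ioi 0) := by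
    simpa using hh.integrableOn_mul_pow hg.continuous one_ne_zero
  have i7 : IntegrableOn (fun r => r * deriv h r ^ 2 + 2 * c * (r * (deriv h r * deriv g r)))
    (Ioi 0) := i1.add (i3.const_mul _)
  have i8 : IntegrableOn (fun r => r * h r ^ 2 + 2 * c * (r * (h r * g r))) (Ioi 0) :=
    i4.add (i6.const_mul _)
  have h1 : radialDirichlet (fun r => h r + c * g r) = radialDirichlet h +
      2 * c * (∫ r in Ioi 0, r * (deriv h r * deriv g r)) + c ^ 2 * radialDirichlet g := by
    rw [radialDirichlet, radialDirichlet, radialDirichlet, ← integral_const_mul,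
      ← integral_const_mul, ← integral_add i1 (i3.const_mul _),
      ← integral_add i7 (i2.const_mul _)]
    refine setIntegral_congr_ae measurableSet_Ioi ?_
    filter_upwards [hh.ae_differentiableAt, hg.ae_differentiableAt] with r h1 h2 hr
    have := (h1.hasDerivAt.add (h2.hasDerivAt.const_mul c)).deriv
    simp only [Pi.add_def] at this
    rw [this]
    ring
  have h2 : radialMoment 2 (fun r => h r + c * g r) = radialMoment 2 h +
      2 * c * (∫ r in Ioi 0, r * (h r * g r)) + c ^ 2 * radialMoment 2 g := by
    rw [radialMoment, radialMoment, radialMoment, ← integral_const_mul,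
      ← integral_const_mul, ← integral_add i4 (i6.const_mul _),
      ← integral_add i8 (i5.const_mul _)]
    congr 1
    ext r
    ring
  rw [radialEnergy, h1, h2, radialEnergy, radialEnergy]
  ring

/-- Convexity of the quartic moment. -/
theorem radialMoment_four_add_ge (hh : IsProfile h) (hg : IsProfile g) (c : ℝ) :
    radialMoment 4 h + 4 * c * ∫ r in Ioi 0, r * (h r ^ 3 * g r) ≤
      radialMoment 4 fun r => h r + c * g r := by
  have i1 := hh.integrableOn_moment four_ne_zero
  have i2 := hh.integrableOn_mul_pow hg.continuous three_ne_zero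
  rw [radialMoment, radialMoment, ← integral_const_mul, ← integral_add i1 (i2.const_mul _)]
  refine setIntegral_mono_on (i1.add (i2.const_mul _))
    ((hh.add_const_mul hg c).integrableOn_moment four_ne_zero) measurableSet_Ioi fun r hr => ?_
  have hr : 0 < r := hr
  have : r * (h r + c * g r) ^ 4 - (r * h r ^ 4 + 4 * c * (r * (h r ^ 3 * g r))) =
      r * ((c * g r) ^ 2 * (2 * h r ^ 2 + (2 * h r + c * g r) ^ 2)) := by ring
  have h2 : 0 ≤ r * ((c * g r) ^ 2 * (2 * h r ^ 2 + (2 * h r + c * g r) ^ 2)) := by positivity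
  linarith

end IsProfile

/-- The optimal constant in `radialMoment 4 h ≤ C * radialEnergy h ^ 2`, inverted. -/
def quarticConst : ℝ :=
  sInf {m | ∃ h, IsProfile h ∧ 0 < radialMoment 4 h ∧ m = radialEnergy h ^ 2 / radialMoment 4 h}

theorem bddBelow_quartic : (1 / 17 : ℝ) ∈ lowerBounds {m | ∃ h, IsProfile h ∧
    0 < radialMoment 4 h ∧ m = radialEnergy h ^ 2 / radialMoment 4 h} := by
  rintro _ ⟨h, hh, hpos, rfl⟩
  rw [le_div_iff₀ hpos]
  linarith [hh.radialMoment_four_le]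

theorem quarticConst_mul_le {h : ℝ → ℝ} (hh : IsProfile h) :
    quarticConst * radialMoment 4 h ≤ radialEnergy h ^ 2 := by
  rcases (IsProfile.radialMoment_nonneg (by decide) h : 0 ≤ radialMoment 4 h).eq_or_lt with h0 | h0
  · rw [← h0, mul_zero]
    positivity
  · rw [← le_div_iff₀ h0]
    exact csInf_le ⟨_, bddBelow_quartic⟩ ⟨h, hh, h0, rfl⟩

theorem exists_isProfile_pos : ∃ h, IsProfile h ∧ 0 < radialMoment 4 h := by
  have hp : IsProfile fun r => max 0 (1 - |r|) := by
    refine ⟨⟨1, ?_⟩, 1, one_pos, fun r hr => ?_⟩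
    · refine LipschitzWith.of_dist_le_mul fun x y => ?_
      rw [Real.dist_eq, Real.dist_eq, NNReal.coe_one, one_mul]
      rw [max_comm 0, max_comm 0, abs_sub_comm x]
      refine (abs_max_sub_max_le_abs _ _ _).trans ?_ |>.trans (abs_abs_sub_abs_le_abs_sub y x)
      rw [sub_sub_sub_cancel_left]
    · dsimp only
      rw [abs_of_pos (zero_lt_one.trans_le hr)]
      exact max_eq_left (by linarith)
  refine ⟨_, hp, ?_⟩
  rw [radialMoment, setIntegral_pos_iff_support_of_nonneg_ae]
  · refine lt_of_lt_of_le ?_ (measure_mono (s := Ioo (0 : ℝ) 1) fun r hr => ⟨?_, hr.1⟩)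
    · simp
    · have h1 : max 0 (1 - |r|) = 1 - r := by
        rw [abs_of_pos hr.1]
        exact max_eq_right (by linarith [hr.2])
      rw [Function.mem_support, h1]
      have h2 : 0 < 1 - r := by linarith [hr.2]
      have h3 : 0 < r := hr.1
      positivity
  · filter_upwards [ae_restrict_mem measurableSet_Ioi] with r hr
    exact mul_nonneg (le_of_lt hr) (by positivity)
  · exact hp.integrableOn_moment four_ne_zero

theorem quarticConst_pos : 0 < quarticConst := by
  obtain ⟨h, hh, h0⟩ := exists_isProfile_pos
  exact lt_of_lt_of_le (by norm_num) (le_csInf ⟨_, h, hh, h0, rfl⟩ bddBelow_quartic)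

theorem exists_minimizing (ε : ℝ) (hε : 0 < ε) : ∃ h, IsProfile h ∧ (∀ r, 0 ≤ h r) ∧
    radialMoment 4 h = radialEnergy h ∧ quarticConst ≤ radialEnergy h ∧
    radialEnergy h < quarticConst + ε := by
  obtain ⟨g0, hg0, hg0'⟩ := exists_isProfile_pos
  obtain ⟨_, ⟨g, hg, hpos, rfl⟩, hlt⟩ := exists_lt_of_csInf_lt
    (s := {m | ∃ h, IsProfile h ∧ 0 < radialMoment 4 h ∧
      m = radialEnergy h ^ 2 / radialMoment 4 h})
    ⟨_, g0, hg0, hg0', rfl⟩ (show quarticConst < quarticConst + ε by linarith)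
  set f : ℝ → ℝ := fun r => |g r| with hf
  have hfp : IsProfile f := hg.abs
  have hm : ∀ n : ℕ, Even n → radialMoment n f = radialMoment n g := fun n hn => by
    simp only [radialMoment, hf, hn.pow_abs]
  have hE : radialEnergy f ≤ radialEnergy g := by
    rw [radialEnergy, radialEnergy, hm 2 even_two]
    exact add_le_add_left hg.radialDirichlet_abs_le _
  have hC : radialMoment 4 f = radialMoment 4 g := hm 4 (by decide)
  have hCpos : 0 < radialMoment 4 f := hC ▸ hpos
  have hE0 : 0 < radialEnergy f := by
    have h1 := hfp.radialMoment_four_le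
    have h2 := IsProfile.radialEnergy_nonneg f
    by_contra! h3
    have : radialEnergy f = 0 := le_antisymm h3 h2
    rw [this] at h1
    linarith
  set α := √(radialEnergy f / radialMoment 4 f)
  have hα : α ^ 2 = radialEnergy f / radialMoment 4 f := Real.sq_sqrt (by positivity)
  have hEα : radialEnergy (fun r => α * f r) = radialEnergy f ^ 2 / radialMoment 4 f := by
    rw [IsProfile.radialEnergy_const_mul, hα]
    ring
  have hCα : radialMoment 4 (fun r => α * f r) = radialEnergy f ^ 2 / radialMoment 4 f := by
    rw [IsProfile.radialMoment_const_mul, show α ^ 4 = (α ^ 2) ^ 2 by ring, hα]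
    field_simp
  refine ⟨fun r => α * f r, hfp.const_mul α,
    fun r => mul_nonneg (Real.sqrt_nonneg _) (abs_nonneg _), hCα.trans hEα.symm, ?_, ?_⟩
  · rw [hEα, le_div_iff₀ hCpos]
    exact quarticConst_mul_le hfp
  · rw [hEα]
    refine lt_of_le_of_lt ?_ hlt
    rw [hC]
    gcongr

/-- Pointwise convergent subsequences of an equi-Hölder family. -/
theorem exists_subseq_tendsto {f : ℕ → ℝ → ℝ} {K : ℝ} (hb : ∀ x, ∃ B, ∀ n, |f n x| ≤ B)
    (hK : ∀ n x y, (f n x - f n y) ^ 2 ≤ K * |x - y|) :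
    ∃ φ : ℕ → ℕ, StrictMono φ ∧ ∀ x, ∃ l, Tendsto (fun n => f (φ n) x) atTop (𝓝 l) := by
  choose B hB using hb
  obtain ⟨g, -, φ, hφ, hg⟩ := (isCompact_univ_pi (fun q : ℚ => isCompact_Icc
    (a := -B q) (b := B q))).tendsto_subseq (x := fun n (q : ℚ) => f n q)
    fun n q _ => abs_le.mp (hB q n)
  rw [tendsto_pi_nhds] at hg
  refine ⟨φ, hφ, fun x => cauchySeq_tendsto_of_complete (Metric.cauchySeq_iff'.mpr ?_)⟩
  intro ε hε
  have hK0 : 0 ≤ K := by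
    have := (sq_nonneg _).trans (hK 0 1 0)
    simpa using this
  obtain ⟨q, hq1, hq2⟩ := exists_rat_btwn (show x < x + (ε / 3) ^ 2 / (K + 1) by
    linarith [show 0 < (ε / 3) ^ 2 / (K + 1) by positivity])
  have hclose : ∀ n, |f n x - f n q| < ε / 3 := fun n => by
    refine abs_lt_of_sq_lt_sq ?_ (by positivity)
    refine (hK n x q).trans_lt ?_
    rw [abs_sub_comm, abs_of_pos (sub_pos.mpr hq1)]
    have h1 : (q : ℝ) - x < (ε / 3) ^ 2 / (K + 1) := by linarith
    rw [lt_div_iff₀ (by positivity)] at h1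
    nlinarith
  obtain ⟨N, hN⟩ := Metric.cauchySeq_iff'.mp (hg q).cauchySeq (ε / 3) (by positivity)
  refine ⟨N, fun n hn => ?_⟩
  have h1 := hN n hn
  have h2 := hclose (φ n)
  have h3 := hclose (φ N)
  simp only [Function.comp, Real.dist_eq] at h1 ⊢
  rw [abs_lt] at *
  constructor <;> linarith [h1.1, h1.2, h2.1, h2.2, h3.1, h3.2]

theorem IsProfile.mul_sq_le {h : ℝ → ℝ} {K : ℝ} (hh : IsProfile h) (hK : radialEnergy h ≤ K)
    {r : ℝ} (hr : 0 < r) : r * h r ^ 2 ≤ K := by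
  have := hh.sq_le_div hr
  rw [le_div_iff₀ hr] at this
  linarith

theorem IsProfile.mul_pow_four_le_of_pos {h : ℝ → ℝ} {K : ℝ} (hh : IsProfile h)
    (hK : radialEnergy h ≤ K) {r : ℝ} (hr : 0 < r) : r * h r ^ 4 ≤ 16 * K ^ 2 := by
  have hE := IsProfile.radialEnergy_nonneg h
  rcases le_or_gt r 1 with h1 | h1
  · refine (hh.mul_pow_four_le hr h1).trans ?_
    gcongr
  · have h2 := hh.mul_sq_le hK hr
    have h3 : h r ^ 2 ≤ K := by nlinarith [sq_nonneg (h r)]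
    nlinarith [mul_nonneg hr.le (sq_nonneg (h r)), sq_nonneg (h r)]

theorem exists_tendsto_minimizing : ∃ (f : ℕ → ℝ → ℝ) (h : ℝ → ℝ), (∀ n, IsProfile (f n)) ∧
    (∀ n r, 0 ≤ f n r) ∧ (∀ n, radialMoment 4 (f n) = radialEnergy (f n)) ∧
    Tendsto (fun n => radialEnergy (f n)) atTop (𝓝 quarticConst) ∧
    (∀ n, radialEnergy (f n) ≤ quarticConst + 1) ∧
    ∀ r, 0 < r → Tendsto (fun n => f n r) atTop (𝓝 (h r)) := by
  choose f hf hf0 hfC hfm hfE using fun n : ℕ =>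
    exists_minimizing (1 / ((n : ℝ) + 1)) Nat.one_div_pos_of_nat
  have hE1 : ∀ n, radialEnergy (f n) ≤ quarticConst + 1 := fun n => by
    have h1 : 1 / ((n : ℝ) + 1) ≤ 1 := by
      rw [div_le_one (by positivity)]
      linarith [n.cast_nonneg (α := ℝ)]
    linarith [hfE n]
  have hK0 : 0 < quarticConst + 1 := by linarith [quarticConst_pos]
  have hE : Tendsto (fun n => radialEnergy (f n)) atTop (𝓝 quarticConst) := by
    refine tendsto_of_tendsto_of_tendsto_of_le_of_le tendsto_const_nhds ?_ hfm
      (fun n => (hfE n).le)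
    simpa using tendsto_one_div_add_atTop_nhds_zero_nat.const_add quarticConst
  have hmod : ∀ n x y, x ≤ y → (f n (Real.exp x) - f n (Real.exp y)) ^ 2 ≤
      (quarticConst + 1) * (y - x) := fun n x y hxy => by
    have h1 := (hf n).sq_sub_le (Real.exp_pos x) (Real.exp_le_exp.mpr hxy)
    rw [← Real.exp_sub, Real.log_exp] at h1
    have h2 : radialDirichlet (f n) ≤ quarticConst + 1 := by
      have h3 := IsProfile.radialMoment_nonneg even_two (f n)
      have h4 := hE1 n
      rw [radialEnergy] at h4
      linarith
    nlinarith [mul_le_mul_of_nonneg_right h2 (sub_nonneg.mpr hxy)]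
  obtain ⟨φ, hφ, hl⟩ := exists_subseq_tendsto (f := fun n x => f n (Real.exp x))
    (K := quarticConst + 1) (fun x => ⟨√((quarticConst + 1) / Real.exp x), fun n => by
      refine Real.abs_le_sqrt ?_
      rw [le_div_iff₀ (Real.exp_pos x), mul_comm]
      exact (hf n).mul_sq_le (hE1 n) (Real.exp_pos x)⟩) (fun n x y => by
      rcases le_total x y with h | h
      · rw [abs_sub_comm, abs_of_nonneg (sub_nonneg.mpr h)]
        exact hmod n x y h
      · rw [abs_of_nonneg (sub_nonneg.mpr h), ← neg_sq, neg_sub]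
        exact hmod n y x h)
  choose l hl using hl
  refine ⟨fun n => f (φ n), fun r => l (Real.log r), fun n => hf _, fun n => hf0 _,
    fun n => hfC _, hE.comp hφ.tendsto_atTop, fun n => hE1 _, fun r hr => ?_⟩
  have := hl (Real.log r)
  rwa [Real.exp_log hr] at this

/-- The logarithmic cutoff, equal to `log (t / s)` on `[0, s]` and to `0` beyond `t`. -/
def logCutoff (s t r : ℝ) : ℝ := Real.log t - Real.log (max s (min r t))

section LogCutoff

variable {s t : ℝ}

theorem logCutoff_of_ge (hst : s < t) {r : ℝ} (hr : t ≤ r) : logCutoff s t r = 0 := by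
  rw [logCutoff, min_eq_right hr, max_eq_right hst.le, sub_self]

theorem logCutoff_of_le {r : ℝ} (hr : r ≤ t) :
    logCutoff s t r = Real.log t - Real.log (max s r) := by
  rw [logCutoff, min_eq_left hr]

theorem isProfile_logCutoff (hs : 0 < s) (hst : s < t) : IsProfile (logCutoff s t) := by
  refine ⟨⟨⟨s⁻¹, by positivity⟩, LipschitzWith.of_dist_le_mul fun x y => ?_⟩, t, hs.trans hst,
    fun r hr => logCutoff_of_ge hst hr⟩
  have hlog : ∀ a b : ℝ, s ≤ a → a ≤ b → |Real.log b - Real.log a| ≤ s⁻¹ * |b - a| := by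
    intro a b ha hab
    have ha0 : 0 < a := hs.trans_le ha
    have hb0 : 0 < b := ha0.trans_le hab
    rw [abs_of_nonneg (sub_nonneg.mpr (Real.log_le_log ha0 hab)),
      abs_of_nonneg (sub_nonneg.mpr hab), ← Real.log_div hb0.ne' ha0.ne']
    refine (Real.log_le_sub_one_of_pos (div_pos hb0 ha0)).trans ?_
    rw [div_sub_one ha0.ne', div_eq_inv_mul]
    have : a⁻¹ ≤ s⁻¹ := inv_anti₀ hs ha
    exact mul_le_mul_of_nonneg_right this (sub_nonneg.mpr hab)
  have hclamp : |max s (min x t) - max s (min y t)| ≤ |x - y| := by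
    rw [max_comm s, max_comm s]
    exact (abs_max_sub_max_le_abs _ _ _).trans (by
      rcases le_total x t with h1 | h1 <;> rcases le_total y t with h2 | h2 <;>
      simp only [min_eq_left, min_eq_right, h1, h2, le_refl, sub_self, abs_zero, abs_nonneg]
      · rw [abs_of_nonpos (by linarith), abs_of_nonpos (by linarith)]
        linarith
      · rw [abs_of_nonneg (by linarith), abs_of_nonneg (by linarith)]
        linarith)
  rw [Real.dist_eq, Real.dist_eq, logCutoff, logCutoff, sub_sub_sub_cancel_left]
  refine le_trans ?_ (mul_le_mul_of_nonneg_left hclamp (inv_nonneg.mpr hs.le))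
  rcases le_total (max s (min x t)) (max s (min y t)) with h | h
  · rw [abs_sub_comm (max s (min x t))]
    exact hlog _ _ (le_max_left _ _) h
  · rw [abs_sub_comm]
    exact hlog _ _ (le_max_left _ _) h

theorem logCutoff_mem_Icc (hs : 0 < s) (hst : s < t) (r : ℝ) :
    logCutoff s t r ∈ Icc 0 (Real.log t - Real.log s) := by
  have h1 : s ≤ max s (min r t) := le_max_left _ _
  have h2 : max s (min r t) ≤ t := max_le hst.le (min_le_right _ _)
  have h3 := Real.log_le_log hs h1
  have h4 := Real.log_le_log (hs.trans_le h1) h2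
  rw [logCutoff]
  constructor <;> linarith

theorem deriv_logCutoff_mid (hs : 0 < s) {r : ℝ} (h1 : s < r) (h2 : r < t) :
    deriv (logCutoff s t) r = -r⁻¹ := by
  have h3 : logCutoff s t =ᶠ[𝓝 r] fun r => Real.log t - Real.log r := by
    filter_upwards [lt_mem_nhds h1, gt_mem_nhds h2] with x hx1 hx2
    rw [logCutoff, min_eq_left hx2.le, max_eq_right hx1.le]
  rw [h3.deriv_eq]
  exact ((Real.hasDerivAt_log (hs.trans h1).ne').const_sub _).deriv

theorem deriv_logCutoff_lt (hst : s < t) {r : ℝ} (h1 : r < s) : deriv (logCutoff s t) r = 0 := by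
  have h3 : logCutoff s t =ᶠ[𝓝 r] fun _ => Real.log t - Real.log s := by
    filter_upwards [gt_mem_nhds h1] with x hx1
    rw [logCutoff, min_eq_left (hx1.trans hst).le, max_eq_left hx1.le]
  rw [h3.deriv_eq, deriv_const]

theorem deriv_logCutoff_gt (hst : s < t) {r : ℝ} (h1 : t < r) : deriv (logCutoff s t) r = 0 := by
  have h3 : logCutoff s t =ᶠ[𝓝 r] fun _ => 0 := by
    filter_upwards [lt_mem_nhds h1] with x hx1
    exact logCutoff_of_ge hst hx1.le
  rw [h3.deriv_eq, deriv_const]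

theorem IsProfile.integral_deriv_logCutoff {g : ℝ → ℝ} (hg : IsProfile g) (hs : 0 < s)
    (hst : s < t) :
    ∫ r in Ioi 0, r * (deriv g r * deriv (logCutoff s t) r) = g s - g t := by
  have hsub : Ioc s t ⊆ Ioi 0 := fun r hr => hs.trans hr.1
  have hne : ∀ᵐ r : ℝ, r ≠ s ∧ r ≠ t := by
    filter_upwards [Measure.ae_ne volume s, Measure.ae_ne volume t] with r h1 h2
    exact ⟨h1, h2⟩
  rw [setIntegral_eq_of_subset_of_ae_sdiff_eq_zero measurableSet_Ioi.nullMeasurableSet hsub]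
  · have h1 : ∫ r in Ioc s t, r * (deriv g r * deriv (logCutoff s t) r) =
        ∫ r in Ioc s t, -deriv g r := by
      refine setIntegral_congr_ae measurableSet_Ioc ?_
      filter_upwards [hne] with r hr hr2
      rw [deriv_logCutoff_mid hs hr2.1 (lt_of_le_of_ne hr2.2 hr.2)]
      have : r ≠ 0 := (hs.trans hr2.1).ne'
      field_simp
    rw [h1, integral_neg, ← intervalIntegral.integral_of_le hst.le,
      (hg.absolutelyContinuousOnInterval s t).integral_deriv_eq_sub]
    ring
  · filter_upwards [hne] with r hr hr2
    rcases lt_trichotomy r s with h | h | h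
    · rw [deriv_logCutoff_lt hst h]
      ring
    · exact absurd h hr.1
    · have : t < r := by
        by_contra! hc
        exact hr2.2 ⟨h, hc⟩
      rw [deriv_logCutoff_gt hst this]
      ring

end LogCutoff

/-- Integrals against a bounded cutoff pass to the pointwise limit. -/
theorem tendsto_setIntegral_mul_logCutoff {s t B : ℝ} (hs : 0 < s) (hst : s < t)
    {w : ℕ → ℝ → ℝ} {w' : ℝ → ℝ} (hw : ∀ n, Continuous (w n))
    (hB : ∀ n r, 0 < r → r ≤ t → |w n r| ≤ B)
    (hl : ∀ r, 0 < r → Tendsto (fun n => w n r) atTop (𝓝 (w' r))) :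
    Tendsto (fun n => ∫ r in Ioi 0, w n r * logCutoff s t r) atTop
      (𝓝 (∫ r in Ioc 0 t, w' r * logCutoff s t r)) := by
  have hred : ∀ n, ∫ r in Ioi 0, w n r * logCutoff s t r =
      ∫ r in Ioc 0 t, w n r * logCutoff s t r := fun n => by
    refine setIntegral_eq_of_subset_of_forall_sdiff_eq_zero measurableSet_Ioi
      Ioc_subset_Ioi_self fun r hr => ?_
    have : t < r := by
      by_contra! hc
      exact hr.2 ⟨hr.1, hc⟩
    rw [logCutoff_of_ge hst this.le, mul_zero]
  simp_rw [hred]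
  refine tendsto_integral_of_dominated_convergence
    (fun _ => B * (Real.log t - Real.log s)) (fun n => ?_) (integrableOn_const (by simp))
    (fun n => ?_) ?_
  · exact ((hw n).mul (isProfile_logCutoff hs hst).continuous).aestronglyMeasurable
  · filter_upwards [ae_restrict_mem measurableSet_Ioc] with r hr
    have h1 := logCutoff_mem_Icc hs hst r
    rw [Real.norm_eq_abs, abs_mul, abs_of_nonneg h1.1]
    exact mul_le_mul (hB n r hr.1 hr.2) h1.2 h1.1 ((abs_nonneg _).trans (hB n r hr.1 hr.2))
  · filter_upwards [ae_restrict_mem measurableSet_Ioc] with r hr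
    exact (hl r hr.1).mul_const _

/-- First order condition at a zero minimum of a quartic polynomial. -/
theorem eq_of_forall_quartic_nonneg {m F B e : ℝ} (hm : 0 < m)
    (h : ∀ τ : ℝ, m * (m + 4 * τ * F) ≤ (m + 2 * τ * B + τ ^ 2 * e) ^ 2) : F = B := by
  have hd : HasDerivAt (fun τ : ℝ => (m + 2 * τ * B + τ ^ 2 * e) ^ 2 - m * (m + 4 * τ * F))
      (4 * m * (B - F)) 0 := by
    have h1 : HasDerivAt (fun τ : ℝ => m + 2 * τ * B + τ ^ 2 * e) (2 * B) 0 :=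
      (((((hasDerivAt_id' (0 : ℝ)).const_mul 2).mul_const B).const_add m).add
        (((hasDerivAt_id' (0 : ℝ)).pow 2).mul_const e)).congr_deriv (by norm_num)
    have h2 : HasDerivAt (fun τ : ℝ => m * (m + 4 * τ * F)) (m * (4 * F)) 0 :=
      (((((hasDerivAt_id' (0 : ℝ)).const_mul 4).mul_const F).const_add m).const_mul
        m).congr_deriv (by norm_num)
    exact ((h1.pow 2).sub h2).congr_deriv (by norm_num; ring)
  have hmin : IsLocalMin (fun τ : ℝ =>
      (m + 2 * τ * B + τ ^ 2 * e) ^ 2 - m * (m + 4 * τ * F)) 0 := by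
    refine Eventually.of_forall fun τ => ?_
    have := h τ
    norm_num
    nlinarith
  have h0 := hmin.hasDerivAt_eq_zero hd
  have h1 : B - F = 0 := by
    rcases mul_eq_zero.mp h0 with h2 | h2
    · exact absurd h2 (by positivity)
    · exact h2
  linarith

section WeakEquation

variable {w h : ℝ → ℝ}

theorem intervalIntegrable_of_bounded (hc : ContinuousOn w (Ioi 0)) {t B : ℝ} (ht : 0 < t)
    (hb : ∀ r, 0 < r → r ≤ t → |w r| ≤ B) : IntervalIntegrable w volume 0 t := by
  rw [intervalIntegrable_iff_integrableOn_Ioc_of_le ht.le]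
  refine IntegrableOn.of_bound (by simp) ?_ B ?_
  · exact (hc.mono Ioc_subset_Ioi_self).aestronglyMeasurable measurableSet_Ioc
  · filter_upwards [ae_restrict_mem measurableSet_Ioc] with r hr
    exact hb r hr.1 hr.2

theorem hasDerivAt_integral_of_bounded (hc : ContinuousOn w (Ioi 0)) {t B : ℝ} (ht : 0 < t)
    (hb : ∀ r, 0 < r → r ≤ t → |w r| ≤ B) :
    HasDerivAt (fun x => ∫ r in (0 : ℝ)..x, w r) (w t) t :=
  intervalIntegral.integral_hasDerivAt_right (intervalIntegrable_of_bounded hc ht hb)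
    (hc.stronglyMeasurableAtFilter isOpen_Ioi t ht) (hc.continuousAt (Ioi_mem_nhds ht))

/-- A weak equation tested against logarithmic cutoffs yields a pointwise derivative. -/
theorem hasDerivAt_of_weak (hc : ContinuousOn w (Ioi 0))
    (hb : ∀ t, 0 < t → ∃ B, ∀ r, 0 < r → r ≤ t → |w r| ≤ B)
    (hw : ∀ s t, 0 < s → s < t → h s - h t = ∫ r in Ioc 0 t, w r * logCutoff s t r)
    {t : ℝ} (ht : 0 < t) : HasDerivAt h (-(∫ r in (0 : ℝ)..t, w r) / t) t := by
  set s := t / 2 with hs_def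
  have hs : 0 < s := by positivity
  have hst : s < t := by
    rw [hs_def]
    linarith
  have hcl : Continuous fun r : ℝ => Real.log (max s r) :=
    Continuous.log (by fun_prop) fun r => (hs.trans_le (le_max_left _ _)).ne'
  have hb' : ∀ x, 0 < x → ∃ B, ∀ r, 0 < r → r ≤ x → |w r * Real.log (max s r)| ≤ B := by
    intro x hx
    obtain ⟨B, hB⟩ := hb x hx
    obtain ⟨L, hL⟩ := (isCompact_Icc (a := (0 : ℝ)) (b := x)).exists_bound_of_continuousOn
      hcl.continuousOn
    refine ⟨B * L, fun r h1 h2 => ?_⟩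
    rw [abs_mul]
    exact mul_le_mul (hB r h1 h2) (hL r ⟨h1.le, h2⟩) (abs_nonneg _)
      ((abs_nonneg _).trans (hB r h1 h2))
  have hc' : ContinuousOn (fun r => w r * Real.log (max s r)) (Ioi 0) :=
    hc.mul hcl.continuousOn
  have key : h =ᶠ[𝓝 t] fun x => h s - (Real.log x * (∫ r in (0 : ℝ)..x, w r) -
      ∫ r in (0 : ℝ)..x, w r * Real.log (max s r)) := by
    filter_upwards [lt_mem_nhds hst] with x hx
    have hx0 : 0 < x := hs.trans hx
    obtain ⟨B, hB⟩ := hb x hx0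
    obtain ⟨B', hB'⟩ := hb' x hx0
    have h1 := hw s x hs hx
    rw [← intervalIntegral.integral_const_mul, ← intervalIntegral.integral_sub
      ((intervalIntegrable_of_bounded hc hx0 hB).const_mul _)
      (intervalIntegrable_of_bounded hc' hx0 hB'), intervalIntegral.integral_of_le hx0.le]
    have h2 : ∫ r in Ioc 0 x, w r * logCutoff s x r =
        ∫ r in Ioc 0 x, (Real.log x * w r - w r * Real.log (max s r)) := by
      refine setIntegral_congr_fun measurableSet_Ioc fun r hr => ?_
      simp only [logCutoff_of_le hr.2]
      ring
    rw [← h2]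
    linarith
  obtain ⟨B, hB⟩ := hb t ht
  obtain ⟨B', hB'⟩ := hb' t ht
  have hd := (((Real.hasDerivAt_log ht.ne').mul (hasDerivAt_integral_of_bounded hc ht hB)).sub
    (hasDerivAt_integral_of_bounded hc' ht hB')).const_sub (h s)
  refine HasDerivAt.congr_of_eventuallyEq (hd.congr_deriv ?_) key
  rw [max_eq_right hst.le]
  field_simp
  ring

end WeakEquation

/-- Regular solutions on `(0, ∞)` of `y'' = -y' / r + y - y ^ 3`, with `y' = p`. -/
structure IsRadialSol (y p : ℝ → ℝ) : Prop where
  hasDerivAt : ∀ r, 0 < r → HasDerivAt y (p r) r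
  hasDerivAt_deriv : ∀ r, 0 < r → HasDerivAt p (-p r / r + y r - y r ^ 3) r
  exists_bound : ∃ K, ∀ r, 0 < r → r ≤ 1 → |y r| ≤ K ∧ |p r| ≤ K * r
  integrableOn_sq : IntegrableOn (fun r => r * y r ^ 2) (Ioi 0)

theorem abs_integral_le_of_bound {w : ℝ → ℝ} {t C : ℝ} (ht : 0 < t)
    (hb : ∀ r, 0 < r → r ≤ t → |w r| ≤ C) : |∫ r in (0 : ℝ)..t, w r| ≤ C * t := by
  have := intervalIntegral.norm_integral_le_of_norm_le_const (a := 0) (b := t) (f := w) (C := C)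
    fun r hr => by
      rw [uIoc_of_le ht.le] at hr
      exact hb r hr.1 hr.2
  rwa [sub_zero, abs_of_pos ht] at this

/-- The weak radial equation has regular solutions. -/
theorem radial_regularity {h : ℝ → ℝ} (hc : ContinuousOn h (Ioi 0))
    (hb : ∀ t, 0 < t → ∃ B, ∀ r, 0 < r → r ≤ t → |r * (h r ^ 3 - h r)| ≤ B)
    (hw : ∀ s t, 0 < s → s < t →
      h s - h t = ∫ r in Ioc 0 t, r * (h r ^ 3 - h r) * logCutoff s t r)
    (hi : IntegrableOn (fun r => r * h r ^ 2) (Ioi 0)) : ∃ p, IsRadialSol h p := by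
  have hcw : ContinuousOn (fun r => r * (h r ^ 3 - h r)) (Ioi 0) :=
    continuousOn_id.mul ((hc.pow 3).sub hc)
  set Φ : ℝ → ℝ := fun t => ∫ r in (0 : ℝ)..t, r * (h r ^ 3 - h r) with hΦ
  have hd : ∀ t, 0 < t → HasDerivAt h (-Φ t / t) t := fun t ht => hasDerivAt_of_weak hcw hb hw ht
  have hdΦ : ∀ t, 0 < t → HasDerivAt Φ (t * (h t ^ 3 - h t)) t := fun t ht => by
    obtain ⟨B, hB⟩ := hb t ht
    exact hasDerivAt_integral_of_bounded hcw ht hB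
  refine ⟨fun t => -Φ t / t, hd, fun t ht => ?_, ?_, hi⟩
  · refine (((hdΦ t ht).neg).div (hasDerivAt_id' t) ht.ne').congr_deriv ?_
    have : t ≠ 0 := ht.ne'
    simp only [Pi.neg_apply]
    field_simp
    ring
  · obtain ⟨B, hB⟩ := hb 1 one_pos
    have h1 : ∀ r, 0 < r → r ≤ 1 → |-Φ r / r| ≤ B := fun r hr hr1 => by
      rw [abs_div, abs_neg, abs_of_pos hr, div_le_iff₀ hr]
      exact abs_integral_le_of_bound hr fun x hx hxr => hB x hx (hxr.trans hr1)
    have hB0 : 0 ≤ B := (abs_nonneg _).trans (hB 1 one_pos le_rfl)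
    have h2 : ∀ r, 0 < r → r ≤ 1 → |h r| ≤ |h 1| + B := fun r hr hr1 => by
      have h3 := Convex.norm_image_sub_le_of_norm_hasDerivWithin_le (f := h) (s := Ioc 0 1)
        (f' := fun t => -Φ t / t) (C := B) (fun x hx => (hd x hx.1).hasDerivWithinAt)
        (fun x hx => h1 x hx.1 hx.2) (convex_Ioc 0 1) (⟨one_pos, le_rfl⟩ : (1 : ℝ) ∈ Ioc 0 1)
        (⟨hr, hr1⟩ : r ∈ Ioc (0 : ℝ) 1)
      rw [Real.norm_eq_abs, Real.norm_eq_abs] at h3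
      have h4 : |r - 1| ≤ 1 := by
        rw [abs_le]
        constructor <;> linarith
      have h5 := abs_sub_abs_le_abs_sub (h r) (h 1)
      nlinarith
    set K := |h 1| + B with hK
    have hK0 : 0 ≤ K := by positivity
    refine ⟨K + (K ^ 3 + K), fun r hr hr1 => ⟨(h2 r hr hr1).trans (by
      linarith [pow_nonneg hK0 3]), ?_⟩⟩
    rw [abs_div, abs_neg, abs_of_pos hr, div_le_iff₀ hr]
    refine abs_integral_le_of_bound hr fun x hx hxr => ?_
    rw [abs_mul, abs_of_pos hx, mul_comm]
    refine mul_le_mul ?_ hxr hx.le (by positivity)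
    refine (abs_sub _ _).trans ?_
    rw [abs_pow]
    have := h2 x hx (hxr.trans hr1)
    have h6 : |h x| ^ 3 ≤ K ^ 3 := by gcongr
    linarith

/-- Fatou's lemma for real integrals on a half line. -/
theorem integrableOn_of_tendsto_of_integral_le {F : ℕ → ℝ → ℝ} {G : ℝ → ℝ} {c : ℕ → ℝ} {l : ℝ}
    (hF : ∀ n, IntegrableOn (F n) (Ioi 0)) (h0 : ∀ n r, 0 < r → 0 ≤ F n r)
    (hG : ∀ r, 0 < r → Tendsto (fun n => F n r) atTop (𝓝 (G r)))
    (hm : AEStronglyMeasurable G (volume.restrict (Ioi 0)))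
    (hc : ∀ n, ∫ r in Ioi 0, F n r ≤ c n) (hl : Tendsto c atTop (𝓝 l)) :
    IntegrableOn G (Ioi 0) ∧ ∫ r in Ioi 0, G r ≤ l := by
  have hG0 : ∀ r, 0 < r → 0 ≤ G r := fun r hr => ge_of_tendsto' (hG r hr) fun n => h0 n r hr
  have hG0' : 0 ≤ᵐ[volume.restrict (Ioi 0)] G := by
    filter_upwards [ae_restrict_mem measurableSet_Ioi] with r hr
    exact hG0 r hr
  have h1 : ∫⁻ r in Ioi 0, ENNReal.ofReal (G r) ≤ ENNReal.ofReal l := by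
    have h2 : ∫⁻ r in Ioi 0, ENNReal.ofReal (G r) =
        ∫⁻ r in Ioi 0, liminf (fun n => ENNReal.ofReal (F n r)) atTop := by
      refine setLIntegral_congr_fun measurableSet_Ioi fun r hr => ?_
      exact ((ENNReal.tendsto_ofReal (hG r hr)).liminf_eq).symm
    rw [h2]
    refine (lintegral_liminf_le' fun n => ?_).trans ?_
    · exact (hF n).aestronglyMeasurable.aemeasurable.ennreal_ofReal
    · rw [← (ENNReal.tendsto_ofReal hl).liminf_eq]
      refine liminf_le_liminf (Eventually.of_forall fun n => ?_)
      rw [← ofReal_integral_eq_lintegral_ofReal (hF n)]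
      · exact ENNReal.ofReal_le_ofReal (hc n)
      · filter_upwards [ae_restrict_mem measurableSet_Ioi] with r hr
        exact h0 n r hr
  have hl0 : 0 ≤ l := ge_of_tendsto' hl fun n =>
    (setIntegral_nonneg measurableSet_Ioi fun r hr => h0 n r hr).trans (hc n)
  refine ⟨⟨hm, ?_⟩, ?_⟩
  · rw [hasFiniteIntegral_iff_ofReal hG0']
    exact h1.trans_lt ENNReal.ofReal_lt_top
  · rw [integral_eq_lintegral_of_nonneg_ae hG0' hm]
    exact ENNReal.toReal_le_of_le_ofReal hl0 h1

theorem continuousOn_of_sq_sub_le_log {h : ℝ → ℝ} {K : ℝ}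
    (hK : ∀ s t, 0 < s → s ≤ t → (h t - h s) ^ 2 ≤ K * Real.log (t / s)) :
    ContinuousOn h (Ioi 0) := by
  intro t ht
  have ht : 0 < t := ht
  refine ContinuousAt.continuousWithinAt ?_
  have h1 : Tendsto (fun s => K * |Real.log s - Real.log t|) (𝓝 t) (𝓝 0) := by
    have : ContinuousAt (fun s => K * |Real.log s - Real.log t|) t := by
      have := Real.continuousAt_log ht.ne'
      fun_prop
    simpa [ContinuousAt] using this
  have h2 : Tendsto (fun s => (h s - h t) ^ 2) (𝓝 t) (𝓝 0) := by
    refine squeeze_zero' (Eventually.of_forall fun s => sq_nonneg _) ?_ h1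
    filter_upwards [lt_mem_nhds ht] with s hs
    rcases le_total s t with hst | hst
    · have h3 := hK s t hs hst
      rw [Real.log_div ht.ne' hs.ne'] at h3
      rw [abs_sub_comm, abs_of_nonneg (sub_nonneg.mpr (Real.log_le_log hs hst))]
      nlinarith
    · have h3 := hK t s ht hst
      rw [Real.log_div hs.ne' ht.ne'] at h3
      rwa [abs_of_nonneg (sub_nonneg.mpr (Real.log_le_log ht hst))]
  have h3 := h2.sqrt
  rw [Real.sqrt_zero] at h3
  simp_rw [Real.sqrt_sq_eq_abs] at h3
  rw [ContinuousAt, tendsto_iff_norm_sub_tendsto_zero]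
  exact h3

/-- The radial variational problem has a nontrivial critical point. -/
theorem exists_radialSol : ∃ h p, IsRadialSol h p ∧ (∀ r, 0 < r → 0 ≤ h r) ∧
    (∃ r, 0 < r ∧ h r ≠ 0) ∧ IntegrableOn (fun r => r * h r ^ 4) (Ioi 0) ∧
    ∫ r in Ioi 0, r * h r ^ 4 ≤ quarticConst := by
  obtain ⟨f, h, hf, hf0, hfC, hE, hE1, hl⟩ := exists_tendsto_minimizing
  set m := quarticConst with hm_def
  have hm : 0 < m := quarticConst_pos
  set K := m + 1 with hK
  have hlog : ∀ s t, 0 < s → s ≤ t → (h t - h s) ^ 2 ≤ K * Real.log (t / s) := by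
    intro s t hs hst
    refine le_of_tendsto' (((hl t (hs.trans_le hst)).sub (hl s hs)).pow 2) fun n => ?_
    refine ((hf n).sq_sub_le hs hst).trans (mul_le_mul_of_nonneg_right ?_
      (Real.log_nonneg (by rwa [one_le_div hs])))
    have h3 := IsProfile.radialMoment_nonneg even_two (f n)
    have h4 := hE1 n
    rw [radialEnergy] at h4
    linarith
  have hc : ContinuousOn h (Ioi 0) := continuousOn_of_sq_sub_le_log hlog
  have b2 : ∀ n r, 0 < r → r * f n r ^ 2 ≤ K := fun n r hr => (hf n).mul_sq_le (hE1 n) hr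
  have b4 : ∀ n r, 0 < r → r * f n r ^ 4 ≤ 16 * K ^ 2 := fun n r hr =>
    (hf n).mul_pow_four_le_of_pos (hE1 n) hr
  have bw1 : ∀ n t r, 0 < r → r ≤ t → |r * f n r| ≤ K + t := fun n t r hr hrt => by
    rw [abs_of_nonneg (mul_nonneg hr.le (hf0 n r))]
    have := b2 n r hr
    nlinarith [mul_nonneg hr.le (sq_nonneg (f n r - 1))]
  have bw3 : ∀ n t r, 0 < r → r ≤ t → |r * f n r ^ 3| ≤ K + 16 * K ^ 2 := fun n t r hr _ => by
    have h3 := hf0 n r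
    rw [abs_of_nonneg (by positivity)]
    have h1 := b2 n r hr
    have h2 := b4 n r hr
    nlinarith [mul_nonneg hr.le (mul_nonneg (sq_nonneg (f n r)) (sq_nonneg (f n r - 1)))]
  have hlw : ∀ r, 0 < r →
      Tendsto (fun n => r * f n r ^ 3 - r * f n r) atTop (𝓝 (r * (h r ^ 3 - h r))) := by
    intro r hr
    rw [mul_sub]
    exact (((hl r hr).pow 3).const_mul r).sub ((hl r hr).const_mul r)
  have hb : ∀ t, 0 < t → ∃ B, ∀ r, 0 < r → r ≤ t → |r * (h r ^ 3 - h r)| ≤ B := by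
    intro t _
    refine ⟨(K + 16 * K ^ 2) + (K + t), fun r hr hrt => ?_⟩
    refine le_of_tendsto' (hlw r hr).abs fun n => ?_
    exact (abs_sub _ _).trans (add_le_add (bw3 n t r hr hrt) (bw1 n t r hr hrt))
  have hweak : ∀ s t, 0 < s → s < t →
      h s - h t = ∫ r in Ioc 0 t, r * (h r ^ 3 - h r) * logCutoff s t r := by
    intro s t hs hst
    have hψ := isProfile_logCutoff hs hst
    have t1 := tendsto_setIntegral_mul_logCutoff hs hst (w := fun n r => r * f n r)
      (w' := fun r => r * h r) (fun n => continuous_id.mul (hf n).continuous)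
      (fun n r => bw1 n t r) (fun r hr => (hl r hr).const_mul r)
    have t3 := tendsto_setIntegral_mul_logCutoff hs hst (w := fun n r => r * f n r ^ 3)
      (w' := fun r => r * h r ^ 3) (fun n => continuous_id.mul ((hf n).continuous.pow 3))
      (fun n r => bw3 n t r) (fun r hr => ((hl r hr).pow 3).const_mul r)
    have key : ∀ τ : ℝ, m * (m + 4 * τ * ∫ r in Ioc 0 t, r * h r ^ 3 * logCutoff s t r) ≤
        (m + 2 * τ * (h s - h t + ∫ r in Ioc 0 t, r * h r * logCutoff s t r) +
          τ ^ 2 * radialEnergy (logCutoff s t)) ^ 2 := by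
      intro τ
      refine le_of_tendsto_of_tendsto' ((hE.add (t3.const_mul (4 * τ))).const_mul m)
        (((hE.add ((((hl s hs).sub (hl t (hs.trans hst))).add t1).const_mul (2 * τ))).add_const
          (τ ^ 2 * radialEnergy (logCutoff s t))).pow 2) fun n => ?_
      have h1 := quarticConst_mul_le ((hf n).add_const_mul hψ τ)
      have h2 := (hf n).radialMoment_four_add_ge hψ τ
      rw [(hf n).radialEnergy_add hψ, (hf n).integral_deriv_logCutoff hs hst] at h1
      rw [hfC] at h2
      simp_rw [← mul_assoc _ (f n _ ^ 3)] at h2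
      simp_rw [← mul_assoc _ (f n _) (logCutoff s t _)] at h1
      exact (mul_le_mul_of_nonneg_left h2 hm.le).trans h1
    have h0 := eq_of_forall_quartic_nonneg hm key
    have hi : ∀ {w : ℝ → ℝ} {B : ℝ}, ContinuousOn w (Ioi 0) →
        (∀ r, 0 < r → r ≤ t → |w r| ≤ B) →
        IntegrableOn (fun r => w r * logCutoff s t r) (Ioc 0 t) := by
      intro w B hcw hbw
      have h1 := intervalIntegrable_of_bounded hcw (hs.trans hst) hbw
      have h2 := h1.mul_continuousOn (hψ.continuous.continuousOn (s := uIcc 0 t))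
      rwa [intervalIntegrable_iff_integrableOn_Ioc_of_le (hs.trans hst).le] at h2
    have h1 : ∫ r in Ioc 0 t, r * (h r ^ 3 - h r) * logCutoff s t r =
        (∫ r in Ioc 0 t, r * h r ^ 3 * logCutoff s t r) -
          ∫ r in Ioc 0 t, r * h r * logCutoff s t r := by
      rw [← integral_sub]
      · congr 1
        ext r
        ring
      · refine hi (B := K + 16 * K ^ 2) (continuousOn_id.mul (hc.pow 3)) fun r hr hrt => ?_
        exact le_of_tendsto' (((hl r hr).pow 3).const_mul r).abs fun n => bw3 n t r hr hrt
      · refine hi (B := K + t) (continuousOn_id.mul hc) fun r hr hrt => ?_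
        exact le_of_tendsto' ((hl r hr).const_mul r).abs fun n => bw1 n t r hr hrt
    rw [h1, h0]
    ring
  have hm2 : ∀ n : ℕ, AEStronglyMeasurable (fun r => r * h r ^ n) (volume.restrict (Ioi 0)) :=
    fun n => (continuousOn_id.mul (hc.pow n)).aestronglyMeasurable measurableSet_Ioi
  have i2 := integrableOn_of_tendsto_of_integral_le (c := fun _ => K)
    (fun n => (hf n).integrableOn_moment two_ne_zero)
    (fun n r hr => by positivity) (fun r hr => ((hl r hr).pow 2).const_mul r) (hm2 2)
    (fun n => by
      have h3 := IsProfile.radialDirichlet_nonneg (f n)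
      have h4 := hE1 n
      rw [radialEnergy, radialMoment] at h4
      linarith) tendsto_const_nhds
  have i4 := integrableOn_of_tendsto_of_integral_le
    (fun n => (hf n).integrableOn_moment four_ne_zero)
    (fun n r hr => by positivity) (fun r hr => ((hl r hr).pow 4).const_mul r) (hm2 4)
    (fun n => (hfC n).le) hE
  obtain ⟨p, hp⟩ := radial_regularity hc hb hweak i2.1
  refine ⟨h, p, hp, fun r hr => ge_of_tendsto' (hl r hr) fun n => hf0 n r, ?_, i4.1, i4.2⟩
  by_contra! hzero
  have hK0 : 0 < K := by positivity
  set R := 2 * K ^ 2 / m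
  have hR : 0 < R := by positivity
  have h1 : Tendsto (fun n => ∫ r in Ioc 0 R, r * f n r ^ 4) atTop (𝓝 0) := by
    have : Tendsto (fun n => ∫ r in Ioc 0 R, r * f n r ^ 4) atTop
        (𝓝 (∫ r in Ioc 0 R, (0 : ℝ))) := by
      refine tendsto_integral_of_dominated_convergence (fun _ => 16 * K ^ 2) (fun n => ?_)
        (integrableOn_const (by simp)) (fun n => ?_) ?_
      · exact (continuous_id.mul ((hf n).continuous.pow 4)).aestronglyMeasurable
      · filter_upwards [ae_restrict_mem measurableSet_Ioc] with r hr
        have h2 : 0 < r := hr.1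
        rw [Real.norm_eq_abs, abs_of_nonneg (by positivity)]
        exact b4 n r h2
      · filter_upwards [ae_restrict_mem measurableSet_Ioc] with r hr
        have h2 := ((hl r hr.1).pow 4).const_mul r
        rw [hzero r hr.1] at h2
        simpa using h2
    simpa using this
  have h2 : m ≤ 0 + K ^ 2 / R := by
    refine le_of_tendsto_of_tendsto' hE (h1.add_const _) fun n => ?_
    have h4 := (hf n).integrableOn_moment four_ne_zero
    have h3 : radialMoment 4 (f n) =
        (∫ r in Ioc 0 R, r * f n r ^ 4) + ∫ r in Ioi R, r * f n r ^ 4 := by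
      rw [radialMoment, ← Ioc_union_Ioi_eq_Ioi hR.le]
      exact setIntegral_union (Ioc_disjoint_Ioi le_rfl) measurableSet_Ioi
        (h4.mono_set Ioc_subset_Ioi_self) (h4.mono_set (Ioi_subset_Ioi hR.le))
    rw [← hfC, h3]
    refine add_le_add_right ((hf n).setIntegral_tail_le hR |>.trans ?_) _
    have := IsProfile.radialEnergy_nonneg (f n)
    have := hE1 n
    gcongr
  have h3 : K ^ 2 / R = m / 2 := by
    simp only [R]
    field_simp
  rw [h3] at h2
  linarith

/-- A function on `(0, δ]` vanishing at the origin is controlled by its derivative. -/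
theorem abs_le_mul_of_hasDerivAt {f f' : ℝ → ℝ} {C δ : ℝ}
    (hf : ∀ r, 0 < r → r ≤ δ → HasDerivAt f (f' r) r) (hC : ∀ r, 0 < r → r ≤ δ → |f' r| ≤ C)
    (h0 : Tendsto f (𝓝[>] 0) (𝓝 0)) {r : ℝ} (hr : 0 < r) (hrδ : r ≤ δ) : |f r| ≤ C * r := by
  have h1 : ∀ s, 0 < s → s ≤ r → |f r - f s| ≤ C * r := fun s hs hsr => by
    have h2 := Convex.norm_image_sub_le_of_norm_hasDerivWithin_le (f := f) (s := Ioc 0 δ)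
      (f' := f') (C := C) (fun x hx => (hf x hx.1 hx.2).hasDerivWithinAt)
      (fun x hx => hC x hx.1 hx.2) (convex_Ioc 0 δ) (⟨hs, hsr.trans hrδ⟩ : s ∈ Ioc 0 δ)
      (⟨hr, hrδ⟩ : r ∈ Ioc (0 : ℝ) δ)
    rw [Real.norm_eq_abs, Real.norm_eq_abs, abs_of_nonneg (sub_nonneg.mpr hsr)] at h2
    have hC0 : 0 ≤ C := (abs_nonneg _).trans (hC r hr hrδ)
    nlinarith
  have h2 : Tendsto (fun s => |f r - f s|) (𝓝[>] 0) (𝓝 |f r - 0|) := (h0.const_sub _).abs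
  rw [sub_zero] at h2
  refine le_of_tendsto h2 ?_
  filter_upwards [Ioc_mem_nhdsGT hr] with s hs
  exact h1 s hs.1 hs.2

theorem abs_deriv_diff_sq_le {s x Y Z B B' : ℝ} (hs : 0 < s) (hx : s ≤ x) (hY : |Y| ≤ B)
    (hZ : |Z| ≤ B') (P Q : ℝ) :
    |2 * (Y - Z) * (P - Q) + 2 * (P - Q) * ((-P / x + Y - Y ^ 3) - (-Q / x + Z - Z ^ 3))| ≤
      (2 + 2 * (B ^ 2 + B' ^ 2) + 2 / s) * ((Y - Z) ^ 2 + (P - Q) ^ 2) := by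
  have hx0 : 0 < x := hs.trans_le hx
  have b1 : Y ^ 2 ≤ B ^ 2 := sq_le_sq' (neg_le_of_abs_le hY) (le_of_abs_le hY)
  have b2 : Z ^ 2 ≤ B' ^ 2 := sq_le_sq' (neg_le_of_abs_le hZ) (le_of_abs_le hZ)
  have b3 : 1 / x ≤ 1 / s := one_div_le_one_div_of_le hs hx
  have b3' : 0 < 1 / x := by positivity
  have h2 : 2 * (Y - Z) * (P - Q) + 2 * (P - Q) * ((-P / x + Y - Y ^ 3) -
      (-Q / x + Z - Z ^ 3)) = 2 * ((Y - Z) * (P - Q)) * (2 - (Y ^ 2 + Y * Z + Z ^ 2)) -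
        2 * (P - Q) ^ 2 * (1 / x) := by
    field_simp
    ring
  have hk0 : 0 ≤ Y ^ 2 + Y * Z + Z ^ 2 := by nlinarith [sq_nonneg (Y + Z), sq_nonneg (Y - Z)]
  have hk1 : Y ^ 2 + Y * Z + Z ^ 2 ≤ 2 * (B ^ 2 + B' ^ 2) := by nlinarith [sq_nonneg (Y - Z)]
  rw [h2]
  generalize Y ^ 2 + Y * Z + Z ^ 2 = k at *
  generalize 2 * (B ^ 2 + B' ^ 2) = b at *
  generalize Y - Z = e at *
  generalize P - Q = d at *
  have h4 : |2 * (e * d)| ≤ e ^ 2 + d ^ 2 := by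
    rw [abs_le]
    constructor <;> nlinarith [sq_nonneg (e + d), sq_nonneg (e - d)]
  have h5 : |2 - k| ≤ 2 + k := by
    rw [abs_le]
    constructor <;> linarith
  have h6 : |2 * (e * d) * (2 - k)| ≤ (e ^ 2 + d ^ 2) * (2 + k) := by
    rw [abs_mul]
    exact mul_le_mul h4 h5 (abs_nonneg _) (by positivity)
  have h7 : |2 * d ^ 2 * (1 / x)| ≤ 2 * (e ^ 2 + d ^ 2) * (1 / s) := by
    rw [abs_of_nonneg (by positivity)]
    refine mul_le_mul ?_ b3 b3'.le (by positivity)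
    nlinarith [sq_nonneg e]
  refine (abs_sub _ _).trans ?_
  have h8 : (e ^ 2 + d ^ 2) * (2 + k) ≤ (e ^ 2 + d ^ 2) * (2 + b) := by
    gcongr
  calc _ ≤ (e ^ 2 + d ^ 2) * (2 + b) + 2 * (e ^ 2 + d ^ 2) * (1 / s) := add_le_add (h6.trans h8) h7
    _ = _ := by ring

namespace IsRadialSol

variable {y p z q : ℝ → ℝ}

theorem continuousOn (h : IsRadialSol y p) : ContinuousOn y (Ioi 0) := fun r hr =>
  (h.hasDerivAt r hr).continuousAt.continuousWithinAt

theorem continuousOn_deriv (h : IsRadialSol y p) : ContinuousOn p (Ioi 0) := fun r hr =>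
  (h.hasDerivAt_deriv r hr).continuousAt.continuousWithinAt

theorem zero : IsRadialSol (fun _ => 0) fun _ => 0 where
  hasDerivAt r _ := hasDerivAt_const r 0
  hasDerivAt_deriv r _ := (hasDerivAt_const r 0).congr_deriv (by simp)
  exists_bound := ⟨0, fun r _ _ => by simp⟩
  integrableOn_sq := by simp

theorem exists_tendsto (h : IsRadialSol y p) : ∃ l, Tendsto y (𝓝[>] 0) (𝓝 l) := by
  obtain ⟨K, hK⟩ := h.exists_bound
  have hK0 : 0 ≤ K := (abs_nonneg _).trans (hK 1 one_pos le_rfl).1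
  have hL : LipschitzOnWith K.toNNReal y (Ioc 0 1) := by
    refine (convex_Ioc 0 1).lipschitzOnWith_of_nnnorm_hasDerivWithin_le
      (fun x hx => (h.hasDerivAt x hx.1).hasDerivWithinAt) fun x hx => ?_
    rw [← NNReal.coe_le_coe, coe_nnnorm, Real.norm_eq_abs, Real.coe_toNNReal K hK0]
    exact (hK x hx.1 hx.2).2.trans (mul_le_of_le_one_right hK0 hx.2)
  obtain ⟨g, hg, hgy⟩ := hL.extend_real
  refine ⟨g 0, (hg.continuous.continuousAt.tendsto.mono_left nhdsWithin_le_nhds).congr' ?_⟩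
  filter_upwards [Ioc_mem_nhdsGT one_pos] with x hx
  exact (hgy hx).symm

theorem tendsto_deriv (h : IsRadialSol y p) : Tendsto p (𝓝[>] 0) (𝓝 0) := by
  obtain ⟨K, hK⟩ := h.exists_bound
  have h1 : Tendsto (fun r : ℝ => K * r) (𝓝[>] 0) (𝓝 0) := by
    have : Tendsto (fun r : ℝ => K * r) (𝓝 0) (𝓝 (K * 0)) := tendsto_id.const_mul K
    rw [mul_zero] at this
    exact this.mono_left nhdsWithin_le_nhds
  refine squeeze_zero_norm' ?_ h1
  filter_upwards [Ioc_mem_nhdsGT one_pos] with x hx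
  exact (hK x hx.1 hx.2).2

/-- Uniqueness for the initial value problem at a positive radius. -/
theorem eq_of_eq_at (hy : IsRadialSol y p) (hz : IsRadialSol z q) {a : ℝ} (ha : 0 < a)
    (h0 : y a = z a) (h1 : p a = q a) {r : ℝ} (hr : 0 < r) : y r = z r := by
  set s := min a r with hs
  set t := max a r with ht
  have hs0 : 0 < s := lt_min ha hr
  have hsub : Icc s t ⊆ Ioi 0 := fun x hx => hs0.trans_le hx.1
  obtain ⟨B, hB⟩ := isCompact_Icc.exists_bound_of_continuousOn (hy.continuousOn.mono hsub)
  obtain ⟨B', hB'⟩ := isCompact_Icc.exists_bound_of_continuousOn (hz.continuousOn.mono hsub)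
  set C := 2 + 2 * (B ^ 2 + B' ^ 2) + 2 / s with hC
  set F : ℝ → ℝ := fun x => (y x - z x) ^ 2 + (p x - q x) ^ 2 with hF
  set F' : ℝ → ℝ := fun x => 2 * (y x - z x) * (p x - q x) + 2 * (p x - q x) *
    ((-p x / x + y x - y x ^ 3) - (-q x / x + z x - z x ^ 3)) with hF'
  have hd : ∀ x, 0 < x → HasDerivAt F (F' x) x := fun x hx => by
    refine ((((hy.hasDerivAt x hx).sub (hz.hasDerivAt x hx)).pow 2).add
      (((hy.hasDerivAt_deriv x hx).sub (hz.hasDerivAt_deriv x hx)).pow 2)).congr_deriv ?_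
    simp only [hF', Pi.sub_apply]
    push_cast
    ring
  have hF0 : ∀ x, 0 ≤ F x := fun x => by positivity
  have hbound : ∀ x ∈ Icc s t, |F' x| ≤ C * F x := fun x hx =>
    abs_deriv_diff_sq_le hs0 hx.1 (hB x hx) (hB' x hx) (p x) (q x)
  have hFa : F a = 0 := by
    simp only [hF, h0, h1]
    ring
  have hexp : ∀ c x : ℝ, HasDerivAt (fun x => Real.exp (c * x)) (Real.exp (c * x) * c) x :=
    fun c x => by simpa using ((hasDerivAt_id' x).const_mul c).exp
  have hFr : F r ≤ 0 := by
    rcases le_total a r with har | har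
    · have hst : s = a ∧ t = r := ⟨min_eq_left har, max_eq_right har⟩
      have hanti : AntitoneOn (fun x => F x * Real.exp (-C * x)) (Icc s t) := by
        refine antitoneOn_of_hasDerivWithinAt_nonpos (convex_Icc s t) (fun x hx =>
          ((hd x (hsub hx)).mul (hexp (-C) x)).continuousAt.continuousWithinAt)
          (fun x hx => ((hd x (hsub (interior_subset hx))).mul (hexp (-C) x)).hasDerivWithinAt) ?_
        intro x hx
        have h2 := (le_abs_self _).trans (hbound x (interior_subset hx))
        have h3 := Real.exp_pos (-C * x)
        nlinarith
      have h2 := hanti (show a ∈ Icc s t from ⟨hst.1.le, har.trans hst.2.ge⟩)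
        (show r ∈ Icc s t from ⟨hst.1.le.trans har, hst.2.ge⟩) har
      simp only [hFa, zero_mul] at h2
      exact nonpos_of_mul_nonpos_left h2 (Real.exp_pos _)
    · have hst : s = r ∧ t = a := ⟨min_eq_right har, max_eq_left har⟩
      have hmono : MonotoneOn (fun x => F x * Real.exp (C * x)) (Icc s t) := by
        refine monotoneOn_of_hasDerivWithinAt_nonneg (convex_Icc s t) (fun x hx =>
          ((hd x (hsub hx)).mul (hexp C x)).continuousAt.continuousWithinAt)
          (fun x hx => ((hd x (hsub (interior_subset hx))).mul (hexp C x)).hasDerivWithinAt) ?_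
        intro x hx
        have h2 := (neg_le_of_abs_le (hbound x (interior_subset hx)))
        have h3 := Real.exp_pos (C * x)
        nlinarith
      have h2 := hmono (show r ∈ Icc s t from ⟨hst.1.le, har.trans hst.2.ge⟩)
        (show a ∈ Icc s t from ⟨hst.1.le.trans har, hst.2.ge⟩) har
      simp only [hFa, zero_mul] at h2
      exact nonpos_of_mul_nonpos_left h2 (Real.exp_pos _)
  have h2 : (y r - z r) ^ 2 ≤ 0 := by
    have := sq_nonneg (p r - q r)
    simp only [hF] at hFr
    linarith
  have h3 : y r - z r = 0 := by
    have := le_antisymm h2 (sq_nonneg _)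
    exact pow_eq_zero_iff two_ne_zero |>.mp this
  linarith

/-- Uniqueness for the initial value problem at the origin. -/
theorem eq_of_tendsto (hy : IsRadialSol y p) (hz : IsRadialSol z q) {l : ℝ}
    (ly : Tendsto y (𝓝[>] 0) (𝓝 l)) (lz : Tendsto z (𝓝[>] 0) (𝓝 l)) {r : ℝ} (hr : 0 < r) :
    y r = z r := by
  obtain ⟨K, hK⟩ := hy.exists_bound
  obtain ⟨K', hK'⟩ := hz.exists_bound
  set L := 1 + 2 * (K ^ 2 + K' ^ 2) with hL
  have hL1 : 1 ≤ L := by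
    rw [hL]
    nlinarith [sq_nonneg K, sq_nonneg K']
  set δ := 1 / (2 * L) with hδ
  have hδ0 : 0 < δ := by positivity
  have hLδ : L * δ = 1 / 2 := by
    rw [hδ]
    field_simp
  have hδ1 : δ ≤ 1 := by nlinarith
  have le0 : Tendsto (fun x => y x - z x) (𝓝[>] 0) (𝓝 0) := by simpa using ly.sub lz
  have ld0 : Tendsto (fun x => x * (p x - q x)) (𝓝[>] 0) (𝓝 0) := by
    have h1 : Tendsto (fun x : ℝ => x) (𝓝[>] 0) (𝓝 0) := tendsto_id.mono_left nhdsWithin_le_nhds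
    simpa using h1.mul (hy.tendsto_deriv.sub hz.tendsto_deriv)
  have hg : ∀ x, 0 < x → x ≤ δ → |x * ((y x - y x ^ 3) - (z x - z x ^ 3))| ≤
      x * (L * |y x - z x|) := fun x hx hxδ => by
    have h1 := (hK x hx (hxδ.trans hδ1)).1
    have h2 := (hK' x hx (hxδ.trans hδ1)).1
    have b1 : y x ^ 2 ≤ K ^ 2 := by
      rw [← sq_abs (y x)]
      exact pow_le_pow_left₀ (abs_nonneg _) h1 2
    have b2 : z x ^ 2 ≤ K' ^ 2 := by
      rw [← sq_abs (z x)]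
      exact pow_le_pow_left₀ (abs_nonneg _) h2 2
    rw [abs_mul, abs_of_pos hx]
    refine mul_le_mul_of_nonneg_left ?_ hx.le
    have h3 : (y x - y x ^ 3) - (z x - z x ^ 3) =
        (1 - (y x ^ 2 + y x * z x + z x ^ 2)) * (y x - z x) := by ring
    rw [h3, abs_mul]
    refine mul_le_mul_of_nonneg_right ?_ (abs_nonneg _)
    rw [abs_le]
    constructor <;> nlinarith [sq_nonneg (y x - z x), sq_nonneg (y x + z x)]
  have step : ∀ A, (∀ x, 0 < x → x ≤ δ → |y x - z x| ≤ A) →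
      ∀ x, 0 < x → x ≤ δ → |y x - z x| ≤ A / 2 := by
    intro A hA
    have hA0 : 0 ≤ A := (abs_nonneg _).trans (hA δ hδ0 le_rfl)
    have h1 : ∀ x, 0 < x → x ≤ δ → |p x - q x| ≤ A / 2 := fun x hx hxδ => by
      have h2 := abs_le_mul_of_hasDerivAt (f := fun x => x * (p x - q x))
        (f' := fun x => x * ((y x - y x ^ 3) - (z x - z x ^ 3))) (C := A / 2) (δ := δ)
        (fun x hx _ => ((hasDerivAt_id' x).mul ((hy.hasDerivAt_deriv x hx).sub
          (hz.hasDerivAt_deriv x hx))).congr_deriv (by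
            simp only [Pi.sub_apply]
            field_simp
            ring)) (fun x hx hxδ => (hg x hx hxδ).trans (by
          have h3 := hA x hx hxδ
          have h4 : x * (L * |y x - z x|) ≤ δ * (L * A) := by gcongr
          nlinarith)) ld0 hx hxδ
      rw [abs_mul, abs_of_pos hx] at h2
      nlinarith
    intro x hx hxδ
    have h2 := abs_le_mul_of_hasDerivAt (f := fun x => y x - z x) (f' := fun x => p x - q x)
      (fun x hx _ => (hy.hasDerivAt x hx).sub (hz.hasDerivAt x hx)) h1 le0 hx hxδ
    have h3 : A / 2 * x ≤ A / 2 * 1 := by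
      gcongr
      exact hxδ.trans hδ1
    linarith
  have hiter : ∀ n : ℕ, ∀ x, 0 < x → x ≤ δ → |y x - z x| ≤ (K + K') * (1 / 2) ^ n := by
    intro n
    induction n with
    | zero =>
      intro x hx hxδ
      rw [pow_zero, mul_one]
      exact (abs_sub _ _).trans (add_le_add (hK x hx (hxδ.trans hδ1)).1
        (hK' x hx (hxδ.trans hδ1)).1)
    | succ n ih =>
      intro x hx hxδ
      have := step _ ih x hx hxδ
      rw [pow_succ]
      linarith
  have hzero : ∀ x, 0 < x → x ≤ δ → y x = z x := fun x hx hxδ => by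
    have h1 : Tendsto (fun n : ℕ => (K + K') * (1 / 2 : ℝ) ^ n) atTop (𝓝 ((K + K') * 0)) :=
      (tendsto_pow_atTop_nhds_zero_of_lt_one (by norm_num) (by norm_num)).const_mul _
    have h2 := ge_of_tendsto' h1 fun n => hiter n x hx hxδ
    rw [mul_zero] at h2
    exact sub_eq_zero.mp (abs_nonpos_iff.mp h2)
  have hδ2 : 0 < δ / 2 := by positivity
  refine eq_of_eq_at hy hz hδ2 (hzero _ hδ2 (by linarith)) ?_ hr
  refine (hy.hasDerivAt _ hδ2).unique ((hz.hasDerivAt _ hδ2).congr_of_eventuallyEq ?_)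
  filter_upwards [Ioo_mem_nhds hδ2 (show δ / 2 < δ by linarith)] with x hx
  exact hzero x hx.1 hx.2.le

/-- A nonnegative nontrivial solution is positive. -/
theorem pos_of_nonneg (hy : IsRadialSol y p) (h0 : ∀ r, 0 < r → 0 ≤ y r)
    (h1 : ∃ r, 0 < r ∧ y r ≠ 0) {r : ℝ} (hr : 0 < r) : 0 < y r := by
  refine lt_of_le_of_ne (h0 r hr) fun hyr => ?_
  obtain ⟨s, hs, hys⟩ := h1
  have hmin : IsLocalMin y r := by
    filter_upwards [lt_mem_nhds hr] with x hx
    rw [← hyr]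
    exact h0 x hx
  exact hys (eq_of_eq_at hy zero hr hyr.symm (hmin.hasDerivAt_eq_zero (hy.hasDerivAt r hr)) hs)

/-- A positive solution has a positive limit at the origin. -/
theorem pos_of_tendsto (hy : IsRadialSol y p) (h0 : ∀ r, 0 < r → 0 < y r) {l : ℝ}
    (hl : Tendsto y (𝓝[>] 0) (𝓝 l)) : 0 < l := by
  refine lt_of_le_of_ne (ge_of_tendsto hl ?_) fun h => ?_
  · filter_upwards [self_mem_nhdsWithin] with x hx
    exact (h0 x hx).le
  · rw [← h] at hl
    exact (h0 1 one_pos).ne' (eq_of_tendsto hy zero hl tendsto_const_nhds one_pos)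

end IsRadialSol

/-- A weighted Pohozaev energy density, in the variable `x = r ^ (1 / 3)`. -/
def pohozaevDensity (x a b : ℝ) : ℝ :=
  x ^ 4 * b ^ 2 / 2 + x * a * b / 3 + a ^ 2 / (9 * x ^ 2) - x ^ 4 * a ^ 2 / 2 + x ^ 4 * a ^ 4 / 4

theorem frequently_mul_lt_of_integrableOn {g : ℝ → ℝ} (hg : IntegrableOn g (Ioi 1)) {ε : ℝ}
    (hε : 0 < ε) : ∃ᶠ r in atTop, r * g r < ε := by
  intro hcon
  obtain ⟨N, hN⟩ := eventually_atTop.mp hcon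
  have h1 : IntegrableOn g (Ioi (max N 1)) := hg.mono_set (Ioi_subset_Ioi (le_max_right _ _))
  refine not_integrableOn_Ioi_inv (a := max N 1) ?_
  refine (h1.const_mul ε⁻¹).mono' (by fun_prop) ?_
  filter_upwards [ae_restrict_mem measurableSet_Ioi] with r hr
  have hr1 : max N 1 < r := hr
  have hr0 : 0 < r := one_pos.trans ((le_max_right _ _).trans_lt hr1)
  have h2 := not_lt.mp (hN r ((le_max_left _ _).trans hr1.le))
  rw [Real.norm_eq_abs, abs_of_pos (by positivity), ← div_eq_inv_mul, le_div_iff₀ hε,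
    ← div_eq_inv_mul, div_le_iff₀ hr0]
  linarith

theorem abs_pohozaevDensity_le {x a b ε : ℝ} (hx : 1 ≤ x) (hε : ε ≤ 1)
    (h : x ^ 6 * (a ^ 2 + b ^ 2) ≤ ε) : |pohozaevDensity x a b| ≤ 3 * ε := by
  have hx0 : 0 < x := by linarith
  have p1 : x ^ 4 ≤ x ^ 6 := pow_le_pow_right₀ hx (by norm_num)
  have p2 : x ≤ x ^ 6 := le_self_pow₀ hx (by norm_num)
  have p3 : 1 ≤ x ^ 6 := one_le_pow₀ hx
  have ha : x ^ 6 * a ^ 2 ≤ ε := by nlinarith [mul_nonneg (by positivity : 0 ≤ x ^ 6) (sq_nonneg b)]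
  have hb : x ^ 6 * b ^ 2 ≤ ε := by nlinarith [mul_nonneg (by positivity : 0 ≤ x ^ 6) (sq_nonneg a)]
  have a1 : a ^ 2 ≤ 1 := by nlinarith [sq_nonneg a]
  have t1 : x ^ 4 * b ^ 2 ≤ ε := by nlinarith [sq_nonneg b]
  have t2 : x ^ 4 * a ^ 2 ≤ ε := by nlinarith [sq_nonneg a]
  have t3 : |x * a * b| ≤ ε := by
    have h1 : |a * b| ≤ a ^ 2 + b ^ 2 := by
      rw [abs_le]
      constructor <;> nlinarith [sq_nonneg (a + b), sq_nonneg (a - b)]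
    rw [mul_assoc, abs_mul, abs_of_pos hx0]
    have h2 : x * |a * b| ≤ x ^ 6 * (a ^ 2 + b ^ 2) := by gcongr
    linarith
  have t4 : a ^ 2 / (9 * x ^ 2) ≤ ε := by
    rw [div_le_iff₀ (by positivity)]
    have h1 : 1 ≤ x ^ 2 := one_le_pow₀ hx
    have h2 : 0 ≤ ε := by
      refine le_trans ?_ ha
      positivity
    nlinarith [sq_nonneg a]
  have t4' : 0 ≤ a ^ 2 / (9 * x ^ 2) := by positivity
  have t5 : x ^ 4 * a ^ 4 ≤ ε := by
    have h1 : 0 ≤ x ^ 4 * a ^ 2 := by positivity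
    have h2 : x ^ 4 * a ^ 4 = x ^ 4 * a ^ 2 * a ^ 2 := by ring
    rw [h2]
    nlinarith
  have t1' : 0 ≤ x ^ 4 * b ^ 2 := by positivity
  have t2' : 0 ≤ x ^ 4 * a ^ 2 := by positivity
  have t5' : 0 ≤ x ^ 4 * a ^ 4 := by positivity
  rw [abs_le] at t3 ⊢
  rw [pohozaevDensity]
  constructor <;> linarith [t3.1, t3.2]

namespace IsRadialSol

variable {u p v q : ℝ → ℝ}

theorem hasDerivAt_comp_cube (hu : IsRadialSol u p) {x : ℝ} (hx : 0 < x) :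
    HasDerivAt (fun x => u (x ^ 3)) (p (x ^ 3) * (3 * x ^ 2)) x := by
  have h1 : HasDerivAt (fun x : ℝ => x ^ 3) (3 * x ^ 2) x := by
    simpa using hasDerivAt_pow 3 x
  exact HasDerivAt.comp x (hu.hasDerivAt (x ^ 3) (by positivity)) h1

theorem hasDerivAt_deriv_comp_cube (hu : IsRadialSol u p) {x : ℝ} (hx : 0 < x) :
    HasDerivAt (fun x => p (x ^ 3))
      ((-p (x ^ 3) / x ^ 3 + u (x ^ 3) - u (x ^ 3) ^ 3) * (3 * x ^ 2)) x := by
  have h1 : HasDerivAt (fun x : ℝ => x ^ 3) (3 * x ^ 2) x := by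
    simpa using hasDerivAt_pow 3 x
  exact HasDerivAt.comp x (hu.hasDerivAt_deriv (x ^ 3) (by positivity)) h1

theorem hasDerivAt_pohozaevDensity (hu : IsRadialSol u p) {x : ℝ} (hx : 0 < x) :
    HasDerivAt (fun x => pohozaevDensity x (u (x ^ 3)) (p (x ^ 3)))
      (-(2 / (9 * x ^ 3) + x ^ 3) * u (x ^ 3) ^ 2) x := by
  have hU := hu.hasDerivAt_comp_cube hx
  have hP := hu.hasDerivAt_deriv_comp_cube hx
  have h4 : HasDerivAt (fun x : ℝ => x ^ 4) (4 * x ^ 3) x := by simpa using hasDerivAt_pow 4 x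
  have h2 : HasDerivAt (fun x : ℝ => 9 * x ^ 2) (9 * (2 * x)) x := by
    simpa using (hasDerivAt_pow 2 x).const_mul 9
  have := (((((h4.mul (hP.pow 2)).div_const 2).add
    ((((hasDerivAt_id' x).mul hU).mul hP).div_const 3)).add
    ((hU.pow 2).div h2 (by positivity))).sub ((h4.mul (hU.pow 2)).div_const 2)).add
    ((h4.mul (hU.pow 4)).div_const 4)
  refine this.congr_deriv ?_
  simp only [Pi.mul_apply, Pi.pow_apply]
  push_cast
  have hx' : x ≠ 0 := hx.ne'
  generalize u (x ^ 3) = U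
  generalize p (x ^ 3) = P
  field_simp
  ring

theorem strictAntiOn_pohozaevDensity (hu : IsRadialSol u p) (h0 : ∀ r, 0 < r → 0 < u r) :
    StrictAntiOn (fun x => pohozaevDensity x (u (x ^ 3)) (p (x ^ 3))) (Ioi 0) := by
  refine strictAntiOn_of_hasDerivWithinAt_neg (convex_Ioi 0) (fun x hx =>
    (hu.hasDerivAt_pohozaevDensity hx).continuousAt.continuousWithinAt) (fun x hx =>
    (hu.hasDerivAt_pohozaevDensity (interior_subset hx)).hasDerivWithinAt) fun x hx => ?_
  have hx : 0 < x := interior_subset hx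
  have h1 := h0 (x ^ 3) (by positivity)
  have h2 : 0 < (2 / (9 * x ^ 3) + x ^ 3) * u (x ^ 3) ^ 2 := by positivity
  linarith

/-- Arbitrarily far points where both densities are small. -/
theorem exists_pohozaevDensity_lt (iu : IntegrableOn (fun r => r * (u r ^ 2 + p r ^ 2)) (Ioi 1))
    (iv : IntegrableOn (fun r => r * (v r ^ 2 + q r ^ 2)) (Ioi 1)) {ε : ℝ} (hε : 0 < ε) (N : ℝ) :
    ∃ x, N ≤ x ∧ 1 ≤ x ∧ |pohozaevDensity x (u (x ^ 3)) (p (x ^ 3))| < ε ∧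
      |pohozaevDensity x (v (x ^ 3)) (q (x ^ 3))| < ε := by
  set η := min 1 (ε / 4) with hη
  have hη0 : 0 < η := by positivity
  have hη1 : η ≤ 1 := min_le_left _ _
  have hηε : 3 * η < ε := by
    have : η ≤ ε / 4 := min_le_right _ _
    linarith
  obtain ⟨r, hr1, hr2⟩ := ((frequently_mul_lt_of_integrableOn (iu.add iv) hη0).and_eventually
    (eventually_ge_atTop (max N 1 ^ 3))).exists
  have hM : 1 ≤ max N 1 := le_max_right _ _
  have hr0 : 0 ≤ r := le_trans (by positivity) hr2
  set x := r ^ (1 / 3 : ℝ) with hx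
  have hx3 : x ^ 3 = r := by
    rw [hx, ← Real.rpow_natCast, ← Real.rpow_mul hr0]
    norm_num
  have hx0 : 0 ≤ x := Real.rpow_nonneg hr0 _
  have hxM : max N 1 ≤ x := by
    rw [← hx3] at hr2
    exact le_of_pow_le_pow_left₀ three_ne_zero hx0 hr2
  have hx1 : 1 ≤ x := hM.trans hxM
  have h6 : x ^ 6 = r * r := by
    rw [← hx3]
    ring
  simp only [Pi.add_apply] at hr1
  refine ⟨x, (le_max_left _ _).trans hxM, hx1, ?_, ?_⟩
  · refine (abs_pohozaevDensity_le hx1 hη1 ?_).trans_lt hηε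
    rw [h6, hx3]
    have h1 : 0 ≤ r * (r * (v r ^ 2 + q r ^ 2)) := by positivity
    nlinarith
  · refine (abs_pohozaevDensity_le hx1 hη1 ?_).trans_lt hηε
    rw [h6, hx3]
    have h1 : 0 ≤ r * (r * (u r ^ 2 + p r ^ 2)) := by positivity
    nlinarith

theorem pohozaevDensity_pos (hu : IsRadialSol u p) (h0 : ∀ r, 0 < r → 0 < u r)
    (iu : IntegrableOn (fun r => r * (u r ^ 2 + p r ^ 2)) (Ioi 1)) {x : ℝ} (hx : 0 < x) :
    0 < pohozaevDensity x (u (x ^ 3)) (p (x ^ 3)) := by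
  have hanti := hu.strictAntiOn_pohozaevDensity h0
  by_contra! hcon
  have h1 := hanti (show x ∈ Ioi 0 from hx) (show x + 1 ∈ Ioi 0 by
    simp only [mem_Ioi]
    linarith) (by linarith)
  simp only at h1
  obtain ⟨y, hy1, hy2, hy3, -⟩ := exists_pohozaevDensity_lt iu iu
    (ε := -pohozaevDensity (x + 1) (u ((x + 1) ^ 3)) (p ((x + 1) ^ 3))) (by linarith) (x + 1)
  have h2 := hanti.antitoneOn (show x + 1 ∈ Ioi 0 by
    simp only [mem_Ioi]
    linarith) (show y ∈ Ioi 0 by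
    simp only [mem_Ioi]
    linarith) hy1
  have h3 := neg_abs_le (pohozaevDensity y (u (y ^ 3)) (p (y ^ 3)))
  linarith

end IsRadialSol

theorem strictAntiOn_Ioc_of_hasDerivAt {f f' : ℝ → ℝ} (hf : ∀ x, 0 < x → HasDerivAt f (f' x) x)
    {b : ℝ} (hn : ∀ x, 0 < x → x < b → f' x < 0) : StrictAntiOn f (Ioc 0 b) := by
  refine strictAntiOn_of_hasDerivWithinAt_neg (convex_Ioc 0 b) (fun x hx =>
    (hf x hx.1).continuousAt.continuousWithinAt) (fun x hx =>
    (hf x (interior_subset hx).1).hasDerivWithinAt) fun x hx => ?_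
  rw [interior_Ioc] at hx
  exact hn x hx.1 hx.2

theorem neg_of_hasDerivAt_neg {f f' : ℝ → ℝ} (hf : ∀ x, 0 < x → HasDerivAt f (f' x) x) {b : ℝ}
    (hb : 0 < b) (hn : ∀ x, 0 < x → x < b → f' x < 0) (h0 : Tendsto f (𝓝[>] 0) (𝓝 0)) :
    f b < 0 := by
  have hanti := strictAntiOn_Ioc_of_hasDerivAt hf hn
  have hb2 : 0 < b / 2 := by positivity
  have h1 : f b < f (b / 2) := hanti ⟨hb2, by linarith⟩ ⟨hb, le_rfl⟩ (by linarith)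
  refine h1.trans_le (ge_of_tendsto h0 ?_)
  filter_upwards [Ioc_mem_nhdsGT hb2] with x hx
  exact hanti.antitoneOn ⟨hx.1, hx.2.trans (by linarith)⟩ ⟨hb2, by linarith⟩ hx.2

theorem tendsto_cube_nhdsGT : Tendsto (fun x : ℝ => x ^ 3) (𝓝[>] 0) (𝓝[>] 0) := by
  refine tendsto_nhdsWithin_iff.mpr ⟨?_, ?_⟩
  · have : Tendsto (fun x : ℝ => x ^ 3) (𝓝 0) (𝓝 (0 ^ 3)) := (continuous_pow 3).tendsto 0
    rw [zero_pow three_ne_zero] at this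
    exact this.mono_left nhdsWithin_le_nhds
  · filter_upwards [self_mem_nhdsWithin] with x hx
    exact mem_Ioi.mpr (pow_pos (mem_Ioi.mp hx) 3)

theorem tendsto_pohozaevDensity_sub {a b : ℝ → ℝ} {l : ℝ} (ha : Tendsto a (𝓝[>] 0) (𝓝 l))
    (hb : Tendsto b (𝓝[>] 0) (𝓝 0)) :
    Tendsto (fun x => pohozaevDensity x (a x) (b x) - a x ^ 2 / (9 * x ^ 2)) (𝓝[>] 0) (𝓝 0) := by
  have hx : Tendsto (fun x : ℝ => x) (𝓝[>] 0) (𝓝 0) := tendsto_id.mono_left nhdsWithin_le_nhds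
  have h := (((((hx.pow 4).mul (hb.pow 2)).div_const 2).add
    (((hx.mul ha).mul hb).div_const 3)).sub (((hx.pow 4).mul (ha.pow 2)).div_const 2)).add
    (((hx.pow 4).mul (ha.pow 4)).div_const 4)
  norm_num at h
  refine h.congr fun x => ?_
  rw [pohozaevDensity]
  ring

namespace IsRadialSol

variable {u p v q : ℝ → ℝ}

/-- Positive decaying solutions cannot be ordered at the origin. -/
theorem not_lt_of_tendsto (hu : IsRadialSol u p) (hv : IsRadialSol v q)
    (u0 : ∀ r, 0 < r → 0 < u r) (v0 : ∀ r, 0 < r → 0 < v r)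
    (iu : IntegrableOn (fun r => r * (u r ^ 2 + p r ^ 2)) (Ioi 1))
    (iv : IntegrableOn (fun r => r * (v r ^ 2 + q r ^ 2)) (Ioi 1)) {l l' : ℝ}
    (lu : Tendsto u (𝓝[>] 0) (𝓝 l)) (lv : Tendsto v (𝓝[>] 0) (𝓝 l')) : ¬l < l' := by
  intro hll
  have hl : 0 < l := hu.pos_of_tendsto u0 lu
  have u0' : ∀ x : ℝ, 0 < x → 0 < u (x ^ 3) := fun x hx => u0 _ (by positivity)
  have v0' : ∀ x : ℝ, 0 < x → 0 < v (x ^ 3) := fun x hx => v0 _ (by positivity)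
  have tu := lu.comp tendsto_cube_nhdsGT
  have tv := lv.comp tendsto_cube_nhdsGT
  have tp := hu.tendsto_deriv.comp tendsto_cube_nhdsGT
  have tq := hv.tendsto_deriv.comp tendsto_cube_nhdsGT
  simp only [Function.comp_def] at tu tv tp tq
  set D : ℝ → ℝ := fun x => x ^ 3 * (q (x ^ 3) * u (x ^ 3) - v (x ^ 3) * p (x ^ 3)) with hD
  set D' : ℝ → ℝ := fun x => 3 * x ^ 5 * (u (x ^ 3) * v (x ^ 3)) *
    (u (x ^ 3) ^ 2 - v (x ^ 3) ^ 2) with hD'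
  set W : ℝ → ℝ := fun x => v (x ^ 3) / u (x ^ 3) with hW
  set W' : ℝ → ℝ := fun x => 3 * D x / (x * u (x ^ 3) ^ 2) with hW'
  set X : ℝ → ℝ := fun x => W x ^ 2 * pohozaevDensity x (u (x ^ 3)) (p (x ^ 3)) -
    pohozaevDensity x (v (x ^ 3)) (q (x ^ 3)) with hX
  set X' : ℝ → ℝ := fun x => 2 * W x * W' x * pohozaevDensity x (u (x ^ 3)) (p (x ^ 3)) with hX'
  have dD : ∀ x, 0 < x → HasDerivAt D (D' x) x := fun x hx => by
    have h1 : HasDerivAt (fun x : ℝ => x ^ 3) (3 * x ^ 2) x := by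
      simpa using hasDerivAt_pow 3 x
    refine (h1.mul (((hv.hasDerivAt_deriv_comp_cube hx).mul (hu.hasDerivAt_comp_cube hx)).sub
      ((hv.hasDerivAt_comp_cube hx).mul (hu.hasDerivAt_deriv_comp_cube hx)))).congr_deriv ?_
    simp only [hD', Pi.mul_apply, Pi.sub_apply]
    have hx' : x ≠ 0 := hx.ne'
    field_simp
    ring
  have dW : ∀ x, 0 < x → HasDerivAt W (W' x) x := fun x hx => by
    have hux := (u0' x hx).ne'
    refine ((hv.hasDerivAt_comp_cube hx).div (hu.hasDerivAt_comp_cube hx) hux).congr_deriv ?_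
    simp only [hW', hD]
    have hx' : x ≠ 0 := hx.ne'
    field_simp
  have dX : ∀ x, 0 < x → HasDerivAt X (X' x) x := fun x hx => by
    have hux := (u0' x hx).ne'
    refine ((((dW x hx).pow 2).mul (hu.hasDerivAt_pohozaevDensity hx)).sub
      (hv.hasDerivAt_pohozaevDensity hx)).congr_deriv ?_
    simp only [hX', Pi.pow_apply]
    have hWu : W x * u (x ^ 3) = v (x ^ 3) := by
      simp only [hW]
      field_simp
    rw [← hWu]
    push_cast
    ring
  have tD : Tendsto D (𝓝[>] 0) (𝓝 0) := by
    have hx := tendsto_cube_nhdsGT.mono_right nhdsWithin_le_nhds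
    have := hx.mul ((tq.mul tu).sub (tv.mul tp))
    simpa using this
  have tX : Tendsto X (𝓝[>] 0) (𝓝 0) := by
    have tW := tv.div tu hl.ne'
    have := ((tW.pow 2).mul (tendsto_pohozaevDensity_sub tu tp)).sub
      (tendsto_pohozaevDensity_sub tv tq)
    rw [mul_zero, sub_zero] at this
    refine this.congr' ?_
    filter_upwards [self_mem_nhdsWithin] with x hx
    have hx : 0 < x := hx
    have hux := (u0' x hx).ne'
    simp only [hX, hW, Pi.div_apply]
    field_simp
    ring
  have hJ : ∀ x, 0 < x → 0 < pohozaevDensity x (u (x ^ 3)) (p (x ^ 3)) := fun x hx =>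
    hu.pohozaevDensity_pos u0 iu hx
  have hW'neg : ∀ x, 0 < x → D x < 0 → W' x < 0 := fun x hx hDx => by
    have := u0' x hx
    exact div_neg_of_neg_of_pos (by linarith) (by positivity)
  have hX'neg : ∀ x, 0 < x → D x < 0 → X' x < 0 := fun x hx hDx => by
    have h1 : 0 < W x := div_pos (v0' x hx) (u0' x hx)
    have h2 := hJ x hx
    have h3 := hW'neg x hx hDx
    have h4 : 2 * W x * W' x < 0 := by nlinarith
    exact mul_neg_of_neg_of_pos h4 h2
  have hDneg : ∀ x, 0 < x → D x < 0 := by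
    by_contra! hcon
    obtain ⟨x1, hx1, hDx1⟩ := hcon
    obtain ⟨δ, hδ, hδlt⟩ : ∃ δ, 0 < δ ∧ ∀ x, 0 < x → x < δ → u (x ^ 3) < v (x ^ 3) := by
      have := tu.eventually_lt tv hll
      obtain ⟨δ, hδ, h⟩ := mem_nhdsGT_iff_exists_Ioo_subset.mp this
      exact ⟨δ, hδ, fun x h1 h2 => h ⟨h1, h2⟩⟩
    have hD'neg : ∀ x, 0 < x → u (x ^ 3) < v (x ^ 3) → D' x < 0 := fun x hx huv => by
      have h1 := u0' x hx
      have h2 := v0' x hx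
      exact mul_neg_of_pos_of_neg (by positivity) (by nlinarith)
    have hDδ : ∀ x, 0 < x → x ≤ δ → D x < 0 := fun x hx hxδ =>
      neg_of_hasDerivAt_neg dD hx (fun y hy hyx => hD'neg y hy (hδlt y hy (hyx.trans_le hxδ))) tD
    have hcD : ContinuousOn D (Icc δ x1) := fun x hx =>
      (dD x (hδ.trans_le hx.1)).continuousAt.continuousWithinAt
    have hcomp : IsCompact (Icc δ x1 ∩ D ⁻¹' Ici 0) :=
      isCompact_Icc.of_isClosed_subset (hcD.preimage_isClosed_of_isClosed isClosed_Icc isClosed_Ici)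
        inter_subset_left
    have hδx1 : δ ≤ x1 := by
      by_contra! h
      exact absurd (hDδ x1 hx1 h.le) (not_lt.mpr hDx1)
    obtain ⟨x0, ⟨hx0, hDx0⟩, hleast⟩ := hcomp.exists_isLeast ⟨x1, ⟨hδx1, le_rfl⟩, hDx1⟩
    have hx0pos : 0 < x0 := hδ.trans_le hx0.1
    have hDlt : ∀ x, 0 < x → x < x0 → D x < 0 := fun x hx hxx0 => by
      rcases le_or_gt x δ with h | h
      · exact hDδ x hx h
      · by_contra! h2
        exact absurd (hleast ⟨⟨h.le, hxx0.le.trans hx0.2⟩, h2⟩) (not_le.mpr hxx0)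
    have hDx0' : D x0 = 0 := by
      refine le_antisymm ?_ hDx0
      have h1 : Tendsto D (𝓝[<] x0) (𝓝 (D x0)) :=
        (dD x0 hx0pos).continuousAt.tendsto.mono_left nhdsWithin_le_nhds
      refine le_of_tendsto h1 ?_
      filter_upwards [Ioo_mem_nhdsLT hx0pos] with x hx
      exact (hDlt x hx.1 hx.2).le
    have hXx0 : X x0 < 0 := neg_of_hasDerivAt_neg dX hx0pos
      (fun x hx hxx0 => hX'neg x hx (hDlt x hx hxx0)) tX
    have hU := u0' x0 hx0pos
    have hWx0 : 1 < W x0 := by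
      have hv1 : v (x0 ^ 3) = W x0 * u (x0 ^ 3) := by
        simp only [hW]
        field_simp
      have hq1 : q (x0 ^ 3) = W x0 * p (x0 ^ 3) := by
        have h1 : q (x0 ^ 3) * u (x0 ^ 3) - v (x0 ^ 3) * p (x0 ^ 3) = 0 := by
          rcases mul_eq_zero.mp hDx0' with h | h
          · exact absurd h (by positivity)
          · exact h
        simp only [hW]
        field_simp
        linarith
      have hW0 : 0 < W x0 := div_pos (v0' x0 hx0pos) hU
      have h2 : X x0 = x0 ^ 4 * u (x0 ^ 3) ^ 4 / 4 * W x0 ^ 2 * (1 - W x0 ^ 2) := by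
        simp only [hX]
        rw [hq1, hv1, pohozaevDensity, pohozaevDensity]
        ring
      by_contra! h3
      have h4 : 0 ≤ 1 - W x0 ^ 2 := by nlinarith
      have h5 : 0 ≤ X x0 := by
        rw [h2]
        positivity
      linarith
    have hanti := strictAntiOn_Ioc_of_hasDerivAt dW (b := x0)
      fun x hx hxx0 => hW'neg x hx (hDlt x hx hxx0)
    have h6 : D x0 < 0 := neg_of_hasDerivAt_neg dD hx0pos (fun x hx hxx0 => hD'neg x hx (by
      have h7 := hWx0.trans (hanti ⟨hx, hxx0.le⟩ ⟨hx0pos, le_rfl⟩ hxx0)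
      simp only [hW] at h7
      rwa [one_lt_div (u0' x hx)] at h7)) tD
    linarith
  have hX1 : X 1 < 0 := neg_of_hasDerivAt_neg dX one_pos
    (fun x hx _ => hX'neg x hx (hDneg x hx)) tX
  obtain ⟨y, -, hy1, -, hy⟩ := exists_pohozaevDensity_lt iu iv (ε := -X 1) (by linarith) 1
  have hy0 : 0 < y := by linarith
  have hanti := (strictAntiOn_Ioc_of_hasDerivAt dX (b := y)
    fun x hx _ => hX'neg x hx (hDneg x hx)).antitoneOn
  have h1 : X y ≤ X 1 := hanti ⟨one_pos, hy1⟩ ⟨hy0, le_rfl⟩ hy1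
  have h2 : -pohozaevDensity y (v (y ^ 3)) (q (y ^ 3)) ≤ X y := by
    simp only [hX]
    have := hJ y hy0
    nlinarith [mul_nonneg (sq_nonneg (W y)) this.le]
  have h3 := le_abs_self (pohozaevDensity y (v (y ^ 3)) (q (y ^ 3)))
  linarith

/-- Uniqueness of positive decaying solutions. -/
theorem eq_of_pos (hu : IsRadialSol u p) (hv : IsRadialSol v q)
    (u0 : ∀ r, 0 < r → 0 < u r) (v0 : ∀ r, 0 < r → 0 < v r)
    (iu : IntegrableOn (fun r => r * (u r ^ 2 + p r ^ 2)) (Ioi 1))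
    (iv : IntegrableOn (fun r => r * (v r ^ 2 + q r ^ 2)) (Ioi 1)) {r : ℝ} (hr : 0 < r) :
    u r = v r := by
  obtain ⟨l, hl⟩ := hu.exists_tendsto
  obtain ⟨l', hl'⟩ := hv.exists_tendsto
  have h1 := hu.not_lt_of_tendsto hv u0 v0 iu iv hl hl'
  have h2 := hv.not_lt_of_tendsto hu v0 u0 iv iu hl' hl
  obtain rfl : l = l' := le_antisymm (not_lt.mp h2) (not_lt.mp h1)
  exact hu.eq_of_tendsto hv hl hl' hr

/-- Square integrability of the derivative. -/
theorem integrableOn_deriv_sq (hu : IsRadialSol u p)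
    (i4 : IntegrableOn (fun r => r * u r ^ 4) (Ioi 0)) :
    IntegrableOn (fun r => r * (u r ^ 2 + p r ^ 2)) (Ioi 1) := by
  have hsub : ∀ R, 1 ≤ R → Icc 1 R ⊆ Ioi (0 : ℝ) := fun R _ x hx => one_pos.trans_le hx.1
  have hsub1 : Ioi (1 : ℝ) ⊆ Ioi 0 := Ioi_subset_Ioi zero_le_one
  have i2 := hu.integrableOn_sq
  have hcp : ContinuousOn (fun r => r * p r ^ 2) (Ioi 0) :=
    continuousOn_id.mul (hu.continuousOn_deriv.pow 2)
  have hip : ∀ R, 1 ≤ R → IntervalIntegrable (fun r => r * p r ^ 2) volume 1 R := fun R hR => by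
    refine (hcp.mono ?_).intervalIntegrable
    rw [uIcc_of_le hR]
    exact hsub R hR
  set P : ℝ → ℝ := fun r => r * (u r * p r) with hP
  have dP : ∀ r, 0 < r → HasDerivAt P (r * p r ^ 2 + r * u r ^ 2 - r * u r ^ 4) r := fun r hr => by
    refine ((hasDerivAt_id' r).mul ((hu.hasDerivAt r hr).mul
      (hu.hasDerivAt_deriv r hr))).congr_deriv ?_
    simp only [Pi.mul_apply]
    have := hr.ne'
    field_simp
    ring
  set K := |P 1| + ∫ r in Ioi 0, r * u r ^ 4 with hK
  have hPR : ∀ R, 1 ≤ R → ∫ r in (1 : ℝ)..R, r * p r ^ 2 ≤ P R + K := fun R hR => by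
    have j2 : IntervalIntegrable (fun r => r * u r ^ 2) volume 1 R := by
      rw [intervalIntegrable_iff_integrableOn_Ioc_of_le hR]
      exact i2.mono_set fun x hx => one_pos.trans hx.1
    have j4 : IntervalIntegrable (fun r => r * u r ^ 4) volume 1 R := by
      rw [intervalIntegrable_iff_integrableOn_Ioc_of_le hR]
      exact i4.mono_set fun x hx => one_pos.trans hx.1
    have h1 := intervalIntegral.integral_eq_sub_of_hasDerivAt (a := 1) (b := R) (f := P)
      (fun r hr => by
        rw [uIcc_of_le hR] at hr
        exact dP r (hsub R hR hr)) (((hip R hR).add j2).sub j4)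
    rw [intervalIntegral.integral_sub ((hip R hR).add j2) j4,
      intervalIntegral.integral_add (hip R hR) j2] at h1
    have h2 : 0 ≤ ∫ r in (1 : ℝ)..R, r * u r ^ 2 :=
      intervalIntegral.integral_nonneg hR fun r hr =>
        mul_nonneg (le_of_lt (hsub R hR hr)) (sq_nonneg _)
    have h3 : ∫ r in (1 : ℝ)..R, r * u r ^ 4 ≤ ∫ r in Ioi 0, r * u r ^ 4 := by
      rw [intervalIntegral.integral_of_le hR]
      refine setIntegral_mono_set i4 ?_
        (show Ioc 1 R ⊆ Ioi 0 from fun x hx => one_pos.trans hx.1).eventuallyLE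
      filter_upwards [ae_restrict_mem measurableSet_Ioi] with r hr
      have : 0 < r := hr
      positivity
    linarith [neg_abs_le (P 1)]
  have hfreq : ∃ᶠ R in atTop, P R < 1 := by
    intro hcon
    obtain ⟨N, hN⟩ := eventually_atTop.mp hcon
    set M := max N 1
    have hM1 : 1 ≤ M := le_max_right _ _
    have hP1 : ∀ r, M ≤ r → 1 ≤ P r := fun r hr => not_lt.mp (hN r ((le_max_left _ _).trans hr))
    have hmono : MonotoneOn (fun r => u r ^ 2) (Ici M) := by
      refine monotoneOn_of_hasDerivWithinAt_nonneg (convex_Ici M) (fun x hx =>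
        ((hu.hasDerivAt x
          (by linarith [show M ≤ x from hx])).pow 2).continuousAt.continuousWithinAt)
        (fun x hx => ((hu.hasDerivAt x (by
          linarith [show M ≤ x from interior_subset hx])).pow 2).hasDerivWithinAt) fun x hx => ?_
      have hx : M ≤ x := interior_subset hx
      have h1 : 1 ≤ x * (u x * p x) := hP1 x hx
      have h2 : 0 ≤ u x * p x := by
        by_contra! h3
        nlinarith
      push_cast
      linarith
    have hM0 : 0 < u M ^ 2 := by
      refine pow_pos ?_ 2 |>.trans_le (le_of_eq (sq_abs _))
      rw [abs_pos]
      intro h0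
      have := hP1 M le_rfl
      simp only [hP, h0] at this
      norm_num at this
    have hcst : IntegrableOn (fun _ : ℝ => u M ^ 2) (Ioi M) := by
      refine (i2.mono_set (Ioi_subset_Ioi (by linarith))).mono' (by fun_prop) ?_
      filter_upwards [ae_restrict_mem measurableSet_Ioi] with r hr
      have hr : M < r := hr
      have h1 : u M ^ 2 ≤ u r ^ 2 := hmono (mem_Ici.mpr le_rfl) (mem_Ici.mpr hr.le) hr.le
      rw [Real.norm_eq_abs, abs_of_pos hM0]
      nlinarith [sq_nonneg (u r)]
    rw [integrableOn_const_iff, enorm_eq_zero, Real.volume_Ioi] at hcst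
    exact hcst.elim hM0.ne' (lt_irrefl _)
  have hbound : ∀ R, 1 ≤ R → ∫ r in (1 : ℝ)..R, r * p r ^ 2 ≤ 1 + K := fun R hR => by
    obtain ⟨S, hS1, hS2⟩ := (hfreq.and_eventually (eventually_ge_atTop R)).exists
    have h1 := hPR S (hR.trans hS2)
    have h2 : ∫ r in (1 : ℝ)..R, r * p r ^ 2 ≤ ∫ r in (1 : ℝ)..S, r * p r ^ 2 := by
      refine intervalIntegral.integral_mono_interval le_rfl hR hS2 ?_ (hip S (hR.trans hS2))
      filter_upwards [ae_restrict_mem measurableSet_Ioc] with r hr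
      exact mul_nonneg (one_pos.trans hr.1).le (sq_nonneg _)
    linarith
  have hfin : IntegrableOn (fun r => r * p r ^ 2) (Ioi 1) := by
    refine integrableOn_Ioi_of_intervalIntegral_norm_bounded (1 + K) 1 (fun R => ?_)
      tendsto_id ?_
    · rcases le_total 1 R with hR | hR
      · exact (intervalIntegrable_iff_integrableOn_Ioc_of_le hR).mp (hip R hR)
      · simp [Ioc_eq_empty (not_lt.mpr hR)]
    · filter_upwards [eventually_ge_atTop 1] with R hR
      refine le_trans (le_of_eq ?_) (hbound R hR)
      refine intervalIntegral.integral_congr fun r hr => ?_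
      rw [id, uIcc_of_le hR] at hr
      have := hsub R hR hr
      exact Real.norm_of_nonneg (mul_nonneg (le_of_lt this) (sq_nonneg _))
  refine ((i2.mono_set hsub1).add hfin).congr_fun (fun r _ => ?_) measurableSet_Ioi
  simp only [Pi.add_apply]
  ring

end IsRadialSol

namespace IsRadialSol

/-- Half of the Pohozaev identity. -/
theorem two_mul_integral_sq_le {u p : ℝ → ℝ} (hu : IsRadialSol u p) (cu : Continuous u)
    (cp : Continuous p) (iu : IntegrableOn (fun r => r * (u r ^ 2 + p r ^ 2)) (Ioi 1))
    (i4 : IntegrableOn (fun r => r * u r ^ 4) (Ioi 0)) :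
    2 * ∫ r in Ioi 0, r * u r ^ 2 ≤ ∫ r in Ioi 0, r * u r ^ 4 := by
  set F : ℝ → ℝ := fun r => r ^ 2 * p r ^ 2 / 2 - r ^ 2 * u r ^ 2 / 2 + r ^ 2 * u r ^ 4 / 4 with hF
  have hFc : Continuous F := by fun_prop
  have dF : ∀ r, 0 < r → HasDerivAt F (r * u r ^ 4 / 2 - r * u r ^ 2) r := fun r hr => by
    have h2 : HasDerivAt (fun r : ℝ => r ^ 2) (2 * r) r := by simpa using hasDerivAt_pow 2 r
    have hU := hu.hasDerivAt r hr
    have := (((h2.mul ((hu.hasDerivAt_deriv r hr).pow 2)).div_const 2).sub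
      ((h2.mul (hU.pow 2)).div_const 2)).add ((h2.mul (hU.pow 4)).div_const 4)
    refine this.congr_deriv ?_
    simp only [Pi.pow_apply]
    push_cast
    have := hr.ne'
    field_simp
    ring
  have h0 : ∀ R, 0 < R → (∫ r in (0 : ℝ)..R, r * u r ^ 4) / 2 - ∫ r in (0 : ℝ)..R, r * u r ^ 2
      = F R := fun R hR => by
    have := intervalIntegral.integral_eq_sub_of_hasDerivAt_of_le hR.le hFc.continuousOn
      (fun r hr => dF r hr.1) (Continuous.intervalIntegrable (by fun_prop) _ _)
    rw [intervalIntegral.integral_sub (Continuous.intervalIntegrable (by fun_prop) _ _)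
      (Continuous.intervalIntegrable (by fun_prop) _ _), intervalIntegral.integral_div] at this
    rw [this]
    simp [hF]
  by_contra! hcon
  set ε := 2 * (∫ r in Ioi 0, r * u r ^ 2) - ∫ r in Ioi 0, r * u r ^ 4 with hε
  have hε0 : 0 < ε := by linarith
  have ht := (intervalIntegral_tendsto_integral_Ioi 0 hu.integrableOn_sq tendsto_id)
  have hev : ∀ᶠ R in atTop,
      (∫ r in Ioi 0, r * u r ^ 2) - ε / 4 < ∫ r in (0 : ℝ)..id R, r * u r ^ 2 :=
    ht.eventually (lt_mem_nhds (by linarith))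
  obtain ⟨R, hR1, hR2, hR3⟩ := ((frequently_mul_lt_of_integrableOn iu
    (show 0 < ε / 4 by positivity)).and_eventually (hev.and (eventually_gt_atTop 0))).exists
  have h4 : ∫ r in (0 : ℝ)..R, r * u r ^ 4 ≤ ∫ r in Ioi 0, r * u r ^ 4 := by
    rw [intervalIntegral.integral_of_le hR3.le]
    refine setIntegral_mono_set i4 ?_ Ioc_subset_Ioi_self.eventuallyLE
    filter_upwards [ae_restrict_mem measurableSet_Ioi] with r hr
    exact mul_nonneg (le_of_lt hr) (by positivity)
  have h5 := h0 R hR3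
  have h6 : -(R * (R * (u R ^ 2 + p R ^ 2))) ≤ F R := by
    simp only [hF]
    nlinarith [sq_nonneg (R * u R), sq_nonneg (R * p R), sq_nonneg (R * u R ^ 2)]
  simp only [id] at hR2
  linarith

end IsRadialSol

theorem plane_eq_smul_add_smul (x : Plane) : x = x 0 • e0 + x 1 • e1 := by
  ext i
  fin_cases i <;> simp [e0, e1]

theorem norm_sq_plane (x : Plane) : ‖x‖ ^ 2 = x 0 ^ 2 + x 1 ^ 2 := by
  rw [EuclideanSpace.norm_sq_eq, Fin.sum_univ_two]
  simp

theorem norm_e0 : ‖e0‖ = 1 := by simp [e0]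

theorem norm_smul_e0 (x : Plane) : ‖(‖x‖ • e0)‖ = ‖x‖ := by
  rw [norm_smul, norm_e0, norm_norm, mul_one]

section Radial

variable {Q : Plane → ℝ}

theorem mul_d1R_eq_mul_d0R (hd : Differentiable ℝ Q) (hr : ∀ x y : Plane, ‖x‖ = ‖y‖ → Q x = Q y)
    (x : Plane) : x 0 * d1R Q x = x 1 * d0R Q x := by
  set J : Plane := (-x 1) • e0 + x 0 • e1 with hJ
  have hc : HasDerivAt (fun t : ℝ => Real.cos t • x + Real.sin t • J) J 0 := by
    have := ((Real.hasDerivAt_cos 0).smul_const x).add ((Real.hasDerivAt_sin 0).smul_const J)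
    exact this.congr_deriv (by simp)
  have hQ : HasFDerivAt Q (fderiv ℝ Q x) (Real.cos 0 • x + Real.sin 0 • J) := by
    simpa using (hd x).hasFDerivAt
  have h1 := hQ.comp_hasDerivAt (0 : ℝ) hc
  have h2 : Q ∘ (fun t : ℝ => Real.cos t • x + Real.sin t • J) = fun _ => Q x := by
    funext t
    refine hr _ _ ((sq_eq_sq₀ (norm_nonneg _) (norm_nonneg _)).mp ?_)
    rw [norm_sq_plane, norm_sq_plane x]
    simp [hJ, e0, e1]
    linear_combination (x 0 ^ 2 + x 1 ^ 2) * Real.sin_sq_add_cos_sq t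
  rw [h2] at h1
  have h3 := h1.unique (hasDerivAt_const (0 : ℝ) (Q x))
  rw [hJ, map_add, map_smul, map_smul] at h3
  simp only [smul_eq_mul] at h3
  rw [d0R, d1R]
  linarith

theorem hasDerivAt_line {f : Plane → ℝ} (hd : Differentiable ℝ f) (r : ℝ) :
    HasDerivAt (fun r : ℝ => f (r • e0)) (fderiv ℝ f (r • e0) e0) r := by
  have := (hd (r • e0)).hasFDerivAt.comp_hasDerivAt r ((hasDerivAt_id' r).smul_const e0)
  exact this.congr_deriv (by rw [one_smul])

theorem contDiff_d0R (hd : ContDiff ℝ 2 Q) : ContDiff ℝ 1 (d0R Q) :=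
  (hd.fderiv_right (m := 1) (by norm_num)).clm_apply contDiff_const

theorem contDiff_d1R (hd : ContDiff ℝ 2 Q) : ContDiff ℝ 1 (d1R Q) :=
  (hd.fderiv_right (m := 1) (by norm_num)).clm_apply contDiff_const

theorem mul_fderiv_d1R (hd : ContDiff ℝ 2 Q) (hr : ∀ x y : Plane, ‖x‖ = ‖y‖ → Q x = Q y)
    (r : ℝ) : r * fderiv ℝ (d1R Q) (r • e0) e1 = d0R Q (r • e0) := by
  have hl : HasDerivAt (fun t : ℝ => r • e0 + t • e1) e1 0 := by
    simpa using ((hasDerivAt_id' (0 : ℝ)).smul_const e1).const_add (r • e0)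
  have key : ∀ g : Plane → ℝ, ContDiff ℝ 1 g →
      HasDerivAt (fun t : ℝ => g (r • e0 + t • e1)) (fderiv ℝ g (r • e0) e1) 0 := fun g hg => by
    have h : HasFDerivAt g (fderiv ℝ g (r • e0)) (r • e0 + (0 : ℝ) • e1) := by
      simpa using (hg.differentiable one_ne_zero (r • e0)).hasFDerivAt
    exact h.comp_hasDerivAt (0 : ℝ) hl
  have h1 := (key _ (contDiff_d1R hd)).const_mul r
  have h2 := (hasDerivAt_id' (0 : ℝ)).mul (key _ (contDiff_d0R hd))
  have h3 : (fun t : ℝ => r * d1R Q (r • e0 + t • e1)) =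
      (fun t : ℝ => t) * fun t : ℝ => d0R Q (r • e0 + t • e1) := by
    funext t
    simpa [e0, e1] using mul_d1R_eq_mul_d0R (hd.differentiable two_ne_zero) hr (r • e0 + t • e1)
  rw [h3] at h1
  simpa using h1.unique h2

theorem abs_d0R_le (hd : Differentiable ℝ Q) (hr : ∀ x y : Plane, ‖x‖ = ‖y‖ → Q x = Q y)
    (x : Plane) : |d0R Q (‖x‖ • e0)| ≤ ‖fderiv ℝ Q x‖ := by
  rcases eq_or_ne x 0 with rfl | hx
  · rw [norm_zero, zero_smul, d0R]
    simpa [norm_e0] using (fderiv ℝ Q 0).le_opNorm e0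
  · have hx0 : ‖x‖ ≠ 0 := norm_ne_zero_iff.mpr hx
    have h1 : HasDerivAt (fun r : ℝ => Q (r • (‖x‖⁻¹ • x))) (fderiv ℝ Q x (‖x‖⁻¹ • x)) ‖x‖ := by
      have h : HasFDerivAt Q (fderiv ℝ Q x) (‖x‖ • (‖x‖⁻¹ • x)) := by
        rw [smul_inv_smul₀ hx0]
        exact (hd x).hasFDerivAt
      have := h.comp_hasDerivAt ‖x‖ ((hasDerivAt_id' ‖x‖).smul_const (‖x‖⁻¹ • x))
      exact this.congr_deriv (by rw [one_smul])
    have h2 : (fun r : ℝ => Q (r • (‖x‖⁻¹ • x))) = fun r => Q (r • e0) := by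
      funext r
      refine hr _ _ ?_
      rw [norm_smul, norm_smul, norm_smul, norm_inv, norm_norm, inv_mul_cancel₀ hx0, norm_e0]
    rw [h2] at h1
    rw [d0R, (hasDerivAt_line hd ‖x‖).unique h1, ← Real.norm_eq_abs]
    refine ((fderiv ℝ Q x).le_opNorm _).trans_eq ?_
    rw [norm_smul, norm_inv, norm_norm, inv_mul_cancel₀ hx0, mul_one]

end Radial

theorem integrable_fun_norm_plane {f : ℝ → ℝ} :
    Integrable (fun x : Plane => f ‖x‖) ↔ IntegrableOn (fun r => r * f r) (Ioi 0) := by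
  have := integrable_fun_norm_addHaar (volume : Measure Plane) (f := f)
  simpa using this

theorem integral_fun_norm_plane (f : ℝ → ℝ) :
    ∫ x : Plane, f ‖x‖ = 2 * Real.pi * ∫ r in Ioi 0, r * f r := by
  have := integral_fun_norm_addHaar (volume : Measure Plane) f
  simp only [finrank_euclideanSpace, Fintype.card_fin, Nat.add_one_sub_one, pow_one,
    smul_eq_mul, nsmul_eq_mul, Nat.cast_ofNat] at this
  rw [this, measureReal_def, EuclideanSpace.volume_ball_fin_two]
  simp [mul_assoc, Real.pi_pos.le]

namespace IsGroundState

variable {Q : Plane → ℝ}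

theorem isRadialSol (hQ : IsGroundState Q) :
    IsRadialSol (fun r => Q (r • e0)) (fun r => d0R Q (r • e0)) := by
  obtain ⟨hd, -, hr, hi, -, heq⟩ := hQ
  have hd1 := hd.differentiable two_ne_zero
  have hp1 := contDiff_d0R hd
  refine ⟨fun r _ => hasDerivAt_line hd1 r, fun r h0 => ?_, ?_, ?_⟩
  · refine (hasDerivAt_line (hp1.differentiable one_ne_zero) r).congr_deriv ?_
    have h1 := heq (r • e0)
    have h2 := mul_fderiv_d1R hd hr r
    rw [lapR] at h1
    have h3 : fderiv ℝ (d1R Q) (r • e0) e1 = d0R Q (r • e0) / r := by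
      rw [eq_div_iff h0.ne', mul_comm, h2]
    rw [h3] at h1
    rw [neg_div]
    linarith
  · have hq : Continuous fun r : ℝ => Q (r • e0) := by
      have := hd.continuous
      fun_prop
    have hp' : Continuous fun r : ℝ => fderiv ℝ (d0R Q) (r • e0) e0 := by
      have := hp1.continuous_fderiv one_ne_zero
      fun_prop
    obtain ⟨K1, hK1⟩ := isCompact_Icc.exists_bound_of_continuousOn (s := Icc 0 1) hq.continuousOn
    obtain ⟨K2, hK2⟩ := isCompact_Icc.exists_bound_of_continuousOn (s := Icc 0 1) hp'.continuousOn
    refine ⟨max K1 K2, fun r h0 h1 => ⟨(hK1 r ⟨h0.le, h1⟩).trans (le_max_left _ _), ?_⟩⟩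
    have h2 := (convex_Icc (0 : ℝ) 1).norm_image_sub_le_of_norm_hasDerivWithin_le
      (fun s _ => (hasDerivAt_line (hp1.differentiable one_ne_zero) s).hasDerivWithinAt) hK2
      (left_mem_Icc.mpr zero_le_one) (show r ∈ Icc (0 : ℝ) 1 from ⟨h0.le, h1⟩)
    have h3 : d0R Q ((0 : ℝ) • e0) = 0 := by
      have := mul_fderiv_d1R hd hr 0
      rw [zero_mul] at this
      exact this.symm
    rw [h3, sub_zero, sub_zero, Real.norm_eq_abs, Real.norm_eq_abs, abs_of_pos h0] at h2
    exact h2.trans (mul_le_mul_of_nonneg_right (le_max_right _ _) h0.le)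
  · refine integrable_fun_norm_plane (f := fun r => Q (r • e0) ^ 2) |>.mp ?_
    refine hi.congr (ae_of_all _ fun x => ?_)
    simp only
    rw [hr _ _ (norm_smul_e0 x)]

theorem integrableOn_deriv_sq (hQ : IsGroundState Q) :
    IntegrableOn (fun r => r * (Q (r • e0) ^ 2 + d0R Q (r • e0) ^ 2)) (Ioi 1) := by
  have h2 := hQ.isRadialSol.integrableOn_sq
  obtain ⟨hd, -, hr, -, hi, -⟩ := hQ
  have hc := (contDiff_d0R hd).continuous
  have h3 : IntegrableOn (fun r : ℝ => r * d0R Q (r • e0) ^ 2) (Ioi 0) := by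
    refine integrable_fun_norm_plane.mp (hi.mono' (by fun_prop) (ae_of_all _ fun x => ?_))
    rw [Real.norm_of_nonneg (sq_nonneg _), ← sq_abs]
    exact pow_le_pow_left₀ (abs_nonneg _) (abs_d0R_le (hd.differentiable two_ne_zero) hr x) 2
  refine ((h2.add h3).mono_set (Ioi_subset_Ioi zero_le_one)).congr_fun (fun r _ => ?_)
    measurableSet_Ioi
  simp only [Pi.add_apply]
  ring

/-- The mass of the ground state is bounded by the radial quartic constant. -/
theorem integral_sq_le (hQ : IsGroundState Q) :
    (∫ x, Q x ^ 2) ≤ Real.pi * quarticConst := by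
  have hq := hQ.isRadialSol
  obtain ⟨h, p, hh, h0, ⟨s, hs, hs0⟩, h4, hle⟩ := exists_radialSol
  have heq : ∀ r, 0 < r → h r = Q (r • e0) := fun r hr =>
    hh.eq_of_pos hq (fun r hr => hh.pos_of_nonneg h0 ⟨s, hs, hs0⟩ hr) (fun r _ => hQ.2.1 _)
      (hh.integrableOn_deriv_sq h4) hQ.integrableOn_deriv_sq hr
  have hq4 : IntegrableOn (fun r : ℝ => r * Q (r • e0) ^ 4) (Ioi 0) :=
    h4.congr_fun (fun r hr => by simp only [heq r hr]) measurableSet_Ioi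
  have h4eq : ∫ r in Ioi 0, r * h r ^ 4 = ∫ r in Ioi (0 : ℝ), r * Q (r • e0) ^ 4 :=
    setIntegral_congr_fun measurableSet_Ioi fun r hr => by simp only [heq r hr]
  have hc := hQ.1.continuous
  have hc' := (contDiff_d0R hQ.1).continuous
  have h1 := hq.two_mul_integral_sq_le (by fun_prop) (by fun_prop) hQ.integrableOn_deriv_sq hq4
  have h2 : ∫ x, Q x ^ 2 = 2 * Real.pi * ∫ r in Ioi (0 : ℝ), r * Q (r • e0) ^ 2 := by
    rw [← integral_fun_norm_plane fun r => Q (r • e0) ^ 2]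
    refine integral_congr_ae (ae_of_all _ fun x => ?_)
    dsimp only
    rw [hQ.2.2.1 _ _ (norm_smul_e0 x)]
  rw [h2]
  nlinarith [Real.pi_pos]

end IsGroundState

theorem radialMoment_comp_mul (h : ℝ → ℝ) (n : ℕ) {t : ℝ} (ht : 0 < t) :
    t ^ 2 * radialMoment n (fun r => h (t * r)) = radialMoment n h := by
  have := integral_comp_mul_left_Ioi (fun r => r * h r ^ n) 0 ht
  rw [mul_zero, smul_eq_mul] at this
  have h1 : t * ∫ r in Ioi 0, t * r * h (t * r) ^ n = radialMoment n h := by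
    rw [this, mul_inv_cancel_left₀ ht.ne', radialMoment]
  rw [← h1, radialMoment, ← integral_const_mul, ← integral_const_mul]
  congr 1
  ext r
  ring

theorem radialDirichlet_comp_mul (h : ℝ → ℝ) {t : ℝ} (ht : 0 < t) :
    radialDirichlet (fun r => h (t * r)) = radialDirichlet h := by
  have := integral_comp_mul_left_Ioi (fun r => r * deriv h r ^ 2) 0 ht
  rw [mul_zero, smul_eq_mul] at this
  have h1 : t * ∫ r in Ioi 0, t * r * deriv h (t * r) ^ 2 = radialDirichlet h := by
    rw [this, mul_inv_cancel_left₀ ht.ne', radialDirichlet]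
  rw [← h1, radialDirichlet, ← integral_const_mul]
  congr 1
  ext r
  rw [deriv_comp_mul_left, smul_eq_mul]
  ring

namespace IsProfile

theorem comp_mul {h : ℝ → ℝ} (hh : IsProfile h) {t : ℝ} (ht : 0 < t) :
    IsProfile fun r => h (t * r) := by
  obtain ⟨⟨K, hK⟩, R, hR, h0⟩ := hh
  refine ⟨⟨K * ‖t‖₊, hK.comp (lipschitzWith_smul t)⟩, R / t, by positivity, fun r hr => h0 _ ?_⟩
  rwa [div_le_iff₀' ht] at hr

/-- The radial Gagliardo–Nirenberg inequality. -/
theorem quarticConst_mul_radialMoment_le {h : ℝ → ℝ} (hh : IsProfile h) :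
    quarticConst * radialMoment 4 h ≤ 4 * radialDirichlet h * radialMoment 2 h := by
  have hA := IsProfile.radialDirichlet_nonneg h
  have hB : 0 ≤ radialMoment 2 h := IsProfile.radialMoment_nonneg (by decide) h
  have key : ∀ t, 0 < t → t ^ 2 * (quarticConst * radialMoment 4 h) ≤
      (t ^ 2 * radialDirichlet h + radialMoment 2 h) ^ 2 := fun t ht => by
    have h1 := quarticConst_mul_le (hh.comp_mul ht)
    rw [radialEnergy, radialDirichlet_comp_mul h ht] at h1
    rw [← radialMoment_comp_mul h 4 ht, ← radialMoment_comp_mul h 2 ht]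
    have h2 := mul_le_mul_of_nonneg_left h1 (by positivity : 0 ≤ t ^ 4)
    linarith
  have key' : ∀ s, 0 < s → s * (quarticConst * radialMoment 4 h) ≤
      (s * radialDirichlet h + radialMoment 2 h) ^ 2 := fun s hs => by
    simpa [Real.sq_sqrt hs.le] using key _ (Real.sqrt_pos.mpr hs)
  generalize quarticConst * radialMoment 4 h = C at *
  generalize radialDirichlet h = A at *
  generalize radialMoment 2 h = B at *
  rcases hA.eq_or_lt with rfl | hA
  · by_contra! hC
    have hC : 0 < C := by linarith
    have h1 := key' ((B ^ 2 + 1) / C) (by positivity)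
    rw [div_mul_cancel₀ _ hC.ne'] at h1
    nlinarith
  rcases hB.eq_or_lt with rfl | hB
  · by_contra! hC
    have hC : 0 < C := by linarith
    have h1 := key' (C / (2 * A ^ 2)) (by positivity)
    have h2 : (C / (2 * A ^ 2) * A + 0) ^ 2 = C / (2 * A ^ 2) * C / 2 := by
      field_simp
      ring
    have h3 : 0 < C / (2 * A ^ 2) * C := by positivity
    linarith
  · have h1 := key' (B / A) (by positivity)
    rw [div_mul_cancel₀ _ hA.ne', div_mul_eq_mul_div, div_le_iff₀ hA] at h1
    nlinarith

end IsProfile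

theorem isProfile_radialRearrangement {f : Plane → ℝ} (hf : ContDiff ℝ 1 f)
    (hs : HasCompactSupport f) : IsProfile (radialRearrangement f) := by
  obtain ⟨L, hL⟩ := hf.lipschitzWith_of_hasCompactSupport hs one_ne_zero
  exact ⟨⟨L, lipschitzWith_radialRearrangement hf.continuous hs hL⟩,
    radialRearrangement_eq_zero hf.continuous hs⟩

theorem integral_radialRearrangement_pow {f : Plane → ℝ} (hf : ContDiff ℝ 1 f)
    (hs : HasCompactSupport f) (h0 : ∀ x, 0 ≤ f x) {n : ℕ} (hn : n ≠ 0) :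
    ∫ x, f x ^ n = 2 * Real.pi * radialMoment n (radialRearrangement f) := by
  rw [radialMoment, ← integral_fun_norm_plane fun r => radialRearrangement f r ^ n,
    integral_eq_lintegral_of_nonneg_ae (ae_of_all _ fun x => pow_nonneg (h0 x) n)
      (hf.continuous.pow n).aestronglyMeasurable,
    integral_eq_lintegral_of_nonneg_ae
      (ae_of_all _ fun x => pow_nonneg (radialRearrangement_nonneg _) n)
      (((isProfile_radialRearrangement hf hs).continuous.comp continuous_norm).pow
        n).aestronglyMeasurable, lintegral_radialRearrangement_pow hf.continuous hs h0 hn]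

theorem two_pi_mul_radialDirichlet_le {f : Plane → ℝ} (hf : ContDiff ℝ 1 f)
    (hs : HasCompactSupport f) (h0 : ∀ x, 0 ≤ f x) :
    2 * Real.pi * radialDirichlet (radialRearrangement f) ≤ ∫ x, ‖fderiv ℝ f x‖ ^ 2 := by
  have hc : Continuous fun x => ‖fderiv ℝ f x‖ ^ 2 := (hf.continuous_fderiv one_ne_zero).norm.pow 2
  have hi : Integrable fun x => ‖fderiv ℝ f x‖ ^ 2 :=
    hc.integrable_of_hasCompactSupport
      ((hs.fderiv ℝ).comp_left (g := fun y => ‖y‖ ^ 2) (by simp))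
  have h1 := lintegral_deriv_radialRearrangement_sq_le hf hs h0
  simp only [← ENNReal.ofReal_pow (norm_nonneg (fderiv ℝ f _))] at h1
  rw [← ofReal_integral_eq_lintegral_ofReal hi (ae_of_all _ fun x => sq_nonneg _)] at h1
  have h2 : ∀ r ∈ Ioi (0 : ℝ), ENNReal.ofReal r *
      ENNReal.ofReal (-deriv (radialRearrangement f) r) ^ 2 =
      ENNReal.ofReal (r * deriv (radialRearrangement f) r ^ 2) := fun r hr => by
    have h3 : deriv (radialRearrangement f) r ≤ 0 := by
      rw [← derivWithin_of_isOpen isOpen_Ioi hr]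
      exact AntitoneOn.derivWithin_nonpos fun s hs' t _ hst =>
        radialRearrangement_anti hf.continuous hs (le_of_lt hs') hst
    rw [ENNReal.ofReal_mul (le_of_lt hr), ← ENNReal.ofReal_pow (by linarith), neg_sq]
  rw [setLIntegral_congr_fun measurableSet_Ioi h2, ← ofReal_integral_eq_lintegral_ofReal
    (isProfile_radialRearrangement hf hs).integrableOn_dirichlet_sq
    ((ae_restrict_mem measurableSet_Ioi).mono fun r hr => mul_nonneg (le_of_lt hr) (sq_nonneg _)),
    ← ENNReal.ofReal_mul (by positivity)] at h1
  exact (ENNReal.ofReal_le_ofReal_iff (integral_nonneg fun x => sq_nonneg _)).mp h1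

/-- The Gagliardo–Nirenberg inequality for nonnegative test functions. -/
theorem gagliardoNirenberg_of_contDiff {f : Plane → ℝ} (hf : ContDiff ℝ 1 f)
    (hs : HasCompactSupport f) (h0 : ∀ x, 0 ≤ f x) :
    Real.pi * quarticConst * ∫ x, f x ^ 4 ≤ 2 * (∫ x, ‖fderiv ℝ f x‖ ^ 2) * ∫ x, f x ^ 2 := by
  have h1 := (isProfile_radialRearrangement hf hs).quarticConst_mul_radialMoment_le
  have h2 := two_pi_mul_radialDirichlet_le hf hs h0
  have hB : 0 ≤ radialMoment 2 (radialRearrangement f) :=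
    IsProfile.radialMoment_nonneg (by decide) _
  rw [integral_radialRearrangement_pow hf hs h0 four_ne_zero,
    integral_radialRearrangement_pow hf hs h0 two_ne_zero]
  have h3 := mul_le_mul_of_nonneg_left h1 (by positivity : 0 ≤ 2 * Real.pi ^ 2)
  have h4 := mul_le_mul_of_nonneg_right h2 (by positivity :
    0 ≤ 4 * Real.pi * radialMoment 2 (radialRearrangement f))
  linarith

section Mollify

variable {ρ X : Plane → ℝ}

theorem integrable_mul_comp_sub (cρ : Continuous ρ) (sρ : HasCompactSupport ρ)
    (hX : Integrable X) (x : Plane) : Integrable fun t => X t * ρ (x - t) := by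
  obtain ⟨K, hK⟩ := sρ.exists_bound_of_continuous cρ
  exact hX.mul_bdd (c := K) (by fun_prop) (ae_of_all _ fun t => hK (x - t))

theorem integral_comp_sub_eq_one (h1 : ∫ t, ρ t = 1) (x : Plane) : ∫ t, ρ (x - t) = 1 := by
  rw [← h1]
  exact integral_sub_left_eq_self ρ volume x

theorem sq_integral_mul_comp_sub_le (cρ : Continuous ρ) (sρ : HasCompactSupport ρ)
    (h0 : ∀ t, 0 ≤ ρ t) (h1 : ∫ t, ρ t = 1) (hX : Integrable X)
    (hX2 : Integrable fun t => X t ^ 2) (x : Plane) :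
    (∫ t, X t * ρ (x - t)) ^ 2 ≤ ∫ t, X t ^ 2 * ρ (x - t) := by
  set c := ∫ t, X t * ρ (x - t) with hc
  have i0 : Integrable fun t => ρ (x - t) :=
    (cρ.integrable_of_hasCompactSupport sρ).comp_sub_left x
  have i1 := integrable_mul_comp_sub cρ sρ hX x
  have i2 := integrable_mul_comp_sub cρ sρ hX2 x
  have h : 0 ≤ ∫ t, (X t ^ 2 * ρ (x - t) - 2 * c * (X t * ρ (x - t)) + c ^ 2 * ρ (x - t)) :=
    integral_nonneg fun t => by
      have := mul_nonneg (h0 (x - t)) (sq_nonneg (X t - c))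
      simp only [Pi.zero_apply]
      linarith
  have i3 : Integrable fun t => X t ^ 2 * ρ (x - t) - 2 * c * (X t * ρ (x - t)) :=
    i2.sub (i1.const_mul _)
  rw [integral_add i3 (i0.const_mul _), integral_sub i2 (i1.const_mul _),
    integral_const_mul, integral_const_mul, integral_comp_sub_eq_one h1, ← hc] at h
  linarith

theorem lintegral_sq_integral_mul_comp_sub_le (cρ : Continuous ρ) (sρ : HasCompactSupport ρ)
    (h0 : ∀ t, 0 ≤ ρ t) (h1 : ∫ t, ρ t = 1) (mX : Measurable X) (hX : Integrable X)
    (hX2 : Integrable fun t => X t ^ 2) :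
    ∫⁻ x, ENNReal.ofReal ((∫ t, X t * ρ (x - t)) ^ 2) ≤ ENNReal.ofReal (∫ t, X t ^ 2) := by
  have m1 : Measurable fun p : Plane × Plane =>
      ENNReal.ofReal (X p.2 ^ 2) * ENNReal.ofReal (ρ (p.1 - p.2)) := by
    have := cρ.measurable
    fun_prop
  calc ∫⁻ x, ENNReal.ofReal ((∫ t, X t * ρ (x - t)) ^ 2)
      ≤ ∫⁻ x, ∫⁻ t, ENNReal.ofReal (X t ^ 2) * ENNReal.ofReal (ρ (x - t)) := by
        refine lintegral_mono fun x => ?_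
        refine (ENNReal.ofReal_le_ofReal
          (sq_integral_mul_comp_sub_le cρ sρ h0 h1 hX hX2 x)).trans_eq ?_
        rw [ofReal_integral_eq_lintegral_ofReal (integrable_mul_comp_sub cρ sρ hX2 x)
          (ae_of_all _ fun t => mul_nonneg (sq_nonneg _) (h0 _))]
        simp only [ENNReal.ofReal_mul (sq_nonneg _)]
    _ = ∫⁻ t, ∫⁻ x, ENNReal.ofReal (X t ^ 2) * ENNReal.ofReal (ρ (x - t)) :=
        lintegral_lintegral_swap m1.aemeasurable
    _ = ∫⁻ t, ENNReal.ofReal (X t ^ 2) := by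
        refine lintegral_congr fun t => ?_
        rw [lintegral_const_mul _ (by have := cρ.measurable; fun_prop),
          lintegral_sub_right_eq_self (fun x => ENNReal.ofReal (ρ x)) t,
          ← ofReal_integral_eq_lintegral_ofReal (cρ.integrable_of_hasCompactSupport sρ)
          (ae_of_all _ h0), h1, ENNReal.ofReal_one, mul_one]
    _ = ENNReal.ofReal (∫ t, X t ^ 2) :=
        (ofReal_integral_eq_lintegral_ofReal hX2 (ae_of_all _ fun t => sq_nonneg _)).symm

variable {g : Plane → ℝ}

theorem integrable_of_hasCompactSupport_of_sq {h : Plane → ℝ} {K : Set Plane} (hK : IsCompact K)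
    (hs : ∀ x, x ∉ K → h x = 0) (hm : Measurable h) (h2 : Integrable fun x => h x ^ 2) :
    Integrable h := by
  have h3 : IntegrableOn (fun x => 1 + h x ^ 2) K :=
    (integrableOn_const hK.measure_lt_top.ne).add h2.integrableOn
  have h4 : IntegrableOn h K := by
    refine h3.mono' hm.aestronglyMeasurable (ae_of_all _ fun x => ?_)
    rw [Real.norm_eq_abs, ← sq_abs (h x)]
    nlinarith [sq_nonneg (|h x| - 1)]
  refine (integrableOn_iff_integrable_of_support_subset fun x hx => ?_).mp h4
  by_contra hxK
  exact hx (hs x hxK)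

theorem integrable_norm_fderiv (hs : HasCompactSupport g)
    (hi : Integrable fun x => ‖fderiv ℝ g x‖ ^ 2) : Integrable fun x => ‖fderiv ℝ g x‖ :=
  integrable_of_hasCompactSupport_of_sq (K := tsupport g) hs
    (fun x hx => by rw [image_eq_zero_of_notMem_tsupport
      (fun h => hx (tsupport_fderiv_subset ℝ h)), norm_zero])
    (measurable_fderiv ℝ g).norm hi

theorem contDiff_mollify (hg : Differentiable ℝ g) (dρ : ContDiff ℝ 1 ρ)
    (sρ : HasCompactSupport ρ) : ContDiff ℝ 1 fun x => ∫ t, g t * ρ (x - t) :=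
  sρ.contDiff_convolution_right (n := 1) (ContinuousLinearMap.mul ℝ ℝ)
    hg.continuous.locallyIntegrable dρ

theorem hasCompactSupport_mollify (hs : HasCompactSupport g) (sρ : HasCompactSupport ρ) :
    HasCompactSupport fun x => ∫ t, g t * ρ (x - t) :=
  HasCompactSupport.convolution (ContinuousLinearMap.mul ℝ ℝ) hs sρ

theorem fderiv_mollify_apply (hg : Differentiable ℝ g) (hs : HasCompactSupport g)
    (hi : Integrable fun x => ‖fderiv ℝ g x‖ ^ 2) (dρ : ContDiff ℝ 1 ρ)
    (sρ : HasCompactSupport ρ) (x v : Plane) :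
    fderiv ℝ (fun x => ∫ t, g t * ρ (x - t)) x v = ∫ t, fderiv ℝ g t v * ρ (x - t) := by
  have h1 := sρ.hasFDerivAt_convolution_right (ContinuousLinearMap.mul ℝ ℝ)
    (hg.continuous.locallyIntegrable (μ := volume)) dρ x
  have h2 := convolution_precompR_apply (ContinuousLinearMap.mul ℝ ℝ)
    (hg.continuous.locallyIntegrable (μ := volume)) (sρ.fderiv ℝ)
    (dρ.continuous_fderiv one_ne_zero) x v
  have h3 : fderiv ℝ (fun x => ∫ t, g t * ρ (x - t)) x v =
      ∫ t, g t * fderiv ℝ ρ (x - t) v := by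
    rw [← h1.fderiv] at h2
    exact h2
  have h4 : ∀ t, fderiv ℝ (fun t => ρ (x - t)) t v = -fderiv ℝ ρ (x - t) v := fun t => by
    have h5 : HasFDerivAt ρ (fderiv ℝ ρ (x - t)) (x - t) :=
      (dρ.differentiable one_ne_zero _).hasFDerivAt
    have h6 := h5.comp t ((hasFDerivAt_id t).const_sub x)
    have h7 : fderiv ℝ (fun t => ρ (x - t)) t = _ := h6.fderiv
    rw [h7]
    simp
  have ig : Integrable g := hg.continuous.integrable_of_hasCompactSupport hs
  have ig' : Integrable fun t => fderiv ℝ g t v := by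
    refine ((integrable_norm_fderiv hs hi).mul_const ‖v‖).mono'
      ((measurable_fderiv_apply_const ℝ g v).aestronglyMeasurable)
      (ae_of_all _ fun t => (fderiv ℝ g t).le_opNorm v)
  have cρ' : Continuous fun y => fderiv ℝ ρ y v :=
    (dρ.continuous_fderiv one_ne_zero).clm_apply continuous_const
  have sρ' : HasCompactSupport fun y => fderiv ℝ ρ y v :=
    (sρ.fderiv ℝ).comp_left (g := fun L : Plane →L[ℝ] ℝ => L v) rfl
  have h5 := integral_mul_fderiv_eq_neg_fderiv_mul_of_integrable (μ := (volume : Measure Plane))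
    (f := g) (g := fun t => ρ (x - t)) (v := v)
    (integrable_mul_comp_sub dρ.continuous sρ ig' x)
    (by
      simp only [h4, mul_neg]
      exact (integrable_mul_comp_sub cρ' sρ' ig x).neg)
    (integrable_mul_comp_sub dρ.continuous sρ ig x) (fun t _ => hg t)
    (fun t _ => ((dρ.differentiable one_ne_zero).comp (differentiable_id.const_sub x)) t)
  simp only [h4, mul_neg, integral_neg, neg_inj] at h5
  rw [h3, h5]

theorem norm_fderiv_mollify_le (hg : Differentiable ℝ g) (hs : HasCompactSupport g)
    (hi : Integrable fun x => ‖fderiv ℝ g x‖ ^ 2) (dρ : ContDiff ℝ 1 ρ)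
    (sρ : HasCompactSupport ρ) (h0 : ∀ t, 0 ≤ ρ t) (x : Plane) :
    ‖fderiv ℝ (fun x => ∫ t, g t * ρ (x - t)) x‖ ≤ ∫ t, ‖fderiv ℝ g t‖ * ρ (x - t) := by
  refine ContinuousLinearMap.opNorm_le_bound _
    (integral_nonneg fun t => mul_nonneg (norm_nonneg _) (h0 _)) fun v => ?_
  rw [fderiv_mollify_apply hg hs hi dρ sρ, ← integral_mul_const]
  refine norm_integral_le_of_norm_le
    ((integrable_mul_comp_sub dρ.continuous sρ (integrable_norm_fderiv hs hi) x).mul_const _)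
    (ae_of_all _ fun t => ?_)
  rw [norm_mul, Real.norm_of_nonneg (h0 (x - t)), mul_right_comm]
  exact mul_le_mul_of_nonneg_right ((fderiv ℝ g t).le_opNorm v) (h0 _)

theorem integrable_pow_of_hasCompactSupport {c : Plane → ℝ} (hc : Continuous c)
    (sc : HasCompactSupport c) {n : ℕ} (hn : n ≠ 0) : Integrable fun x => c x ^ n :=
  (hc.pow n).integrable_of_hasCompactSupport
    (sc.comp_left (g := fun y => y ^ n) (zero_pow hn))

/-- The Gagliardo–Nirenberg inequality along an approximation with smaller norms. -/
theorem lintegral_pow_four_le_of_le {c X : Plane → ℝ} {B : ℝ} (dc : ContDiff ℝ 1 c)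
    (sc : HasCompactSupport c) (c0 : ∀ x, 0 ≤ c x)
    (h1 : ∫⁻ x, ENNReal.ofReal (c x ^ 2) ≤ ENNReal.ofReal B) (hB : 0 ≤ B)
    (h2 : ∫⁻ x, ENNReal.ofReal (‖fderiv ℝ c x‖ ^ 2) ≤ ENNReal.ofReal (∫ x, X x ^ 2)) :
    ENNReal.ofReal (Real.pi * quarticConst) * ∫⁻ x, ENNReal.ofReal (c x ^ 4) ≤
      ENNReal.ofReal (2 * (∫ x, X x ^ 2) * B) := by
  have key := gagliardoNirenberg_of_contDiff dc sc c0
  have cp : ∀ n : ℕ, n ≠ 0 → Integrable fun x => c x ^ n := fun n hn =>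
    integrable_pow_of_hasCompactSupport dc.continuous sc hn
  have cd : Continuous fun x => ‖fderiv ℝ c x‖ ^ 2 := (dc.continuous_fderiv one_ne_zero).norm.pow 2
  have icd : Integrable fun x => ‖fderiv ℝ c x‖ ^ 2 :=
    cd.integrable_of_hasCompactSupport
      ((sc.fderiv ℝ).comp_left (g := fun y => ‖y‖ ^ 2) (by simp))
  rw [← ofReal_integral_eq_lintegral_ofReal (cp 2 two_ne_zero)
    (ae_of_all _ fun x => sq_nonneg _), ENNReal.ofReal_le_ofReal_iff hB] at h1
  rw [← ofReal_integral_eq_lintegral_ofReal icd (ae_of_all _ fun x => sq_nonneg _),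
    ENNReal.ofReal_le_ofReal_iff (integral_nonneg fun x => sq_nonneg _)] at h2
  rw [← ofReal_integral_eq_lintegral_ofReal (cp 4 four_ne_zero)
    (ae_of_all _ fun x => pow_nonneg (c0 x) 4), ← ENNReal.ofReal_mul
    (mul_nonneg Real.pi_pos.le quarticConst_pos.le)]
  refine ENNReal.ofReal_le_ofReal (key.trans ?_)
  have n1 : 0 ≤ ∫ x, c x ^ 2 := integral_nonneg fun x => sq_nonneg _
  have n2 : 0 ≤ ∫ x, X x ^ 2 := integral_nonneg fun x => sq_nonneg _
  exact mul_le_mul (by linarith) h1 n1 (by linarith)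

/-- The Gagliardo–Nirenberg inequality for a mollified function. -/
theorem lintegral_mollify_pow_four_le (hg : Differentiable ℝ g) (hs : HasCompactSupport g)
    (hg0 : ∀ x, 0 ≤ g x) (hi : Integrable fun x => ‖fderiv ℝ g x‖ ^ 2) (dρ : ContDiff ℝ 1 ρ)
    (sρ : HasCompactSupport ρ) (h0 : ∀ t, 0 ≤ ρ t) (h1 : ∫ t, ρ t = 1) :
    ENNReal.ofReal (Real.pi * quarticConst) *
      ∫⁻ x, ENNReal.ofReal ((∫ t, g t * ρ (x - t)) ^ 4) ≤
      ENNReal.ofReal (2 * (∫ x, ‖fderiv ℝ g x‖ ^ 2) * ∫ x, g x ^ 2) := by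
  have ig : Integrable g := hg.continuous.integrable_of_hasCompactSupport hs
  have ig2 := integrable_pow_of_hasCompactSupport hg.continuous hs two_ne_zero
  refine lintegral_pow_four_le_of_le (contDiff_mollify hg dρ sρ) (hasCompactSupport_mollify hs sρ)
    (fun x => integral_nonneg fun t => mul_nonneg (hg0 _) (h0 _))
    (lintegral_sq_integral_mul_comp_sub_le dρ.continuous sρ h0 h1 hg.continuous.measurable
      ig ig2) (integral_nonneg fun x => sq_nonneg _) ?_
  refine le_trans ?_ (lintegral_sq_integral_mul_comp_sub_le dρ.continuous sρ h0 h1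
    (measurable_fderiv ℝ g).norm (integrable_norm_fderiv hs hi) hi)
  exact lintegral_mono fun x => ENNReal.ofReal_le_ofReal (pow_le_pow_left₀ (norm_nonneg _)
    (norm_fderiv_mollify_le hg hs hi dρ sρ h0 x) 2)

end Mollify

/-- Fatou's lemma for a quartic bound. -/
theorem lintegral_pow_four_le_of_tendsto {F : ℕ → Plane → ℝ} {f : Plane → ℝ} {K B : ENNReal}
    {b : ℕ → ENNReal} (hF : ∀ n, Continuous (F n))
    (hl : ∀ x, Tendsto (fun n => F n x) atTop (𝓝 (f x)))
    (hb : Tendsto b atTop (𝓝 B)) (hK : K ≠ ⊤)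
    (h : ∀ n, K * ∫⁻ x, ENNReal.ofReal (F n x ^ 4) ≤ b n) :
    K * ∫⁻ x, ENNReal.ofReal (f x ^ 4) ≤ B := by
  have m : ∀ n, Measurable fun x => K * ENNReal.ofReal (F n x ^ 4) := fun n => by
    have := (hF n).measurable
    fun_prop
  have h1 : ∀ x, liminf (fun n => K * ENNReal.ofReal (F n x ^ 4)) atTop =
      K * ENNReal.ofReal (f x ^ 4) := fun x =>
    (ENNReal.Tendsto.const_mul (ENNReal.tendsto_ofReal ((hl x).pow 4)) (Or.inr hK)).liminf_eq
  rw [← lintegral_const_mul' _ _ hK]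
  calc ∫⁻ x, K * ENNReal.ofReal (f x ^ 4)
      = ∫⁻ x, liminf (fun n => K * ENNReal.ofReal (F n x ^ 4)) atTop := by simp only [h1]
    _ ≤ liminf (fun n => ∫⁻ x, K * ENNReal.ofReal (F n x ^ 4)) atTop := lintegral_liminf_le m
    _ ≤ liminf b atTop := by
        refine liminf_le_liminf (Eventually.of_forall fun n => ?_)
        rw [lintegral_const_mul' _ _ hK]
        exact h n
    _ = B := hb.liminf_eq

/-- The Gagliardo–Nirenberg inequality for differentiable functions of compact support. -/
theorem gagliardoNirenberg_of_hasCompactSupport {g : Plane → ℝ} (hg : Differentiable ℝ g)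
    (hs : HasCompactSupport g) (hg0 : ∀ x, 0 ≤ g x)
    (hi : Integrable fun x => ‖fderiv ℝ g x‖ ^ 2) :
    ENNReal.ofReal (Real.pi * quarticConst) * ∫⁻ x, ENNReal.ofReal (g x ^ 4) ≤
      ENNReal.ofReal (2 * (∫ x, ‖fderiv ℝ g x‖ ^ 2) * ∫ x, g x ^ 2) := by
  let φ : ℕ → ContDiffBump (0 : Plane) := fun n =>
    ⟨1 / (2 * ((n : ℝ) + 1)), 1 / ((n : ℝ) + 1), by positivity, by
      gcongr
      have : (0 : ℝ) ≤ n := n.cast_nonneg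
      linarith⟩
  have hφ : Tendsto (fun n => (φ n).rOut) atTop (𝓝 0) := tendsto_one_div_add_atTop_nhds_zero_nat
  refine lintegral_pow_four_le_of_tendsto
    (F := fun n x => ∫ t, g t * (φ n).normed volume (x - t))
    (b := fun _ => ENNReal.ofReal (2 * (∫ x, ‖fderiv ℝ g x‖ ^ 2) * ∫ x, g x ^ 2))
    (fun n => (contDiff_mollify hg (φ n).contDiff_normed (φ n).hasCompactSupport_normed).continuous)
    (fun x => ?_) tendsto_const_nhds ENNReal.ofReal_ne_top fun n =>
    lintegral_mollify_pow_four_le hg hs hg0 hi (φ n).contDiff_normed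
      (φ n).hasCompactSupport_normed (φ n).nonneg_normed (φ n).integral_normed
  have h1 := ContDiffBump.convolution_tendsto_right_of_continuous (μ := volume) hφ
    hg.continuous x
  simp only [convolution_lsmul_swap, smul_eq_mul] at h1
  simpa only [mul_comm] using h1

section Cutoff

variable {f χ : Plane → ℝ} {L s : ℝ}

theorem hasFDerivAt_cutoff_mul (hf : Differentiable ℝ f) (hχ : Differentiable ℝ χ) (s : ℝ)
    (x : Plane) :
    HasFDerivAt (fun y => χ (s • y) * f y)
      (χ (s • x) • fderiv ℝ f x + f x • s • fderiv ℝ χ (s • x)) x := by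
  have h1 : HasFDerivAt (fun y : Plane => χ (s • y)) (s • fderiv ℝ χ (s • x)) x := by
    have := (hχ (s • x)).hasFDerivAt.comp x ((hasFDerivAt_id x).const_smul s)
    refine this.congr_fderiv ?_
    ext v
    simp
  exact h1.mul (hf x).hasFDerivAt

theorem norm_fderiv_cutoff_mul_sq_le (hf : Differentiable ℝ f) (f0 : ∀ x, 0 ≤ f x)
    (hχ : Differentiable ℝ χ) (χ0 : ∀ x, 0 ≤ χ x) (χ1 : ∀ x, χ x ≤ 1)
    (hL : ∀ x, ‖fderiv ℝ χ x‖ ≤ L) (hs : 0 < s) (x : Plane) :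
    ‖fderiv ℝ (fun y => χ (s • y) * f y) x‖ ^ 2 ≤
      (1 + s) * ‖fderiv ℝ f x‖ ^ 2 + (s ^ 2 + s) * L ^ 2 * f x ^ 2 := by
  rw [(hasFDerivAt_cutoff_mul hf hχ s x).fderiv]
  have hb : ‖χ (s • x) • fderiv ℝ f x + f x • s • fderiv ℝ χ (s • x)‖ ≤
      ‖fderiv ℝ f x‖ + s * (L * f x) := by
    refine (norm_add_le _ _).trans (add_le_add ?_ ?_)
    · rw [norm_smul, Real.norm_of_nonneg (χ0 _)]
      exact mul_le_of_le_one_left (norm_nonneg _) (χ1 _)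
    · rw [norm_smul, norm_smul, Real.norm_of_nonneg (f0 _), Real.norm_of_nonneg hs.le]
      calc f x * (s * ‖fderiv ℝ χ (s • x)‖) = s * (‖fderiv ℝ χ (s • x)‖ * f x) := by ring
        _ ≤ s * (L * f x) := by
          have := f0 x
          have := hL (s • x)
          gcongr
  refine (pow_le_pow_left₀ (norm_nonneg _) hb 2).trans ?_
  nlinarith [mul_nonneg hs.le (sq_nonneg (‖fderiv ℝ f x‖ - L * f x))]

/-- The Gagliardo–Nirenberg inequality for nonnegative differentiable functions. -/
theorem gagliardoNirenberg_of_nonneg (hf : Differentiable ℝ f) (f0 : ∀ x, 0 ≤ f x)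
    (h2 : Integrable fun x => f x ^ 2) (hi : Integrable fun x => ‖fderiv ℝ f x‖ ^ 2) :
    ENNReal.ofReal (Real.pi * quarticConst) * ∫⁻ x, ENNReal.ofReal (f x ^ 4) ≤
      ENNReal.ofReal (2 * (∫ x, ‖fderiv ℝ f x‖ ^ 2) * ∫ x, f x ^ 2) := by
  let φ : ContDiffBump (0 : Plane) := ⟨1, 2, one_pos, one_lt_two⟩
  have φd : Differentiable ℝ φ := φ.contDiff.differentiable one_ne_zero
  obtain ⟨L, hL⟩ := (φ.hasCompactSupport.fderiv ℝ).exists_bound_of_continuous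
    (φ.contDiff.continuous_fderiv one_ne_zero)
  let s : ℕ → ℝ := fun n => 1 / ((n : ℝ) + 1)
  have s0 : ∀ n, 0 < s n := fun n => by positivity
  have st : Tendsto s atTop (𝓝 0) := tendsto_one_div_add_atTop_nhds_zero_nat
  set A := ∫ x, ‖fderiv ℝ f x‖ ^ 2 with hA
  set B := ∫ x, f x ^ 2 with hB
  have B0 : 0 ≤ B := integral_nonneg fun x => sq_nonneg _
  have gd : ∀ n, Differentiable ℝ fun x => φ (s n • x) * f x := fun n x =>
    (hasFDerivAt_cutoff_mul hf φd (s n) x).differentiableAt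
  have gs : ∀ n, HasCompactSupport fun x => φ (s n • x) * f x := fun n =>
    (φ.hasCompactSupport.comp_smul (s0 n).ne').mul_right
  have gb : ∀ n x, ‖fderiv ℝ (fun y => φ (s n • y) * f y) x‖ ^ 2 ≤
      (1 + s n) * ‖fderiv ℝ f x‖ ^ 2 + (s n ^ 2 + s n) * L ^ 2 * f x ^ 2 := fun n =>
    norm_fderiv_cutoff_mul_sq_le hf f0 φd (fun x => φ.nonneg) (fun x => φ.le_one) hL (s0 n)
  have ib : ∀ n, Integrable fun x =>
      (1 + s n) * ‖fderiv ℝ f x‖ ^ 2 + (s n ^ 2 + s n) * L ^ 2 * f x ^ 2 := fun n =>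
    (hi.const_mul _).add (h2.const_mul _)
  have ig : ∀ n, Integrable fun x => ‖fderiv ℝ (fun y => φ (s n • y) * f y) x‖ ^ 2 := fun n =>
    (ib n).mono' ((measurable_fderiv ℝ _).norm.pow_const 2).aestronglyMeasurable
      (ae_of_all _ fun x => by
        rw [Real.norm_of_nonneg (sq_nonneg _)]
        exact gb n x)
  have bA : ∀ n, ∫ x, ‖fderiv ℝ (fun y => φ (s n • y) * f y) x‖ ^ 2 ≤
      (1 + s n) * A + (s n ^ 2 + s n) * L ^ 2 * B := fun n => by
    refine (integral_mono (ig n) (ib n) (gb n)).trans_eq ?_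
    rw [integral_add (hi.const_mul _) (h2.const_mul _), integral_const_mul, integral_const_mul]
  have bB : ∀ n, ∫ x, (φ (s n • x) * f x) ^ 2 ≤ B := fun n => by
    refine integral_mono_of_nonneg (ae_of_all _ fun x => sq_nonneg _) h2 (ae_of_all _ fun x => ?_)
    exact pow_le_pow_left₀ (mul_nonneg φ.nonneg (f0 x))
      (mul_le_of_le_one_left (f0 x) φ.le_one) 2
  refine lintegral_pow_four_le_of_tendsto (F := fun n x => φ (s n • x) * f x)
    (b := fun n => ENNReal.ofReal (2 * ((1 + s n) * A + (s n ^ 2 + s n) * L ^ 2 * B) * B))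
    (fun n => (gd n).continuous) (fun x => ?_) ?_ ENNReal.ofReal_ne_top fun n => ?_
  · have h1 : Tendsto (fun n => φ (s n • x) * f x) atTop (𝓝 (φ ((0 : ℝ) • x) * f x)) :=
      ((φ.continuous.tendsto _).comp (st.smul_const x)).mul_const _
    rwa [zero_smul, φ.one_of_mem_closedBall (mem_closedBall_self zero_le_one), one_mul] at h1
  · refine ENNReal.tendsto_ofReal ?_
    have h1 : Tendsto (fun n => 2 * ((1 + s n) * A + (s n ^ 2 + s n) * L ^ 2 * B) * B) atTop
        (𝓝 (2 * ((1 + 0) * A + (0 ^ 2 + 0) * L ^ 2 * B) * B)) :=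
      ((((st.const_add 1).mul_const A).add
        (((((st.pow 2).add st).mul_const (L ^ 2)).mul_const B))).const_mul 2).mul_const B
    simpa using h1
  · refine (gagliardoNirenberg_of_hasCompactSupport (gd n) (gs n)
      (fun x => mul_nonneg φ.nonneg (f0 x)) (ig n)).trans (ENNReal.ofReal_le_ofReal ?_)
    have n1 : 0 ≤ ∫ x, (φ (s n • x) * f x) ^ 2 := integral_nonneg fun x => sq_nonneg _
    have n2 : 0 ≤ ∫ x, ‖fderiv ℝ (fun y => φ (s n • y) * f y) x‖ ^ 2 :=
      integral_nonneg fun x => sq_nonneg _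
    have := bA n
    exact mul_le_mul (by linarith) (bB n) n1 (by linarith)

end Cutoff

section Modulus

variable {u : Plane → ℂ} {κ : ℝ}

/-- A smooth regularisation of the modulus. -/
def regAbs (κ : ℝ) (u : Plane → ℂ) (x : Plane) : ℝ := √(‖u x‖ ^ 2 + κ ^ 2) - κ

theorem regAbs_nonneg (u : Plane → ℂ) (κ : ℝ) (x : Plane) : 0 ≤ regAbs κ u x :=
  sub_nonneg.2 (Real.le_sqrt_of_sq_le (by nlinarith [sq_nonneg ‖u x‖]))

theorem regAbs_le (hκ : 0 ≤ κ) (u : Plane → ℂ) (x : Plane) : regAbs κ u x ≤ ‖u x‖ := by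
  rw [regAbs, sub_le_iff_le_add]
  exact Real.sqrt_le_left (by positivity) |>.2 (by nlinarith [mul_nonneg (norm_nonneg (u x)) hκ])

theorem hasFDerivAt_sqrt_sq_add (hκ : κ ≠ 0) {n : Plane → ℝ} {x : Plane} {n' : Plane →L[ℝ] ℝ}
    (hn : HasFDerivAt n n' x) :
    HasFDerivAt (fun y => √(n y ^ 2 + κ ^ 2) - κ) ((n x / √(n x ^ 2 + κ ^ 2)) • n') x := by
  have hp : n x ^ 2 + κ ^ 2 ≠ 0 := by positivity
  refine (((hn.pow 2).add_const (κ ^ 2)).sqrt hp).sub_const κ |>.congr_fderiv ?_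
  ext v
  simp
  field_simp

theorem differentiable_regAbs (hu : Differentiable ℝ u) (hκ : κ ≠ 0) :
    Differentiable ℝ (regAbs κ u) := fun x =>
  ((((hu x).norm_sq ℂ).add_const _).sqrt (by positivity)).sub_const κ

theorem gradAbsSq_of_eq_zero {x : Plane} (hx : u x = 0) : gradAbsSq u x = 0 := by
  have h : IsLocalMin (fun y => ‖u y‖) x :=
    Eventually.of_forall fun y => by simp [hx]
  simp [gradAbsSq, h.fderiv_eq_zero]

theorem norm_fderiv_regAbs_sq_le (hu : Differentiable ℝ u) (hκ : 0 < κ) (x : Plane) :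
    ‖fderiv ℝ (regAbs κ u) x‖ ^ 2 ≤ gradAbsSq u x := by
  by_cases hx : u x = 0
  · rw [gradAbsSq_of_eq_zero hx]
    have h : IsLocalMin (regAbs κ u) x := Eventually.of_forall fun y => by
      simpa [regAbs, hx, Real.sqrt_sq hκ.le] using regAbs_nonneg u κ y
    simp [h.fderiv_eq_zero]
  · have h := hasFDerivAt_sqrt_sq_add hκ.ne' ((hu x).norm ℂ hx).hasFDerivAt
    have h' : fderiv ℝ (regAbs κ u) x = _ := h.fderiv
    rw [h', gradAbsSq, norm_smul, Real.norm_of_nonneg (by positivity)]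
    refine pow_le_pow_left₀ (by positivity) (mul_le_of_le_one_left (norm_nonneg _) ?_) 2
    exact div_le_one_of_le₀ (Real.le_sqrt_of_sq_le (by nlinarith [sq_nonneg κ]))
      (Real.sqrt_nonneg _)

/-- The square of the modulus of a partial derivative splits into radial and phase parts. -/
theorem norm_mul_fderiv_norm (hu : Differentiable ℝ u) {x : Plane} (v : Plane) (hx : u x ≠ 0) :
    ‖u x‖ * fderiv ℝ (fun y => ‖u y‖) x v =
      ((starRingEnd ℂ) (u x) * fderiv ℝ u x v).re := by
  have h1 := (((hu x).norm ℂ hx).hasFDerivAt.pow 2).unique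
    ((hu x).hasFDerivAt.norm_sq)
  have h2 := DFunLike.congr_fun h1 v
  simp at h2
  simp only [Complex.mul_re, Complex.conj_re, Complex.conj_im]
  linarith

theorem norm_sq_le_of_apply (l : Plane →L[ℝ] ℝ) : ‖l‖ ^ 2 ≤ l e0 ^ 2 + l e1 ^ 2 := by
  have h : ‖l‖ ≤ √(l e0 ^ 2 + l e1 ^ 2) := by
    refine l.opNorm_le_bound (Real.sqrt_nonneg _) fun v => ?_
    rw [← Real.sqrt_sq (norm_nonneg v), ← Real.sqrt_mul (by positivity), norm_sq_plane]
    refine Real.abs_le_sqrt ?_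
    conv_lhs => rw [plane_eq_smul_add_smul v]
    simp only [map_add, map_smul, smul_eq_mul]
    nlinarith [sq_nonneg (v 0 * l e1 - v 1 * l e0)]
  calc ‖l‖ ^ 2 ≤ √(l e0 ^ 2 + l e1 ^ 2) ^ 2 := pow_le_pow_left₀ (norm_nonneg _) h 2
    _ = _ := Real.sq_sqrt (by positivity)

/-- The diamagnetic inequality with the centrifugal term made explicit. -/
theorem gradAbsSq_add_le (hu : Differentiable ℝ u) (Ω : ℝ) (x : Plane) :
    gradAbsSq u x - Ω ^ 2 / 4 * ‖x‖ ^ 2 * ‖u x‖ ^ 2 ≤ gradSq u x - Ω * momentum u x := by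
  by_cases hx : u x = 0
  · rw [gradAbsSq_of_eq_zero hx]
    simp only [momentum, gradSq, hx]
    simp
    positivity
  have hn : 0 < ‖u x‖ := norm_pos_iff.2 hx
  have key : ∀ v, ‖fderiv ℝ u x v‖ ^ 2 = fderiv ℝ (fun y => ‖u y‖) x v ^ 2 +
      (((starRingEnd ℂ) (u x) * fderiv ℝ u x v).im / ‖u x‖) ^ 2 := fun v => by
    have h1 := norm_mul_fderiv_norm hu v hx
    have h2 : ‖(starRingEnd ℂ) (u x) * fderiv ℝ u x v‖ ^ 2 =
        (‖u x‖ * ‖fderiv ℝ u x v‖) ^ 2 := by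
      rw [norm_mul, Complex.norm_conj]
    rw [Complex.sq_norm, Complex.normSq_apply, ← h1] at h2
    field_simp
    linarith
  have h1 := norm_sq_le_of_apply (fderiv ℝ (fun y => ‖u y‖) x)
  simp only [gradAbsSq, gradSq, momentum, d0, d1, norm_sq_plane]
  rw [key e0, key e1]
  set I0 := ((starRingEnd ℂ) (u x) * fderiv ℝ u x e0).im
  set I1 := ((starRingEnd ℂ) (u x) * fderiv ℝ u x e1).im
  have e : (I0 / ‖u x‖ + Ω / 2 * x 1 * ‖u x‖) ^ 2 + (I1 / ‖u x‖ - Ω / 2 * x 0 * ‖u x‖) ^ 2 =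
      (I0 / ‖u x‖) ^ 2 + (I1 / ‖u x‖) ^ 2 - Ω * (-(x 1) * I0 + x 0 * I1) +
        Ω ^ 2 / 4 * (x 0 ^ 2 + x 1 ^ 2) * ‖u x‖ ^ 2 := by
    field_simp
    ring
  have := add_nonneg (sq_nonneg (I0 / ‖u x‖ + Ω / 2 * x 1 * ‖u x‖))
    (sq_nonneg (I1 / ‖u x‖ - Ω / 2 * x 0 * ‖u x‖))
  linarith

theorem gradAbsSq_le (hu : Differentiable ℝ u) (x : Plane) : gradAbsSq u x ≤ gradSq u x := by
  simpa using gradAbsSq_add_le hu 0 x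

theorem abs_momentum_le (u : Plane → ℂ) (x : Plane) :
    |momentum u x| ≤ ‖x‖ ^ 2 * ‖u x‖ ^ 2 + gradSq u x := by
  have key : ∀ (t : ℝ) (w : ℂ), |t * ((starRingEnd ℂ) (u x) * w).im| ≤
      t ^ 2 * ‖u x‖ ^ 2 + ‖w‖ ^ 2 := fun t w => by
    have h1 : |((starRingEnd ℂ) (u x) * w).im| ≤ ‖u x‖ * ‖w‖ := by
      simpa using Complex.abs_im_le_norm ((starRingEnd ℂ) (u x) * w)
    rw [abs_mul]
    have h2 : |t| * |((starRingEnd ℂ) (u x) * w).im| ≤ |t| * (‖u x‖ * ‖w‖) := by gcongr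
    nlinarith [sq_nonneg (|t| * ‖u x‖ - ‖w‖), sq_abs t,
      mul_nonneg (mul_nonneg (abs_nonneg t) (norm_nonneg (u x))) (norm_nonneg w)]
  have h := abs_add_le (-(x 1) * ((starRingEnd ℂ) (u x) * d0 u x).im)
    (x 0 * ((starRingEnd ℂ) (u x) * d1 u x).im)
  have h0 := key (-(x 1)) (d0 u x)
  have h1 := key (x 0) (d1 u x)
  rw [momentum, gradSq, norm_sq_plane]
  nlinarith

theorem measurable_momentum (hu : Differentiable ℝ u) : Measurable (momentum u) := by
  have h0 : Measurable (d0 u) := measurable_fderiv_apply_const ℝ u e0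
  have h1 : Measurable (d1 u) := measurable_fderiv_apply_const ℝ u e1
  have h2 := hu.continuous.measurable
  have h3 : Measurable fun x => (starRingEnd ℂ) (u x) :=
    Complex.continuous_conj.measurable.comp h2
  unfold momentum
  fun_prop

theorem integrable_gradAbsSq (hu : InH1 u) : Integrable (gradAbsSq u) :=
  hu.2.2.mono' ((measurable_fderiv ℝ _).norm.pow_const 2).aestronglyMeasurable
    (ae_of_all _ fun x => by
      rw [Real.norm_of_nonneg (show 0 ≤ gradAbsSq u x from sq_nonneg _)]
      exact gradAbsSq_le hu.1 x)

/-- The Gagliardo–Nirenberg inequality in terms of the gradient of the modulus. -/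
theorem lintegral_norm_pow_four_le (hu : InH1 u) :
    ENNReal.ofReal (Real.pi * quarticConst) * ∫⁻ x, ENNReal.ofReal (‖u x‖ ^ 4) ≤
      ENNReal.ofReal (2 * (∫ x, gradAbsSq u x) * ∫ x, ‖u x‖ ^ 2) := by
  let κ : ℕ → ℝ := fun n => 1 / ((n : ℝ) + 1)
  have κ0 : ∀ n, 0 < κ n := fun n => by positivity
  have κt : Tendsto κ atTop (𝓝 0) := tendsto_one_div_add_atTop_nhds_zero_nat
  have rd : ∀ n, Differentiable ℝ (regAbs (κ n) u) := fun n =>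
    differentiable_regAbs hu.1 (κ0 n).ne'
  have b2 : ∀ n x, regAbs (κ n) u x ^ 2 ≤ ‖u x‖ ^ 2 := fun n x =>
    pow_le_pow_left₀ (regAbs_nonneg u _ x) (regAbs_le (κ0 n).le u x) 2
  have i2 : ∀ n, Integrable fun x => regAbs (κ n) u x ^ 2 := fun n =>
    hu.2.1.mono' ((rd n).continuous.pow 2).aestronglyMeasurable (ae_of_all _ fun x => by
      rw [Real.norm_of_nonneg (sq_nonneg _)]
      exact b2 n x)
  have ig : ∀ n, Integrable fun x => ‖fderiv ℝ (regAbs (κ n) u) x‖ ^ 2 := fun n =>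
    (integrable_gradAbsSq hu).mono'
      ((measurable_fderiv ℝ _).norm.pow_const 2).aestronglyMeasurable (ae_of_all _ fun x => by
        rw [Real.norm_of_nonneg (sq_nonneg _)]
        exact norm_fderiv_regAbs_sq_le hu.1 (κ0 n) x)
  refine lintegral_pow_four_le_of_tendsto (F := fun n x => regAbs (κ n) u x)
    (b := fun _ => ENNReal.ofReal (2 * (∫ x, gradAbsSq u x) * ∫ x, ‖u x‖ ^ 2))
    (fun n => (rd n).continuous) (fun x => ?_) tendsto_const_nhds ENNReal.ofReal_ne_top
    fun n => ?_
  · have h1 : Tendsto (fun n => √(‖u x‖ ^ 2 + κ n ^ 2) - κ n) atTop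
        (𝓝 (√(‖u x‖ ^ 2 + 0 ^ 2) - 0)) :=
      ((κt.pow 2).const_add _).sqrt.sub κt
    simpa [regAbs, Real.sqrt_sq (norm_nonneg (u x))] using h1
  · refine (gagliardoNirenberg_of_nonneg (rd n) (regAbs_nonneg u _) (i2 n) (ig n)).trans
      (ENNReal.ofReal_le_ofReal ?_)
    have n1 : 0 ≤ ∫ x, regAbs (κ n) u x ^ 2 := integral_nonneg fun x => sq_nonneg _
    have n2 : 0 ≤ ∫ x, gradAbsSq u x := integral_nonneg fun x => sq_nonneg _
    have b1 := integral_mono (ig n) (integrable_gradAbsSq hu)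
      (norm_fderiv_regAbs_sq_le hu.1 (κ0 n))
    exact mul_le_mul (by linarith) (integral_mono (i2 n) hu.2.1 (b2 n)) n1 (by linarith)

theorem integrable_norm_pow_four (hu : InH1 u) : Integrable fun x => ‖u x‖ ^ 4 := by
  refine ⟨(hu.1.continuous.norm.pow 4).aestronglyMeasurable, ?_⟩
  rw [hasFiniteIntegral_iff_ofReal (ae_of_all _ fun x => by positivity)]
  by_contra h
  have h1 := lintegral_norm_pow_four_le hu
  rw [not_lt_top_iff.1 h, ENNReal.mul_top
    (ENNReal.ofReal_pos.2 (mul_pos Real.pi_pos quarticConst_pos)).ne'] at h1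
  exact absurd h1 (not_le_of_gt ENNReal.ofReal_lt_top)

theorem integral_norm_pow_four_le (hu : InH1 u) :
    Real.pi * quarticConst * ∫ x, ‖u x‖ ^ 4 ≤
      2 * (∫ x, gradAbsSq u x) * ∫ x, ‖u x‖ ^ 2 := by
  have h1 := lintegral_norm_pow_four_le hu
  have n1 : 0 ≤ ∫ x, ‖u x‖ ^ 2 := integral_nonneg fun x => sq_nonneg _
  have n2 : 0 ≤ ∫ x, gradAbsSq u x := integral_nonneg fun x => sq_nonneg _
  rwa [← ofReal_integral_eq_lintegral_ofReal (integrable_norm_pow_four hu)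
    (ae_of_all _ fun x => by positivity), ← ENNReal.ofReal_mul
    (mul_nonneg Real.pi_pos.le quarticConst_pos.le),
    ENNReal.ofReal_le_ofReal_iff (by positivity)] at h1

end Modulus

theorem neg_integral_le_integral {f g : Plane → ℝ} (hg : Integrable g) (g0 : ∀ x, 0 ≤ g x)
    (h : ∀ x, -g x ≤ f x) : -∫ x, g x ≤ ∫ x, f x := by
  by_cases hf : Integrable f
  · rw [← integral_neg]
    exact integral_mono hg.neg hf h
  · rw [integral_undef hf]
    exact neg_nonpos.2 (integral_nonneg g0)

/-- The square of the singular part of the logarithm. -/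
def logSing (r : ℝ) : ℝ := (Iio 1).indicator (fun t => Real.log t ^ 2) r

theorem logSing_nonneg (r : ℝ) : 0 ≤ logSing r := indicator_nonneg (fun _ _ => sq_nonneg _) r

theorem integrable_logSing : Integrable fun x : Plane => logSing ‖x‖ := by
  rw [integrable_fun_norm_plane]
  have h : (fun r => r * logSing r) = (Iio 1).indicator fun r => r * Real.log r ^ 2 := by
    ext r
    by_cases hr : r < 1 <;> simp [logSing, hr]
  rw [h, IntegrableOn, integrable_indicator_iff measurableSet_Iio, IntegrableOn,
    Measure.restrict_restrict measurableSet_Iio, inter_comm, Ioi_inter_Iio]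
  refine IntegrableOn.of_bound (C := 4) (by simp) (by fun_prop) ?_
  refine (ae_restrict_iff' measurableSet_Ioo).2 (ae_of_all _ fun r hr => ?_)
  have h1 := Real.abs_log_mul_self_rpow_lt r (1 / 2) hr.1 hr.2.le (by norm_num)
  have h2 : (Real.log r * r ^ (1 / 2 : ℝ)) ^ 2 = r * Real.log r ^ 2 := by
    rw [mul_pow, ← Real.sqrt_eq_rpow, Real.sq_sqrt hr.1.le, mul_comm]
  rw [← h2, Real.norm_of_nonneg (sq_nonneg _), ← sq_abs]
  rw [one_div_one_div] at h1
  nlinarith [abs_nonneg (Real.log r * r ^ (1 / 2 : ℝ))]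

theorem neg_logSing_add_le {l r s : ℝ} (hl : 0 < l) (hs : 0 ≤ s) :
    -(l / 2 * logSing r + 1 / (2 * l) * s ^ 2) ≤ Real.log r * s := by
  by_cases h : r < 1
  · have e : logSing r = Real.log r ^ 2 := by simp [logSing, h]
    rw [e]
    have e2 : l / 2 * Real.log r ^ 2 + 1 / (2 * l) * s ^ 2 + Real.log r * s =
        (l * Real.log r + s) ^ 2 / (2 * l) := by
      field_simp
      ring
    have : 0 ≤ (l * Real.log r + s) ^ 2 / (2 * l) := by positivity
    linarith
  · have e : logSing r = 0 := by simp [logSing, h]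
    rw [e]
    have h1 := mul_nonneg (Real.log_nonneg (not_lt.1 h)) hs
    have : 0 ≤ 1 / (2 * l) * s ^ 2 := by positivity
    linarith

/-- A lower bound for the logarithmic convolution energy. -/
theorem neg_mul_le_logConv {u : Plane → ℂ} (hu : InH1 u) {l : ℝ} (hl : 0 < l) :
    -((l / 2 * (∫ x : Plane, logSing ‖x‖) + 1 / (2 * l) * ∫ x, ‖u x‖ ^ 4) *
      ∫ x, ‖u x‖ ^ 2) ≤ logConv u := by
  have i4 : Integrable fun y => (‖u y‖ ^ 2) ^ 2 := by
    simpa only [← pow_mul] using integrable_norm_pow_four hu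
  have n1 : 0 ≤ ∫ x : Plane, logSing ‖x‖ := integral_nonneg fun x => logSing_nonneg _
  have n2 : 0 ≤ ∫ x, ‖u x‖ ^ 4 := integral_nonneg fun x => by positivity
  rw [← integral_const_mul]
  refine neg_integral_le_integral (hu.2.1.const_mul _) (fun x => by positivity) fun x => ?_
  have iL : Integrable fun y : Plane => logSing ‖x - y‖ := integrable_logSing.comp_sub_left x
  have e : (l / 2 * (∫ x : Plane, logSing ‖x‖) + 1 / (2 * l) * ∫ x, ‖u x‖ ^ 4) * ‖u x‖ ^ 2 =
      ∫ y, ‖u x‖ ^ 2 * (l / 2 * logSing ‖x - y‖ + 1 / (2 * l) * (‖u y‖ ^ 2) ^ 2) := by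
    rw [integral_const_mul, integral_add (iL.const_mul _) (i4.const_mul _), integral_const_mul,
      integral_const_mul, integral_sub_left_eq_self (fun z : Plane => logSing ‖z‖) volume x]
    simp only [← pow_mul]
    ring
  rw [e]
  refine neg_integral_le_integral (((iL.const_mul _).add (i4.const_mul _)).const_mul _)
    (fun y => ?_) fun y => ?_
  · have := logSing_nonneg ‖x - y‖
    positivity
  · have h1 := mul_le_mul_of_nonneg_left
      (neg_logSing_add_le (r := ‖x - y‖) hl (sq_nonneg ‖u y‖)) (sq_nonneg ‖u x‖)
    linarith

theorem SubCritical.exists_lower_bound {V : Plane → ℝ} {Ω : ℝ} (hV : ∀ x, 0 ≤ V x) (h0 : 0 ≤ Ω)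
    (hS : SubCritical V Ω) :
    ∃ m : ℝ, 0 ≤ m ∧ ∀ x : Plane, -m ≤ V x - Ω ^ 2 / 4 * ‖x‖ ^ 2 := by
  obtain ⟨W, ⟨W0, hW⟩, hΩ⟩ := hS
  obtain ⟨R, hR⟩ := hW 0
  refine ⟨Ω ^ 2 / 4 * R ^ 2, by positivity, fun x => ?_⟩
  rcases le_or_gt R ‖x‖ with h | h
  · have h1 := hR x h
    have h2 : Ω ^ 2 / 4 * ‖x‖ ^ 2 ≤ W ^ 2 / 4 * ‖x‖ ^ 2 := by gcongr
    have h3 : 0 ≤ Ω ^ 2 / 4 * R ^ 2 := by positivity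
    linarith
  · have h1 : Ω ^ 2 / 4 * ‖x‖ ^ 2 ≤ Ω ^ 2 / 4 * R ^ 2 := by gcongr
    linarith [hV x]

theorem V110.integrable_norm_sq_mul {V : Plane → ℝ} {u : Plane → ℂ} (hV : V110 V)
    (hu : InH V u) : Integrable fun x => ‖x‖ ^ 2 * ‖u x‖ ^ 2 := by
  obtain ⟨c, hc, R, hR⟩ := hV.2.2.2
  refine ((hu.1.2.1.const_mul (R ^ 2)).add (hu.2.const_mul c⁻¹)).mono'
    ((continuous_norm.pow 2).mul (hu.1.1.continuous.norm.pow 2)).aestronglyMeasurable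
    (ae_of_all _ fun x => ?_)
  rw [Real.norm_of_nonneg (by positivity)]
  have h2 := hV.2.1 x
  simp only [Pi.add_apply]
  rcases le_or_gt R ‖x‖ with h | h
  · have h1 : ‖x‖ ^ 2 ≤ c⁻¹ * V x := by
      rw [le_inv_mul_iff₀ hc]
      exact hR x h
    have h3 : ‖x‖ ^ 2 * ‖u x‖ ^ 2 ≤ c⁻¹ * V x * ‖u x‖ ^ 2 := by gcongr
    nlinarith [mul_nonneg (sq_nonneg R) (sq_nonneg ‖u x‖)]
  · have h1 : ‖x‖ ^ 2 * ‖u x‖ ^ 2 ≤ R ^ 2 * ‖u x‖ ^ 2 := by gcongr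
    have h3 : 0 ≤ c⁻¹ * (V x * ‖u x‖ ^ 2) := by positivity
    linarith

/-- A lower bound for the one-body part of the energy. -/
theorem integral_gradAbsSq_sub_le {V : Plane → ℝ} {Ω m : ℝ} {u : Plane → ℂ} (hV : V110 V)
    (hm : ∀ x : Plane, -m ≤ V x - Ω ^ 2 / 4 * ‖x‖ ^ 2) (hu : InH V u) :
    (∫ x, gradAbsSq u x) - m * ∫ x, ‖u x‖ ^ 2 ≤
      (∫ x, (gradSq u x + V x * ‖u x‖ ^ 2)) - Ω * ∫ x, momentum u x := by
  have iM : Integrable (momentum u) :=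
    ((hV.integrable_norm_sq_mul hu).add hu.1.2.2).mono'
      (measurable_momentum hu.1.1).aestronglyMeasurable (ae_of_all _ (abs_momentum_le u))
  have iG := integrable_gradAbsSq hu.1
  have i1 : Integrable fun x => gradSq u x + V x * ‖u x‖ ^ 2 := hu.1.2.2.add hu.2
  rw [← integral_const_mul, ← integral_const_mul, ← integral_sub iG (hu.1.2.1.const_mul m),
    ← integral_sub i1 (iM.const_mul Ω)]
  refine integral_mono (iG.sub (hu.1.2.1.const_mul m)) (i1.sub (iM.const_mul Ω)) fun x => ?_
  have h1 := gradAbsSq_add_le hu.1.1 Ω x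
  have h2 := mul_le_mul_of_nonneg_right (hm x) (sq_nonneg ‖u x‖)
  dsimp only
  linarith

theorem energy_coercive :
    ∃ C : ℝ, 0 < C ∧
      ∀ V : Plane → ℝ, V110 V → ∀ Ω : ℝ, 0 ≤ Ω → SubCritical V Ω →
      ∀ Q : Plane → ℝ, IsGroundState Q →
      ∀ astar : ℝ, astar = (∫ x : Plane, (Q x) ^ 2) →
      ∀ a : ℝ, 0 < a → a < astar →
      ∃ M : ℝ, 0 < M ∧ (∀ x : Plane, -M < V x - Ω ^ 2 / 4 * ‖x‖ ^ 2) ∧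
        ∀ u ∈ Sset V a,
          (astar - a) / (2 * astar) * (∫ x : Plane, gradAbsSq u x)
              - C * a ^ 3 * astar / (astar - a) - a * M ≤ Ea V Ω u := by
  refine ⟨1, one_pos, fun V hV Ω hΩ hS Q hQ astar hA a ha haA => ?_⟩
  obtain ⟨m, hm0, hm⟩ := hS.exists_lower_bound hV.2.1 hΩ
  have hA0 : 0 < astar := ha.trans haA
  have hd : 0 < astar - a := sub_pos.2 haA
  have hAq : astar ≤ Real.pi * quarticConst := hA ▸ hQ.integral_sq_le
  set l := a ^ 2 / (astar - a) with hl
  have hl0 : 0 < l := by positivity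
  set k := ∫ x : Plane, logSing ‖x‖
  have hk : 0 ≤ k := integral_nonneg fun x => logSing_nonneg _
  have hlk : 0 ≤ l * k / 4 := by positivity
  refine ⟨m + l * k / 4 + 1, by positivity, fun x => by linarith [hm x], fun u hu => ?_⟩
  obtain ⟨hu, hua⟩ := hu
  have h1 := integral_gradAbsSq_sub_le hV hm hu
  have h2 := neg_mul_le_logConv hu.1 hl0
  have h3 := integral_norm_pow_four_le hu.1
  have hD0 : 0 ≤ ∫ x, ‖u x‖ ^ 4 := integral_nonneg fun x => by positivity
  rw [hua] at h1 h2 h3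
  rw [Ea]
  set G := ∫ x, gradAbsSq u x
  set D := ∫ x, ‖u x‖ ^ 4
  have h4 : D ≤ 2 * a / astar * G := by
    rw [div_mul_eq_mul_div, le_div_iff₀ hA0]
    nlinarith [mul_le_mul_of_nonneg_right hAq hD0]
  have h5 : 1 / (2 * l) * D * a ≤ (astar - a) / astar * G := by
    calc 1 / (2 * l) * D * a ≤ 1 / (2 * l) * (2 * a / astar * G) * a := by gcongr
      _ = (astar - a) / astar * G := by
        rw [hl]
        field_simp
  have h6 : 0 ≤ 1 * a ^ 3 * astar / (astar - a) := by positivity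
  have h7 : (astar - a) / (2 * astar) * G =
      G - 1 / 2 * (2 * a / astar * G) - 1 / 2 * ((astar - a) / astar * G) := by
    field_simp
    ring
  rw [h7]
  nlinarith

end
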